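/- arXiv:2006.02531 — 10 statements merged into one kernel-verified Lean document; each statement's English description precedes it below -/
import Mathlib

section
/- Let K be a field of characteristic zero, let Ω be an algebraic closure of K, and let f be a homogeneous polynomial of degree 3 in 4 variables with coefficients in K which defines a smooth cubic surface, i.e. there is no nonzero vector x ∈ Ω⁴ at which all four partial derivatives of f vanish simultaneously. If f has no nontrivial zero over K (that is, f(v) ≠ 0 for every nonzero v ∈ K⁴), then for every field extension L of K with [L : K] = 2, f has no nontrivial zero over L (that is, f(x) ≠ 0 for every nonzero x ∈ L⁴, where f is viewed in L via the inclusion of coefficients). -/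
/-- The exponents of a monomial of a form of degree `n` sum to `n`. -/
theorem MvPolynomial.IsHomogeneous.sum_eq_of_mem_support {σ R : Type*} [Fintype σ]
    [CommSemiring R] {f : MvPolynomial σ R} {n : ℕ} (hf : f.IsHomogeneous n) {d : σ →₀ ℕ}
    (hd : d ∈ f.support) : ∑ i, d i = n := by
  rw [← Finsupp.degree_eq_sum, Finsupp.degree_eq_weight_one]
  exact hf (mem_support_iff.mp hd)

/-- Substituting `c • g` in a homogeneous polynomial of degree `n` scales its value by `c ^ n`. -/
theorem MvPolynomial.aeval_mul_const_of_isHomogeneous {σ R A : Type*} [Fintype σ] [CommSemiring R]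
    [CommSemiring A] [Algebra R A] {f : MvPolynomial σ R} {n : ℕ} (hf : f.IsHomogeneous n)
    (c : A) (g : σ → A) : aeval (fun i => c * g i) f = c ^ n * aeval g f := by
  simp only [aeval_def, eval₂_eq', Finset.mul_sum]
  refine Finset.sum_congr rfl fun d hd => ?_
  simp only [mul_pow, Finset.prod_mul_distrib, Finset.prod_pow_eq_pow_sum,
    hf.sum_eq_of_mem_support hd]
  ring

open Polynomial in
/-- A product of powers of polynomials of degree at most one has degree at most the sum of the
exponents, and its coefficient there is the product of the powers of the linear coefficients. -/
theorem Polynomial.natDegree_le_and_coeff_prod_linear_pow {σ R : Type*} [CommSemiring R]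
    (u w : σ → R) (d : σ → ℕ) (s : Finset σ) :
    (∏ i ∈ s, (C (w i) * X + C (u i)) ^ d i).natDegree ≤ ∑ i ∈ s, d i ∧
      (∏ i ∈ s, (C (w i) * X + C (u i)) ^ d i).coeff (∑ i ∈ s, d i) = ∏ i ∈ s, w i ^ d i := by
  classical
  induction s using Finset.induction_on with
  | empty => simp
  | insert a s ha ih =>
    simp only [Finset.prod_insert ha, Finset.sum_insert ha]
    have h1 : (C (w a) * X + C (u a)).natDegree ≤ 1 := natDegree_linear_le
    have h2 : ((C (w a) * X + C (u a)) ^ d a).natDegree ≤ d a := by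
      simpa using natDegree_pow_le_of_le (d a) h1
    refine ⟨natDegree_mul_le_of_le h2 ih.1, ?_⟩
    rw [coeff_mul_add_eq_of_natDegree_le h2 ih.1, ih.2]
    have h3 := coeff_pow_of_natDegree_le (m := d a) h1
    rw [mul_one] at h3
    simp [h3]

open Polynomial in
/-- The restriction of a form of degree `n` to the line `u + t w` has degree at most `n` in `t`,
and its coefficient of degree `n` is the value of the form at `w`. -/
theorem Polynomial.natDegree_le_and_coeff_aeval_line {σ R : Type*} [Fintype σ]
    [CommSemiring R] {f : MvPolynomial σ R} {n : ℕ} (hf : f.IsHomogeneous n) (u w : σ → R) :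
    (MvPolynomial.aeval (fun i => C (w i) * X + C (u i)) f).natDegree ≤ n ∧
      (MvPolynomial.aeval (fun i => C (w i) * X + C (u i)) f).coeff n =
        MvPolynomial.eval w f := by
  rw [MvPolynomial.aeval_def, MvPolynomial.eval₂_eq', MvPolynomial.eval_eq']
  simp only [algebraMap_eq]
  refine ⟨natDegree_sum_le_of_forall_le _ _ fun d hd => ?_, ?_⟩
  · have h := (natDegree_le_and_coeff_prod_linear_pow u w d Finset.univ).1
    rw [hf.sum_eq_of_mem_support hd] at h
    exact (natDegree_C_mul_le _ _).trans h
  · rw [finsetSum_coeff]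
    refine Finset.sum_congr rfl fun d hd => ?_
    have h := (natDegree_le_and_coeff_prod_linear_pow u w d Finset.univ).2
    rw [hf.sum_eq_of_mem_support hd] at h
    rw [coeff_C_mul, h]

open Polynomial in
/-- A cubic polynomial with a root generating a quadratic extension has a root in the base. -/
theorem Polynomial.exists_isRoot_of_natDegree_eq_three {K L : Type*} [Field K] [Field L]
    [Algebra K L] (hL : Module.finrank K L = 2) {θ : L} (hθ : θ ∉ (algebraMap K L).range)
    {p : K[X]} (hp : p.natDegree = 3) (hroot : aeval θ p = 0) : ∃ r, p.IsRoot r := by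
  have : FiniteDimensional K L := Module.finite_of_finrank_eq_succ hL
  have hint : IsIntegral K θ := Algebra.IsIntegral.isIntegral θ
  have hm : (minpoly K θ).natDegree = 2 :=
    le_antisymm (hL ▸ minpoly.natDegree_le θ) ((minpoly.two_le_natDegree_iff hint).2 hθ)
  obtain ⟨q, rfl⟩ := minpoly.dvd K θ hroot
  have hq : q ≠ 0 := by rintro rfl; simp at hp
  rw [natDegree_mul (minpoly.ne_zero hint) hq, hm] at hp
  obtain ⟨r, hr⟩ := exists_root_of_degree_eq_one
    ((degree_eq_iff_natDegree_eq_of_pos one_pos).2 (by omega : q.natDegree = 1))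
  exact ⟨r, root_mul_left_of_isRoot _ hr⟩

/-- Any element of a quadratic extension outside the base forms a basis together with `1`. -/
theorem exists_eq_add_mul_of_finrank_eq_two {K L : Type*} [Field K] [Field L] [Algebra K L]
    (hL : Module.finrank K L = 2) {θ : L} (hθ : θ ∉ (algebraMap K L).range) (y : L) :
    ∃ a b : K, y = algebraMap K L a + θ * algebraMap K L b := by
  have hli : LinearIndependent K ![(1 : L), θ] := by
    rw [LinearIndependent.pair_iff' one_ne_zero]
    intro a ha
    exact hθ ⟨a, by rw [← ha, Algebra.smul_def, mul_one]⟩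
  have hspan := hli.span_eq_top_of_card_eq_finrank (by simp [hL])
  have hy : y ∈ Submodule.span K (Set.range ![(1 : L), θ]) := hspan ▸ Submodule.mem_top
  rw [Matrix.range_cons_cons_empty, Submodule.mem_span_pair] at hy
  obtain ⟨a, b, rfl⟩ := hy
  exact ⟨a, b, by simp only [Algebra.smul_def]; ring⟩

/-- A cubic form without nontrivial zeros over `K` has none over a quadratic extension. -/
theorem MvPolynomial.aeval_ne_zero_of_finrank_eq_two {σ K L : Type*} [Fintype σ]
    [Field K] [Field L] [Algebra K L] (hL : Module.finrank K L = 2) {f : MvPolynomial σ K}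
    (hf : f.IsHomogeneous 3) (hK : ∀ v : σ → K, v ≠ 0 → eval v f ≠ 0) (x : σ → L) (hx : x ≠ 0) :
    aeval x f ≠ 0 := by
  have haeval : ∀ v : σ → K, aeval (fun i => algebraMap K L (v i)) f =
      algebraMap K L (eval v f) := fun v =>
    (eval₂_comp (algebraMap K L) v f).symm
  have hKL : ∀ v : σ → K, v ≠ 0 → aeval (fun i => algebraMap K L (v i)) f ≠ 0 := fun v hv => by
    rw [haeval]
    exact (map_ne_zero _).2 (hK v hv)
  obtain ⟨θ, hθ⟩ : ∃ θ : L, θ ∉ (algebraMap K L).range := by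
    by_contra! h
    have hbot : (⊥ : Subalgebra K L) = ⊤ := eq_top_iff.2 fun y _ => h y
    have hone := Subalgebra.bot_eq_top_iff_finrank_eq_one.1 hbot
    omega
  choose u w hxuw using fun i => exists_eq_add_mul_of_finrank_eq_two hL hθ (x i)
  intro hx0
  by_cases hw : w = 0
  · have hxu : x = fun i => algebraMap K L (u i) := by ext i; simp [hxuw i, hw]
    refine hKL u ?_ (hxu ▸ hx0)
    rintro rfl
    exact hx (by ext i; simp [hxu])
  set p : Polynomial K :=
    aeval (fun i => Polynomial.C (w i) * Polynomial.X + Polynomial.C (u i)) f with hpdef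
  obtain ⟨hdeg, hcoeff⟩ := Polynomial.natDegree_le_and_coeff_aeval_line hf u w
  have hp : p.natDegree = 3 :=
    le_antisymm hdeg (Polynomial.le_natDegree_of_ne_zero (hcoeff ▸ hK w hw))
  have hroot : Polynomial.aeval θ p = 0 := by
    rw [← hx0, hpdef, comp_aeval_apply]
    congr 2
    ext i
    simp [hxuw i]
    ring
  obtain ⟨r, hr⟩ := Polynomial.exists_isRoot_of_natDegree_eq_three hL hθ hp hroot
  have hr0 : eval (fun i => w i * r + u i) f = 0 := by
    have h : Polynomial.aeval r p = 0 := by rw [Polynomial.coe_aeval_eq_eval]; exact hr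
    rw [hpdef, comp_aeval_apply] at h
    simpa [aeval_eq_eval] using h
  have hline : (fun i => w i * r + u i) = 0 := by
    by_contra h
    exact hK _ h hr0
  have hxw : x = fun i => (θ - algebraMap K L r) * algebraMap K L (w i) := by
    ext i
    have hi : u i = -(w i * r) := eq_neg_of_add_eq_zero_right (congrFun hline i)
    rw [hxuw i, hi, map_neg, map_mul]
    ring
  rw [hxw, aeval_mul_const_of_isHomogeneous hf] at hx0
  refine mul_ne_zero (pow_ne_zero _ (sub_ne_zero.2 ?_)) (hKL w hw) hx0
  rintro rfl
  exact hθ ⟨r, rfl⟩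

/-- Lemma 2.2: A smooth cubic surface over a field `K` of characteristic zero with no
`K`-points has no points of degree 2, i.e. no nontrivial zeros over any quadratic
extension of `K`. -/
theorem cubic_no_degree_two_points
    (K Ω : Type) [Field K] [CharZero K] [Field Ω] [Algebra K Ω] [IsAlgClosure K Ω]
    (f : MvPolynomial (Fin 4) K) (hf : f.IsHomogeneous 3)
    (hsmooth : ∀ x : Fin 4 → Ω, x ≠ 0 →
      ∃ i : Fin 4, MvPolynomial.eval x
        (MvPolynomial.map (algebraMap K Ω) (MvPolynomial.pderiv i f)) ≠ 0)
    (hnoK : ∀ v : Fin 4 → K, v ≠ 0 → MvPolynomial.eval v f ≠ 0)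
    (L : Type) [Field L] [Algebra K L] (hL : Module.finrank K L = 2) :
    ∀ x : Fin 4 → L, x ≠ 0 →
      MvPolynomial.eval x (MvPolynomial.map (algebraMap K L) f) ≠ 0 := by
  intro x hx
  rw [MvPolynomial.eval_map, ← MvPolynomial.aeval_def]
  exact MvPolynomial.aeval_ne_zero_of_finrank_eq_two hL hf hnoK x hx
end

section
/- Let K be a field of characteristic zero, let Ω be an algebraic closure of K, and let q₁, q₂ be homogeneous polynomials of degree 2 in 5 variables with coefficients in K such that the common projective zero locus {q₁ = q₂ = 0} ⊂ P⁴ is smooth, i.e. for every nonzero x ∈ Ω⁵ with q₁(x) = q₂(x) = 0, the 2×5 Jacobian matrix (∂qᵢ/∂xⱼ evaluated at x) has rank 2. If there exist a field extension L of K with [L : K] = 3 and a nonzero vector x ∈ L⁵ with q₁(x) = q₂(x) = 0 (the qᵢ viewed over L via the inclusion of coefficients), then there exists a nonzero vector v ∈ K⁵ with q₁(v) = q₂(v) = 0. -/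
open MvPolynomial in
/-- The restriction of a linear form to the span of three vectors is a linear form in three
variables. -/
theorem exists_aeval_linear_combination_eq_of_isHomogeneous_one {σ K : Type*} [Field K]
    {l : MvPolynomial σ K} (hl : l.IsHomogeneous 1) (a b c : σ → K) (L : Type*) [Field L]
    [Algebra K L] :
    ∃ r s t : K, ∀ X Y Z : L, aeval (fun i => a i • X + b i • Y + c i • Z) l =
      r • X + s • Y + t • Z := by
  rw [← mem_homogeneousSubmodule, homogeneousSubmodule_one_eq_span_X] at hl
  induction hl using Submodule.span_induction with
  | mem _ h =>
    obtain ⟨i, rfl⟩ := h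
    exact ⟨a i, b i, c i, fun X Y Z => by simp⟩
  | zero => exact ⟨0, 0, 0, by simp⟩
  | add _ _ _ _ hp hq =>
    obtain ⟨r, s, t, h⟩ := hp
    obtain ⟨r', s', t', h'⟩ := hq
    exact ⟨r + r', s + s', t + t', fun X Y Z => by rw [map_add, h, h']; module⟩
  | smul k _ _ hp =>
    obtain ⟨r, s, t, h⟩ := hp
    exact ⟨k * r, k * s, k * t, fun X Y Z => by rw [map_smul, h]; module⟩

open MvPolynomial in
/-- The restriction of a quadratic form to the span of three vectors is a quadratic form in three
variables. -/
theorem exists_aeval_linear_combination_eq_of_isHomogeneous_two {σ K : Type*} [Field K]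
    {q : MvPolynomial σ K} (hq : q.IsHomogeneous 2) (a b c : σ → K) (L : Type*) [Field L]
    [Algebra K L] :
    ∃ k : Fin 6 → K, ∀ X Y Z : L, aeval (fun i => a i • X + b i • Y + c i • Z) q =
      k 0 • X ^ 2 + k 1 • (X * Y) + k 2 • Y ^ 2 + k 3 • (X * Z) + k 4 • (Y * Z) +
        k 5 • Z ^ 2 := by
  rw [← mem_homogeneousSubmodule, ← homogeneousSubmodule_one_pow, pow_two] at hq
  induction hq using Submodule.mul_induction_on' with
  | mem_mul_mem m hm n hn =>
    obtain ⟨r, s, t, h⟩ := exists_aeval_linear_combination_eq_of_isHomogeneous_one hm a b c L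
    obtain ⟨r', s', t', h'⟩ := exists_aeval_linear_combination_eq_of_isHomogeneous_one hn a b c L
    refine ⟨![r * r', r * s' + s * r', s * s', r * t' + t * r', s * t' + t * s', t * t'],
      fun X Y Z => ?_⟩
    rw [map_mul, h, h']
    simp only [Algebra.smul_def, Fin.isValue, Matrix.cons_val, map_add, map_mul]
    ring
  | add _ _ _ _ hp hq =>
    obtain ⟨k, h⟩ := hp
    obtain ⟨k', h'⟩ := hq
    exact ⟨k + k', fun X Y Z => by rw [map_add, h, h']; simp only [Pi.add_apply]; module⟩

/-- In a cubic field extension, the powers `1, θ, θ²` of any element `θ` outside the base field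
form a basis. -/
theorem exists_basis_pow_of_finrank_eq_three {K L : Type*} [Field K] [Field L] [Algebra K L]
    (h3 : Module.finrank K L = 3) {θ : L} (hθ : θ ∉ (algebraMap K L).range) :
    ∃ B : Module.Basis (Fin 3) K L, ∀ i, B i = θ ^ (i : ℕ) := by
  have : FiniteDimensional K L := FiniteDimensional.of_finrank_pos (by omega)
  have hint : IsIntegral K θ := Algebra.IsIntegral.isIntegral θ
  have hdeg : (minpoly K θ).natDegree = 3 := by
    have hdvd := minpoly.degree_dvd hint
    rw [h3] at hdvd
    refine ((Nat.dvd_prime Nat.prime_three).mp hdvd).resolve_left fun h => hθ ?_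
    exact minpoly.natDegree_eq_one_iff.mp h
  have hli : LinearIndependent K fun i : Fin 3 => θ ^ (i : ℕ) := by
    have := linearIndependent_pow (K := K) θ
    rwa [hdeg] at this
  exact ⟨basisOfLinearIndependentOfCardEqFinrank hli (by simp [h3]), by simp⟩

/-- Two homogeneous linear equations in three unknowns have a nontrivial solution. -/
theorem exists_ne_zero_of_two_linear_equations {K : Type*} [Field K] (u v : Fin 3 → K) :
    ∃ w : Fin 3 → K, w ≠ 0 ∧ u 0 * w 0 + u 1 * w 1 + u 2 * w 2 = 0 ∧
      v 0 * w 0 + v 1 * w 1 + v 2 * w 2 = 0 := by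
  have hker := LinearMap.ker_ne_bot_of_finrank_lt (f := (Matrix.of ![u, v]).mulVecLin) (by simp)
  obtain ⟨w, hw, hw0⟩ := (Submodule.ne_bot_iff _).mp hker
  have h : (Matrix.of ![u, v]).mulVec w = 0 := hw
  refine ⟨w, hw0, ?_, ?_⟩
  · simpa [Matrix.mulVec, dotProduct, Fin.sum_univ_three] using congrFun h 0
  · simpa [Matrix.mulVec, dotProduct, Fin.sum_univ_three] using congrFun h 1

/-- If a nonzero vector `w` is orthogonal to `s` and `t`, then every vector orthogonal to `w` is
orthogonal to the cross product of `s` and `t`. -/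
theorem dot_cross_eq_zero_of_orthogonal {K : Type*} [Field K] {w s t k : Fin 3 → K} (hw : w ≠ 0)
    (hs : w 0 * s 0 + w 1 * s 1 + w 2 * s 2 = 0) (ht : w 0 * t 0 + w 1 * t 1 + w 2 * t 2 = 0)
    (hk : k 0 * w 0 + k 1 * w 1 + k 2 * w 2 = 0) :
    k 0 * (s 1 * t 2 - s 2 * t 1) + k 1 * (s 2 * t 0 - s 0 * t 2) +
      k 2 * (s 0 * t 1 - s 1 * t 0) = 0 := by
  obtain ⟨i, hi⟩ := Function.ne_iff.mp hw
  apply (mul_eq_zero.mp _).resolve_left hi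
  fin_cases i <;> dsimp
  · linear_combination (s 1 * t 2 - s 2 * t 1) * hk + (k 2 * t 1 - k 1 * t 2) * hs +
      (k 1 * s 2 - k 2 * s 1) * ht
  · linear_combination (s 2 * t 0 - s 0 * t 2) * hk + (k 0 * t 2 - k 2 * t 0) * hs +
      (k 2 * s 0 - k 0 * s 2) * ht
  · linear_combination (s 0 * t 1 - s 1 * t 0) * hk + (k 1 * t 0 - k 0 * t 1) * hs +
      (k 0 * s 1 - k 1 * s 0) * ht

open MvPolynomial in
/-- Two quadratic forms over a field with a common nontrivial zero over a cubic extension have a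
common nontrivial zero. -/
theorem exists_common_zero_of_cubic_extension {σ K L : Type*} [Field K] [Field L] [Algebra K L]
    (q : Fin 2 → MvPolynomial σ K) (hq : ∀ i, (q i).IsHomogeneous 2)
    (h3 : Module.finrank K L = 3) {x : σ → L} (hx : x ≠ 0) (hqx : ∀ i, aeval x (q i) = 0) :
    ∃ v : σ → K, v ≠ 0 ∧ ∀ i, eval v (q i) = 0 := by
  obtain ⟨j₀, hj₀⟩ := Function.ne_iff.mp hx
  -- Rescale `x` so that its coordinate at `j₀` is `1`.
  obtain ⟨y, hy₀, hqy⟩ : ∃ y : σ → L, y j₀ = 1 ∧ ∀ i, aeval y (q i) = 0 := by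
    refine ⟨(x j₀)⁻¹ • x, inv_mul_cancel₀ hj₀, fun i => ?_⟩
    obtain ⟨k, hk⟩ := exists_aeval_linear_combination_eq_of_isHomogeneous_two
      ((hq i).map (algebraMap K L)) x 0 0 L
    have h₁ := hk 1 0 0
    have h₂ := hk (x j₀)⁻¹ 0 0
    simp only [aeval_map_algebraMap, Pi.zero_apply, smul_eq_mul, mul_one, mul_zero, add_zero,
      one_pow, ne_eq, OfNat.ofNat_ne_zero, not_false_eq_true, zero_pow] at h₁ h₂
    rw [hqx i] at h₁
    rw [← h₁, zero_mul] at h₂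
    simpa [Pi.smul_def, mul_comm] using h₂
  have heval (v : σ → K) (i : Fin 2) (h : aeval (fun j => algebraMap K L (v j)) (q i) = 0) :
      eval v (q i) = 0 := by
    have h' := aeval_algebraMap_apply L v (q i)
    simpa [Function.comp_def, h] using h'.symm
  by_cases hrange : ∀ j, y j ∈ (algebraMap K L).range
  · choose v hv using hrange
    refine ⟨v, fun h => ?_, fun i => heval v i ?_⟩
    · simpa [h, hy₀] using hv j₀
    · simpa [hv] using hqy i
  push Not at hrange
  obtain ⟨j₁, hj₁⟩ := hrange
  set θ := y j₁ with hθ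
  obtain ⟨B, hB⟩ := exists_basis_pow_of_finrank_eq_three h3 hj₁
  have hsum (z : L) : z = B.repr z 0 • 1 + B.repr z 1 • θ + B.repr z 2 • θ ^ 2 := by
    conv_lhs => rw [← B.sum_repr z]
    simp [Fin.sum_univ_three, hB]
  have hrepr (r s t : K) : (B.repr (r • 1 + s • θ + t • θ ^ 2) : Fin 3 → K) = ![r, s, t] := by
    have : r • 1 + s • θ + t • θ ^ 2 = ∑ i, ![r, s, t] i • B i := by
      simp [Fin.sum_univ_three, hB]
    rw [this, B.repr_sum_self]
  obtain ⟨w, r, p, hcubic⟩ : ∃ w r p : K, θ ^ 3 = w • 1 + r • θ + p • θ ^ 2 :=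
    ⟨_, _, _, hsum (θ ^ 3)⟩
  set a : σ → K := fun j => B.repr (y j) 0 with ha
  set b : σ → K := fun j => B.repr (y j) 1 with hb
  set c : σ → K := fun j => B.repr (y j) 2 with hc
  have hy : y = fun j => a j • 1 + b j • θ + c j • θ ^ 2 := funext fun j => hsum (y j)
  have h₀ : (B.repr (y j₀) : Fin 3 → K) = ![1, 0, 0] := by
    rw [← hrepr, hy₀]; simp
  have h₁ : (B.repr (y j₁) : Fin 3 → K) = ![0, 1, 0] := by
    rw [← hrepr, ← hθ]; simp
  choose k hk using fun i =>
    exists_aeval_linear_combination_eq_of_isHomogeneous_two (hq i) a b c L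
  -- The three linear conditions on the restricted forms imposed by vanishing at `(1, θ, θ²)`.
  have hcond (i : Fin 2) : k i 0 + w * k i 4 + p * w * k i 5 = 0 ∧
      k i 1 + r * k i 4 + (p * r + w) * k i 5 = 0 ∧
      k i 2 + k i 3 + p * k i 4 + (p ^ 2 + r) * k i 5 = 0 := by
    have h := hk i 1 θ (θ ^ 2)
    rw [← hy, hqy i] at h
    have h' := hrepr (k i 0 + w * k i 4 + p * w * k i 5)
      (k i 1 + r * k i 4 + (p * r + w) * k i 5)
      (k i 2 + k i 3 + p * k i 4 + (p ^ 2 + r) * k i 5)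
    have hz : (k i 0 + w * k i 4 + p * w * k i 5) • 1 +
      (k i 1 + r * k i 4 + (p * r + w) * k i 5) • θ +
      (k i 2 + k i 3 + p * k i 4 + (p ^ 2 + r) * k i 5) • θ ^ 2 = 0 := by
      simp only [Algebra.smul_def, map_add, map_mul, map_pow] at h hcubic ⊢
      linear_combination -h - (algebraMap K L (k i 4) + algebraMap K L (k i 5) *
        (θ + algebraMap K L p)) * hcubic
    rw [hz] at h'
    exact ⟨by simpa using (congrFun h' 0).symm, by simpa using (congrFun h' 1).symm,
      by simpa using (congrFun h' 2).symm⟩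
  have hzero (X Y Z : K) (i : Fin 2)
      (h : k i 0 * X ^ 2 + k i 1 * (X * Y) + k i 2 * Y ^ 2 + k i 3 * (X * Z) + k i 4 * (Y * Z) +
        k i 5 * Z ^ 2 = 0) : eval (fun j => a j * X + b j * Y + c j * Z) (q i) = 0 := by
    apply heval
    have h' := hk i (algebraMap K L X) (algebraMap K L Y) (algebraMap K L Z)
    simp only [Algebra.smul_def, ← map_mul, ← map_add, ← map_pow, h, map_zero] at h'
    exact h'
  -- The restricted forms are combinations of the `2 × 2` minors of a `3 × 2` matrix of linear
  -- forms; `n` is orthogonal to both coefficient vectors.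
  obtain ⟨n, hn, hn₀, hn₁⟩ := exists_ne_zero_of_two_linear_equations
    ![-k 0 5, k 0 4 + p * k 0 5, k 0 3 + p * (k 0 4 + p * k 0 5)]
    ![-k 1 5, k 1 4 + p * k 1 5, k 1 3 + p * (k 1 4 + p * k 1 5)]
  obtain ⟨m, hm, hm₀, hm₁⟩ := exists_ne_zero_of_two_linear_equations
    n ![n 2 * w, n 0 + n 2 * r, n 1 + n 2 * p]
  have hQ (i : Fin 2) : k i 0 * m 0 ^ 2 + k i 1 * (m 0 * m 1) + k i 2 * m 1 ^ 2 +
      k i 3 * (m 0 * m 2) + k i 4 * (m 1 * m 2) + k i 5 * m 2 ^ 2 = 0 := by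
    have hni : -k i 5 * n 0 + (k i 4 + p * k i 5) * n 1 +
        (k i 3 + p * (k i 4 + p * k i 5)) * n 2 = 0 := by
      fin_cases i
      · simpa using hn₀
      · simpa using hn₁
    have h := dot_cross_eq_zero_of_orthogonal hn (s := m)
      (t := ![m 1, m 2, w * m 0 + r * m 1 + p * m 2])
      (k := ![-k i 5, k i 4 + p * k i 5, k i 3 + p * (k i 4 + p * k i 5)]) hm₀
      (by simp at hm₁ ⊢; linear_combination hm₁) (by simpa using hni)
    obtain ⟨c₀, c₁, c₂⟩ := hcond i
    simp at h
    linear_combination (m 0) ^ 2 * c₀ + m 0 * m 1 * c₁ + m 1 ^ 2 * c₂ + h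
  by_cases hv : (fun j => a j * m 0 + b j * m 1 + c j * m 2) = 0
  · have hm0 : m 0 = 0 := by simpa [ha, hb, hc, h₀] using congrFun hv j₀
    have hm1 : m 1 = 0 := by simpa [ha, hb, hc, h₁] using congrFun hv j₁
    have hm2 : m 2 ≠ 0 := fun h => hm (by ext i; fin_cases i <;> simpa)
    have hc0 : c = 0 := funext fun j => by simpa [hm0, hm1, hm2] using congrFun hv j
    refine ⟨a, fun h => by simpa [ha, h₀] using congrFun h j₀, fun i => ?_⟩
    have e₀ := hk i 0 0 0
    have e₁ := hk i 0 0 1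
    have e₂ := hk i 0 1 0
    have e₃ := hk i 0 1 1
    simp only [hc0, Pi.zero_apply, smul_zero, zero_smul, add_zero, zero_add, mul_zero, mul_one,
      one_pow, ne_eq, OfNat.ofNat_ne_zero, not_false_eq_true, zero_pow] at e₀ e₁ e₂ e₃
    have h5 : k i 5 = 0 := by
      rw [e₀] at e₁
      simpa using e₁.symm
    have h4 : k i 4 = 0 := by
      rw [e₂, h5] at e₃
      simpa using e₃
    have hk0 : k i 0 = 0 := by simpa [h4, h5] using (hcond i).1
    simpa using hzero 1 0 0 i (by simp [hk0])
  · exact ⟨_, hv, fun i => hzero _ _ _ i (hQ i)⟩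

/-- The elementary claim inside Lemma 2.4: a smooth intersection of two quadrics in `P⁴`
over a field `K` of characteristic zero having a point of degree 3 over `K` also has a
`K`-point. -/
theorem dP4_point_of_degree_three_point
    (K Ω : Type) [Field K] [CharZero K] [Field Ω] [Algebra K Ω] [IsAlgClosure K Ω]
    (q : Fin 2 → MvPolynomial (Fin 5) K) (hq : ∀ i, (q i).IsHomogeneous 2)
    (hsmooth : ∀ x : Fin 5 → Ω, x ≠ 0 →
      (∀ i, MvPolynomial.eval x (MvPolynomial.map (algebraMap K Ω) (q i)) = 0) →
      (Matrix.of fun (i : Fin 2) (j : Fin 5) =>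
        MvPolynomial.eval x
          (MvPolynomial.map (algebraMap K Ω) (MvPolynomial.pderiv j (q i)))).rank = 2)
    (hpoint : ∃ (L : Type) (_ : Field L) (_ : Algebra K L),
      Module.finrank K L = 3 ∧
      ∃ x : Fin 5 → L, x ≠ 0 ∧
        ∀ i, MvPolynomial.eval x (MvPolynomial.map (algebraMap K L) (q i)) = 0) :
    ∃ v : Fin 5 → K, v ≠ 0 ∧ ∀ i, MvPolynomial.eval v (q i) = 0 := by
  obtain ⟨L, _, _, h3, x, hx, hqx⟩ := hpoint
  refine exists_common_zero_of_cubic_extension q hq h3 hx fun i => ?_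
  rw [MvPolynomial.aeval_def, MvPolynomial.eval₂_eq_eval_map, hqx]
end

section
/- Let H be a subgroup of the group GA₂(F₃) of affine automorphisms of the affine plane A²(F₃) over the field F₃ with three elements, i.e. the group of bijections of F₃² of the form x ↦ Ax + b with A ∈ GL₂(F₃) and b ∈ F₃² (equivalently, the group of affine equivalences of the F₃-module F₃ × F₃). If there is no point of F₃² that is fixed by every element of H, then H contains an element of order 3. -/
/-- A finite group of affine automorphisms of a vector space whose order is nonzero in the base
field has a fixed point, namely the centroid of the orbit of the origin. -/
theorem AffineEquiv.exists_fixed_point_of_card_ne_zero {k V : Type*} [Field k] [AddCommGroup V]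
    [Module k V] (H : Subgroup (V ≃ᵃ[k] V)) [Finite H] (hcard : (Nat.card H : k) ≠ 0) :
    ∃ p : V, ∀ g ∈ H, g p = p := by
  have := Fintype.ofFinite H
  have hdecomp (g : V ≃ᵃ[k] V) (v : V) : g v = g.linear v + g 0 := by
    simpa using g.map_vadd 0 v
  set s : V := ∑ h : H, h.1 0 with hs
  refine ⟨(Nat.card H : k)⁻¹ • s, fun g hg => ?_⟩
  have hsum : s = g.linear s + (Nat.card H : k) • g 0 := by
    calc s = ∑ h : H, ((⟨g, hg⟩ * h : H) : V ≃ᵃ[k] V) 0 :=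
          (Equiv.sum_comp (Equiv.mulLeft (⟨g, hg⟩ : H)) fun h : H => h.1 0).symm
      _ = ∑ h : H, (g.linear (h.1 0) + g 0) := Finset.sum_congr rfl fun h _ => hdecomp g (h.1 0)
      _ = _ := by
        simp [Finset.sum_add_distrib, hs, Nat.card_eq_fintype_card, Nat.cast_smul_eq_nsmul]
  calc g ((Nat.card H : k)⁻¹ • s)
      = (Nat.card H : k)⁻¹ • (g.linear s + (Nat.card H : k) • g 0) := by
        rw [hdecomp, map_smul, smul_add, inv_smul_smul₀ hcard]
    _ = (Nat.card H : k)⁻¹ • s := by rw [← hsum]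

/-- Lemma 4.1: a subgroup of the affine automorphism group `GA₂(F₃)` of the affine
plane over `F₃` acting without fixed points on `A²(F₃)` contains an element of order 3. -/
theorem affine_group_F3_no_fixed_point_order_three
    (H : Subgroup ((ZMod 3 × ZMod 3) ≃ᵃ[ZMod 3] (ZMod 3 × ZMod 3)))
    (hfix : ¬ ∃ p : ZMod 3 × ZMod 3, ∀ g ∈ H, g p = p) :
    ∃ g ∈ H, orderOf g = 3 := by
  have : Finite ((ZMod 3 × ZMod 3) ≃ᵃ[ZMod 3] (ZMod 3 × ZMod 3)) :=
    Finite.of_injective _ DFunLike.coe_injective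
  have hdvd : 3 ∣ Nat.card H := by
    rw [← ZMod.natCast_eq_zero_iff]
    by_contra hcard
    exact hfix (AffineEquiv.exists_fixed_point_of_card_ne_zero H hcard)
  obtain ⟨g, hg⟩ := exists_prime_orderOf_dvd_card' 3 hdvd
  exact ⟨g, g.2, by rwa [Subgroup.orderOf_coe]⟩
end

section
/- Let K be a field of characteristic zero, let Ω be an algebraic closure of K, and let f be a homogeneous polynomial of degree 3 in 3 variables with coefficients in K defining a smooth plane cubic curve, i.e. there is no nonzero x ∈ Ω³ at which all three partial derivatives of f vanish simultaneously. Call a point of the projective plane P²(Ω) (an equivalence class of nonzero vectors of Ω³ up to Ω*-scaling) an inflection point of the curve {f = 0} if f and the determinant of the 3×3 Hessian matrix of second partial derivatives of f both vanish at (any representative of) it. Suppose that no inflection point has a representative in K³ (i.e., the set Σ of inflection points satisfies Σ(K) = ∅). Then there exists a K-algebra automorphism σ of Ω such that the permutation that σ induces on the (finite) set of inflection points (via the coordinatewise action of σ on Ω³) has order exactly 3. -/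
/-- The substitution setting the variables of index less than `k` to zero. -/
noncomputable def MvPolynomial.killInitial {F : Type*} [CommSemiring F] {n : ℕ} (k : ℕ) :
    MvPolynomial (Fin n) F →ₐ[F] MvPolynomial (Fin n) F :=
  MvPolynomial.aeval fun i => if (i : ℕ) < k then 0 else MvPolynomial.X i

theorem MvPolynomial.natCast_le_height_vanishingIdeal_zero {F : Type*} [Field F] {n : ℕ} :
    (n : ℕ∞) ≤ (MvPolynomial.vanishingIdeal F {(0 : Fin n → F)}).height := by
  let P : ℕ → Ideal (MvPolynomial (Fin n) F) := fun k =>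
    RingHom.ker (MvPolynomial.killInitial (F := F) (n := n) k)
  have hprime : ∀ k, (P k).IsPrime := fun k => RingHom.ker_isPrime _
  have hcomp : ∀ k, (MvPolynomial.killInitial (F := F) (n := n) (k + 1)).comp
      (MvPolynomial.killInitial k) = MvPolynomial.killInitial (k + 1) := by
    intro k
    ext1 i
    by_cases h : (i : ℕ) < k
    · simp [killInitial, h]
      omega
    · simp [killInitial, h]
  have hle : ∀ k, P k ≤ P (k + 1) := by
    intro k p hp
    rw [RingHom.mem_ker] at hp ⊢
    rw [← hcomp k, AlgHom.comp_apply, hp, map_zero]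
  have hlt : ∀ k, k < n → P k < P (k + 1) := by
    intro k hk
    refine lt_of_le_of_ne (hle k) fun h => ?_
    have h1 : (X ⟨k, hk⟩ : MvPolynomial (Fin n) F) ∈ P (k + 1) := by
      simp [P, RingHom.mem_ker, killInitial]
    rw [← h] at h1
    simp [P, RingHom.mem_ker, killInitial] at h1
  have hheight : ∀ k, k ≤ n → (k : ℕ∞) ≤ (P k).height := by
    intro k
    induction k with
    | zero => simp
    | succ k ih =>
      intro hk
      have := hprime k
      have := hprime (k + 1)
      have h := Ideal.height_add_one_le_of_lt_of_isPrime (hlt k hk)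
      push_cast
      exact (add_le_add_left (ih (by omega)) 1).trans h
  refine (hheight n le_rfl).trans (Ideal.height_mono fun p hp => ?_)
  rw [MvPolynomial.mem_vanishingIdeal_singleton_iff]
  have h0 : (aeval (0 : Fin n → F)).comp (killInitial (F := F) n) = aeval (0 : Fin n → F) := by
    ext i
    simp [killInitial]
  rw [← h0, AlgHom.comp_apply, RingHom.mem_ker.1 hp, map_zero]

/-- Two polynomials in three variables that vanish at the origin have another common zero. -/
theorem MvPolynomial.exists_common_zero_ne_zero {F : Type*} [Field F] [IsAlgClosed F]
    (f g : MvPolynomial (Fin 3) F) (hf : eval 0 f = 0) (hg : eval 0 g = 0) :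
    ∃ x : Fin 3 → F, x ≠ 0 ∧ eval x f = 0 ∧ eval x g = 0 := by
  by_contra! hcon
  have hV : zeroLocus F (Ideal.span {f, g}) = {(0 : Fin 3 → F)} := by
    rw [zeroLocus_span]
    ext x
    simp only [Set.mem_insert_iff, Set.mem_singleton_iff, forall_eq_or_imp, forall_eq,
      Set.mem_ofPred_eq, aeval_eq_eval]
    constructor
    · rintro ⟨h1, h2⟩
      by_contra hx
      exact hcon x hx h1 h2
    · rintro rfl
      exact ⟨hf, hg⟩
  have hrad := vanishingIdeal_zeroLocus_eq_radical (K := F) (Ideal.span {f, g})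
  rw [hV] at hrad
  have hmem : vanishingIdeal F {(0 : Fin 3 → F)} ∈ (Ideal.span {f, g}).minimalPrimes := by
    rw [← Ideal.radical_minimalPrimes, ← hrad, Ideal.minimalPrimes_eq_subsingleton_self]
    rfl
  have h1 := (natCast_le_height_vanishingIdeal_zero (F := F) (n := 3)).trans
    (Ideal.height_le_card_of_mem_minimalPrimes_span (by simp) hmem)
  have h2 := Set.ncard_insert_le f {g}
  rw [Set.ncard_singleton] at h2
  have h3 := Nat.cast_le.1 h1
  omega

theorem Equiv.Perm.exists_orderOf_eq_three_or_exists_fixed {S : Type*} [Finite S]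
    (hcard : Nat.card S = 9) (H : Subgroup (Equiv.Perm S))
    (hι : ∀ p : S, ∃ ι : S → S, Function.Involutive ι ∧ (∀ q, ι q = q ↔ q = p) ∧
      ∀ h ∈ H, h p = p → ∀ q, h (ι q) = ι (h q)) :
    (∃ h ∈ H, orderOf h = 3) ∨ ∃ s, ∀ h ∈ H, h s = s := by
  classical
  have := Fintype.ofFinite S
  by_contra! hcon
  obtain ⟨h3, hfix⟩ := hcon
  have key : ∀ {d : ℕ}, d.Prime → d ∣ Nat.card H → d = 2 := by
    intro d hd hdvd
    have : Fact d.Prime := ⟨hd⟩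
    obtain ⟨⟨h, hH⟩, hord⟩ := exists_prime_orderOf_dvd_card' (G := H) d hdvd
    rw [Subgroup.orderOf_mk] at hord
    by_contra hd2
    have hd3 : d ≠ 3 := fun hd3 => h3 h hH (hord.trans hd3)
    have hd5 : 5 ≤ d := by
      have := hd.two_le
      have : d ≠ 4 := by rintro rfl; revert hd; decide
      omega
    have hodd : d % 2 = 1 := hd.eq_two_or_odd.resolve_left hd2
    let A : Set S := {s | h s = s}
    have hmod : Nat.card S ≡ Nat.card A [MOD d] := by
      have hp : IsPGroup d (Subgroup.zpowers h) :=
        IsPGroup.of_card (n := 1) (by rw [Nat.card_zpowers, hord, pow_one])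
      have h1 := hp.card_modEq_card_fixedPoints S
      have h2 : MulAction.fixedPoints (Subgroup.zpowers h) S = A := by
        ext s
        constructor
        · exact fun hs => hs ⟨h, Subgroup.mem_zpowers h⟩
        · rintro hs ⟨_, n, rfl⟩
          exact Equiv.Perm.zpow_apply_eq_self_of_apply_eq_self hs n
      rwa [h2] at h1
    have hlt : Nat.card A < 9 := by
      rw [← hcard]
      refine Set.ncard_lt_card fun hA => ?_
      have : h = 1 := Equiv.ext fun s => (Set.eq_univ_iff_forall.1 hA s : s ∈ A)
      rw [this, orderOf_one] at hord
      exact hd.one_lt.ne hord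
    have hodd' : Nat.card A = 0 ∨ Nat.card A % 2 = 1 := by
      rcases A.eq_empty_or_nonempty with hA | ⟨p, hp⟩
      · left; simp [hA]
      right
      obtain ⟨ι, hinv, hιp, hcomm⟩ := hι p
      let g : Function.End A := fun a => ⟨ι a, by
        have := hcomm h hH hp a
        rw [show h a = a from a.2] at this
        exact this⟩
      have hg : g ^ 2 ^ 1 = 1 := by
        funext a
        exact Subtype.ext (hinv (a : S))
      have h1 := Equiv.Perm.card_fixedPoints_modEq hg
      have h2 : Fintype.card (Function.fixedPoints g) = 1 := by
        rw [Fintype.card_eq_one_iff]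
        refine ⟨⟨⟨p, hp⟩, Subtype.ext ((hιp p).2 rfl)⟩, fun a => ?_⟩
        exact Subtype.ext (Subtype.ext ((hιp a.1.1).1 (congrArg Subtype.val a.2)))
      rw [h2] at h1
      rw [Nat.card_eq_fintype_card]
      exact h1
    rw [hcard] at hmod
    have hdvd9 : d ∣ 9 - Nat.card A := (Nat.modEq_iff_dvd' hlt.le).1 hmod.symm
    obtain ⟨k, hk⟩ := hdvd9
    have hk1 : k < 2 := by nlinarith [Nat.sub_le 9 (Nat.card A)]
    interval_cases k
    · omega
    · have : d ≠ 9 := by rintro rfl; revert hd; decide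
      omega
  obtain ⟨s, hs⟩ : (MulAction.fixedPoints H S).Nonempty := by
    have hp : IsPGroup 2 H := IsPGroup.of_card
      (Nat.eq_prime_pow_of_unique_prime_dvd Nat.card_pos.ne' key)
    exact hp.nonempty_fixed_point_of_prime_not_dvd_card S (by rw [hcard]; decide)
  obtain ⟨h, hH, hne⟩ := hfix s
  exact hne (hs ⟨h, hH⟩)

/-- A symmetric trilinear form `T` whose cubic form `x ↦ T x x x` has no singular point. -/
structure IsSmoothCubic {F V : Type*} [Field F] [AddCommGroup V] [Module F V]
    (T : V →ₗ[F] V →ₗ[F] V →ₗ[F] F) : Prop where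
  swap_left : ∀ x y z, T x y z = T y x z
  swap_right : ∀ x y z, T x y z = T x z y
  smooth : ∀ x, x ≠ 0 → ∃ u, T x x u ≠ 0

/-- A nonzero vector at which the cubic form of `T` vanishes and its Hessian is degenerate. -/
def IsFlex {F V : Type*} [Field F] [AddCommGroup V] [Module F V]
    (T : V →ₗ[F] V →ₗ[F] V →ₗ[F] F) (v : V) : Prop :=
  v ≠ 0 ∧ T v v v = 0 ∧ ∃ w, w ≠ 0 ∧ ∀ u, T v w u = 0

/-- A spanning triple in which the cubic form of `T` is in Weierstrass form with flex `p`. -/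
structure IsFlexFrame {F V : Type*} [Field F] [AddCommGroup V] [Module F V]
    (T : V →ₗ[F] V →ₗ[F] V →ₗ[F] F) (p w e : V) : Prop where
  span : ∀ v, ∃ a b c : F, v = a • p + b • w + c • e
  ppp : T p p p = 0
  ppw : T p p w = 0
  pww : T p w w = 0
  pwe : T p w e = 0
  pee : T p e e = 0
  wwe : T w w e = 0
  ppe : T p p e ≠ 0
  www : T w w w ≠ 0

section Cubic

variable {F V : Type*} [Field F] [AddCommGroup V] [Module F V]
  {T : V →ₗ[F] V →ₗ[F] V →ₗ[F] F} {p w e : V}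

theorem IsFlex.smul {v : V} (hv : IsFlex T v) {k : F} (hk : k ≠ 0) : IsFlex T (k • v) := by
  obtain ⟨h0, h1, u, hu, h2⟩ := hv
  exact ⟨smul_ne_zero hk h0, by simp [h1], u, hu, by simp [h2]⟩

theorem isFlex_smul_iff {v : V} {k : F} (hk : k ≠ 0) : IsFlex T (k • v) ↔ IsFlex T v := by
  refine ⟨fun h => ?_, fun h => h.smul hk⟩
  simpa [smul_smul, inv_mul_cancel₀ hk] using h.smul (inv_ne_zero hk)

theorem IsSmoothCubic.exists_eq_combination (hT : IsSmoothCubic T)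
    (hdim : Module.finrank F V = 3) (hw : w ≠ 0) (hppp : T p p p = 0)
    (hpw : ∀ u, T p w u = 0) (he : T p p e ≠ 0) (v : V) :
    ∃ a b c : F, v = a • p + b • w + c • e := by
  have hppw : T p p w = 0 := by rw [hT.swap_right, hpw]
  have hli : LinearIndependent F ![p, w, e] := by
    rw [Fintype.linearIndependent_iff]
    intro g hg
    simp only [Fin.sum_univ_three, Matrix.cons_val] at hg
    have hc : g 2 = 0 := by
      have h := congrArg (T p p) hg
      simpa [hppp, hppw, he] using h
    rw [hc, zero_smul, add_zero] at hg
    have ha : g 0 = 0 := by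
      have h := congrArg (fun x => T p x e) hg
      simpa [hpw, he] using h
    rw [ha, zero_smul, zero_add] at hg
    have hb : g 1 = 0 := (smul_eq_zero.1 hg).resolve_right hw
    intro i
    fin_cases i <;> assumption
  have : FiniteDimensional F V := Module.finite_of_finrank_eq_succ hdim
  have hspan := hli.span_eq_top_of_card_eq_finrank' (by simp [hdim])
  have hv : v ∈ Submodule.span F (Set.range ![p, w, e]) := hspan ▸ Submodule.mem_top
  rw [Submodule.mem_span_range_iff_exists_fun] at hv
  obtain ⟨c, hc⟩ := hv
  exact ⟨c 0, c 1, c 2, by rw [← hc, Fin.sum_univ_three]; rfl⟩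

theorem IsSmoothCubic.exists_isFlexFrame [IsAlgClosed F] [NeZero (2 : F)]
    (hT : IsSmoothCubic T) (hdim : Module.finrank F V = 3) (hp : IsFlex T p) :
    ∃ w e, IsFlexFrame T p w e := by
  obtain ⟨hp0, hppp, w, hw0, hpw⟩ := hp
  obtain ⟨e, he⟩ := hT.smooth p hp0
  have hppw : T p p w = 0 := by rw [hT.swap_right, hpw]
  have h2 : (2 : F) ≠ 0 := NeZero.ne 2
  have hww : T w w w ≠ 0 := by
    intro hwww
    obtain ⟨a, ha⟩ := IsAlgClosed.exists_eq_mul_self (-(T w w e) / T p p e)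
    have hx : a • p + w ≠ 0 := by
      intro h0
      have h1 := congrArg (fun x => T p x e) h0
      have ha0 : a = 0 := by simpa [hpw, he] using h1
      rw [ha0, zero_smul, zero_add] at h0
      exact hw0 h0
    obtain ⟨u, hu⟩ := hT.smooth _ hx
    apply hu
    obtain ⟨x, y, z, rfl⟩ := hT.exists_eq_combination hdim hw0 hppp hpw he u
    have hwp : ∀ u, T w p u = 0 := fun u => by rw [hT.swap_left, hpw]
    have hwwp : T w w p = 0 := by rw [hT.swap_right, hwp]
    have ha' : a * a * T p p e + T w w e = 0 := by rw [← ha]; field_simp; ring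
    simp only [map_add, map_smul, LinearMap.add_apply, LinearMap.smul_apply, smul_eq_mul, hpw, hwp,
      hppp, hppw, hwwp, hwww]
    linear_combination z * ha'
  let s : F := -(T p e e) / (2 * T p p e)
  let t : F := -(T w w e) / T w w w
  have hwp : ∀ u, T w p u = 0 := fun u => by rw [hT.swap_left, hpw]
  have hwwp : T w w p = 0 := by rw [hT.swap_right, hwp]
  have hpep : T p e p = T p p e := hT.swap_right _ _ _
  have hpew : T p e w = 0 := by rw [hT.swap_right, hpw]
  have hppe' : T p p (e + s • p + t • w) = T p p e := by simp [hppp, hppw]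
  have hppe : T p p (e + s • p + t • w) ≠ 0 := by rwa [hppe']
  refine ⟨w, e + s • p + t • w,
    hT.exists_eq_combination hdim hw0 hppp hpw hppe, hppp, hppw, hpw w, hpw _, ?_, ?_,
    hppe, hww⟩
  · simp only [map_add, map_smul, LinearMap.add_apply, LinearMap.smul_apply, smul_eq_mul, hpw,
      hppp, hppw, hpep, hpew, s]
    field_simp
    ring
  · simp only [map_add, map_smul, smul_eq_mul, hwwp, t]
    field_simp
    ring

theorem IsFlexFrame.apply (h : IsFlexFrame T p w e) (hT : IsSmoothCubic T)
    (a b c a' b' c' a'' b'' c'' : F) :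
    T (a • p + b • w + c • e) (a' • p + b' • w + c' • e) (a'' • p + b'' • w + c'' • e) =
      T p p e * (a * a' * c'' + a * c' * a'' + c * a' * a'') + T w w w * (b * b' * b'') +
      T w e e * (b * c' * c'' + c * b' * c'' + c * c' * b'') + T e e e * (c * c' * c'') := by
  have h1 : T p w p = 0 := by rw [hT.swap_right, h.ppw]
  have h2 : T w p p = 0 := by rw [hT.swap_left, h1]
  have h3 : T w p w = 0 := by rw [hT.swap_left, h.pww]
  have h4 : T w w p = 0 := by rw [hT.swap_right, h3]
  have h5 : T p e w = 0 := by rw [hT.swap_right, h.pwe]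
  have h6 : T e p w = 0 := by rw [hT.swap_left, h5]
  have h7 : T e w p = 0 := by rw [hT.swap_right, h6]
  have h8 : T w e p = 0 := by rw [hT.swap_left, h7]
  have h9 : T w p e = 0 := by rw [hT.swap_right, h8]
  have h10 : T e p e = 0 := by rw [hT.swap_left, h.pee]
  have h11 : T e e p = 0 := by rw [hT.swap_right, h10]
  have h12 : T w e w = 0 := by rw [hT.swap_right, h.wwe]
  have h13 : T e w w = 0 := by rw [hT.swap_left, h12]
  have h14 : T p e p = T p p e := hT.swap_right _ _ _
  have h15 : T e p p = T p p e := by rw [hT.swap_left, h14]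
  have h16 : T e w e = T w e e := hT.swap_left _ _ _
  have h17 : T e e w = T w e e := by rw [hT.swap_right, h16]
  simp only [map_add, map_smul, LinearMap.add_apply, LinearMap.smul_apply, smul_eq_mul,
    h.ppp, h.ppw, h.pww, h.pwe, h.pee, h.wwe, h1, h2, h3, h4, h5, h6, h7, h8, h9, h10, h11, h12,
    h13, h14, h15, h16, h17]
  ring

theorem IsFlexFrame.coeff_eq_zero (h : IsFlexFrame T p w e) (hT : IsSmoothCubic T) {a b c : F}
    (h0 : a • p + b • w + c • e = 0) : a = 0 ∧ b = 0 ∧ c = 0 := by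
  have hc := h.apply hT a b c 1 0 0 1 0 0
  have hb := h.apply hT a b c 0 1 0 0 1 0
  have ha := h.apply hT a b c 1 0 0 0 0 1
  simp only [h0, map_zero, LinearMap.zero_apply] at ha hb hc
  refine ⟨(mul_eq_zero.1 (?_ : T p p e * a = 0)).resolve_left h.ppe,
    (mul_eq_zero.1 (?_ : T w w w * b = 0)).resolve_left h.www,
    (mul_eq_zero.1 (?_ : T p p e * c = 0)).resolve_left h.ppe⟩
  · linear_combination -ha
  · linear_combination -hb
  · linear_combination -hc

theorem IsFlexFrame.coeff_eq (h : IsFlexFrame T p w e) (hT : IsSmoothCubic T)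
    {a b c a' b' c' : F} (heq : a • p + b • w + c • e = a' • p + b' • w + c' • e) :
    a = a' ∧ b = b' ∧ c = c' := by
  have h0 : (a - a') • p + (b - b') • w + (c - c') • e = 0 := by
    rw [← sub_eq_zero] at heq
    rw [← heq]
    module
  simpa only [sub_eq_zero] using h.coeff_eq_zero hT h0

/-- Flexes of the cubic in the Weierstrass coordinates of a flex frame. -/
theorem IsFlexFrame.isFlex_iff (h : IsFlexFrame T p w e) (hT : IsSmoothCubic T) (a b : F)
    [NeZero (3 : F)] :
    IsFlex T (a • p + b • w + e) ↔
      3 * T p p e * a ^ 2 + T w w w * b ^ 3 + 3 * T w e e * b + T e e e = 0 ∧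
      (T w w w) ^ 2 * b ^ 4 + 6 * T w w w * T w e e * b ^ 2 + 4 * T w w w * T e e e * b
        - 3 * (T w e e) ^ 2 = 0 := by
  have h3 : (3 : F) ≠ 0 := NeZero.ne 3
  have hα := h.ppe
  have hγ := h.www
  have hE := h.apply hT
  set α := T p p e
  set γ := T w w w
  set ζ := T w e e
  set η := T e e e
  have hcubic := hE a b 1 a b 1 a b 1
  simp only [one_smul] at hcubic
  have hval : T (a • p + b • w + e) (a • p + b • w + e) (a • p + b • w + e) = 0 ↔
      3 * α * a ^ 2 + γ * b ^ 3 + 3 * ζ * b + η = 0 := by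
    rw [hcubic]; ring_nf
  unfold IsFlex
  rw [hval]
  constructor
  · rintro ⟨-, h1, u, hu, hdeg⟩
    refine ⟨h1, ?_⟩
    obtain ⟨x, y, z, rfl⟩ := h.span u
    have e1 := hE a b 1 x y z 1 0 0
    have e2 := hE a b 1 x y z 0 1 0
    have e3 := hE a b 1 x y z 0 0 1
    rw [one_smul, hdeg] at e1 e2 e3
    have hx : x = - a * z := by
      have : α * (x + a * z) = 0 := by linear_combination -e1
      have := (mul_eq_zero.1 this).resolve_left hα
      linear_combination this
    subst hx
    by_cases hz : z = 0
    · subst hz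
      have hy : y ≠ 0 := by
        rintro rfl
        simp at hu
      have hb : b = 0 := by
        have : γ * b * y = 0 := by linear_combination -e2
        simpa [hγ, hy] using this
      have hζ : ζ = 0 := by
        have : ζ * y = 0 := by subst hb; linear_combination -e3
        simpa [hy] using this
      rw [hb, hζ]; ring
    · apply mul_left_cancel₀ hz
      linear_combination γ * b * z * h1 - 3 * γ * b * e3 + 3 * ζ * e2
  · rintro ⟨h1, h2⟩
    refine ⟨fun h0 => ?_, h1, ?_⟩
    · have := h.coeff_eq_zero hT (a := a) (b := b) (c := 1) (by rwa [one_smul])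
      exact one_ne_zero this.2.2
    by_cases hb : b = 0
    · subst hb
      have hζ : ζ = 0 := by
        have : 3 * ζ ^ 2 = 0 := by linear_combination -h2
        simpa [h3] using this
      refine ⟨w, fun hw => hγ (by simp [γ, hw]), fun u => ?_⟩
      obtain ⟨x, y, z, rfl⟩ := h.span u
      have e1 := hE a 0 1 0 1 0 x y z
      simp only [one_smul, zero_smul, zero_add, add_zero] at e1 ⊢
      rw [e1, hζ]; ring
    · refine ⟨(-a * (b * γ)) • p + (-ζ) • w + (b * γ) • e, fun h0 => ?_, fun u => ?_⟩
      · have := (h.coeff_eq_zero hT h0).2.2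
        simp [hb, hγ] at this
      obtain ⟨x, y, z, rfl⟩ := h.span u
      have e1 := hE a b 1 (-a * (b * γ)) (-ζ) (b * γ) x y z
      rw [one_smul] at e1
      rw [e1]
      apply mul_left_cancel₀ h3
      linear_combination z * h2 - z * γ * b * h1

theorem IsFlexFrame.eq_smul_of_isFlex (h : IsFlexFrame T p w e) (hT : IsSmoothCubic T) {v : V}
    (hv : IsFlex T v) :
    (∃ k : F, k ≠ 0 ∧ v = k • p) ∨ ∃ k a b : F, k ≠ 0 ∧ v = k • (a • p + b • w + e) := by
  obtain ⟨a, b, c, rfl⟩ := h.span v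
  by_cases hc : c = 0
  · left
    subst hc
    have h1 := hv.2.1
    rw [h.apply hT] at h1
    have hb : b = 0 := by simpa [h.www] using h1
    subst hb
    have h0 := hv.1
    refine ⟨a, ?_, by simp⟩
    rintro rfl
    simp at h0
  · right
    refine ⟨c, c⁻¹ * a, c⁻¹ * b, hc, ?_⟩
    rw [smul_add, smul_add, smul_smul, smul_smul, mul_inv_cancel_left₀ hc, mul_inv_cancel_left₀ hc]

theorem IsFlexFrame.nonsingular (h : IsFlexFrame T p w e) (hT : IsSmoothCubic T) {b : F}
    (h1 : T w w w * b ^ 3 + 3 * T w e e * b + T e e e = 0)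
    (h2 : T w w w * b ^ 2 + T w e e = 0) : False := by
  have h0 : (0 : F) • p + b • w + (1 : F) • e ≠ 0 := fun h0 =>
    one_ne_zero (h.coeff_eq_zero hT h0).2.2
  obtain ⟨u, hu⟩ := hT.smooth _ h0
  apply hu
  obtain ⟨x, y, z, rfl⟩ := h.span u
  rw [h.apply hT]
  linear_combination (y - b * z) * h2 + z * h1

theorem IsFlexFrame.ne_zero_of_isFlex (h : IsFlexFrame T p w e) (hT : IsSmoothCubic T)
    [NeZero (3 : F)] {a b : F} (hv : IsFlex T (a • p + b • w + e)) : a ≠ 0 := by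
  rintro rfl
  obtain ⟨h1, h2⟩ := (h.isFlex_iff hT 0 b).1 hv
  have h3 : 3 * (T w w w * b ^ 2 + T w e e) ^ 2 = 0 := by
    linear_combination 4 * T w w w * b * h1 - h2
  refine h.nonsingular hT (b := b) (by linear_combination h1) ?_
  simpa [NeZero.ne (3 : F)] using h3

end Cubic

theorem exists_finset_card_four_of_quartic {F : Type*} [Field F] [IsAlgClosed F] [NeZero (3 : F)]
    {γ ζ η : F} (hγ : γ ≠ 0)
    (hns : ∀ b : F, γ * b ^ 3 + 3 * ζ * b + η = 0 → γ * b ^ 2 + ζ = 0 → False)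
    (h2 : (2 : F) ≠ 0) :
    ∃ A : Finset F, A.card = 4 ∧ ∀ b, b ∈ A ↔
      γ ^ 2 * b ^ 4 + 6 * γ * ζ * b ^ 2 + 4 * γ * η * b - 3 * ζ ^ 2 = 0 := by
  classical
  let P : Polynomial F := .C (γ ^ 2) * .X ^ 4 + .C (6 * γ * ζ) * .X ^ 2 + .C (4 * γ * η) * .X
    - .C (3 * ζ ^ 2)
  have hdeg : P.natDegree = 4 := by
    have : γ ^ 2 ≠ 0 := pow_ne_zero 2 hγ
    simp only [P]
    compute_degree!
  have hP0 : P ≠ 0 := by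
    intro h
    simp [h] at hdeg
  have heval : ∀ b, P.eval b =
      γ ^ 2 * b ^ 4 + 6 * γ * ζ * b ^ 2 + 4 * γ * η * b - 3 * ζ ^ 2 := by
    intro b
    simp [P]
  have hsep : P.Separable := by
    rw [Polynomial.separable_def, Polynomial.isCoprime_iff_aeval_ne_zero_of_isAlgClosed (k := F) F]
    intro b
    by_contra! hcon
    obtain ⟨h1, h3⟩ := hcon
    rw [Polynomial.coe_aeval_eq_eval, heval] at h1
    have h4 : 4 * γ * (γ * b ^ 3 + 3 * ζ * b + η) = 0 := by
      rw [← h3]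
      simp only [P, Polynomial.coe_aeval_eq_eval, Polynomial.derivative_sub,
        Polynomial.derivative_add, Polynomial.derivative_C_mul, Polynomial.derivative_X_pow,
        Polynomial.derivative_X, Polynomial.derivative_C, Polynomial.eval_sub, Polynomial.eval_add,
        Polynomial.eval_mul, Polynomial.eval_pow, Polynomial.eval_C, Polynomial.eval_X,
        Polynomial.eval_one, Polynomial.eval_zero]
      push_cast
      ring
    have hne : (4 * γ : F) ≠ 0 := by
      rw [show (4 : F) = 2 * 2 by norm_num]
      exact mul_ne_zero (mul_ne_zero h2 h2) hγ
    have h5 := (mul_eq_zero.1 h4).resolve_left hne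
    refine hns b h5 ?_
    have h6 : 3 * (γ * b ^ 2 + ζ) ^ 2 = 0 := by
      linear_combination 4 * γ * b * h5 - h1
    simpa [NeZero.ne (3 : F)] using h6
  refine ⟨P.roots.toFinset, ?_, fun b => ?_⟩
  · rw [Multiset.toFinset_card_of_nodup (Polynomial.nodup_roots hsep),
      IsAlgClosed.card_roots_eq_natDegree, hdeg]
  · rw [Multiset.mem_toFinset, Polynomial.mem_roots hP0, Polynomial.IsRoot, heval]

/-- The vectors whose first nonzero coordinate is `1`: one representative for each point of the
projective plane. -/
def IsNormalized {F : Type*} [Field F] (v : Fin 3 → F) : Prop :=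
  v 0 = 1 ∨ (v 0 = 0 ∧ v 1 = 1) ∨ (v 0 = 0 ∧ v 1 = 0 ∧ v 2 = 1)

theorem exists_isNormalized_smul {F : Type*} [Field F] {v : Fin 3 → F} (hv : v ≠ 0) :
    ∃ k : F, k ≠ 0 ∧ IsNormalized (k • v) := by
  by_cases h0 : v 0 = 0
  · by_cases h1 : v 1 = 0
    · by_cases h2 : v 2 = 0
      · exact absurd (by ext i; fin_cases i <;> assumption) hv
      · exact ⟨(v 2)⁻¹, inv_ne_zero h2, by simp [IsNormalized, h0, h1, h2]⟩
    · exact ⟨(v 1)⁻¹, inv_ne_zero h1, by simp [IsNormalized, h0, h1]⟩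
  · exact ⟨(v 0)⁻¹, inv_ne_zero h0, by simp [IsNormalized, h0]⟩

theorem IsNormalized.smul_eq {F : Type*} [Field F] {v : Fin 3 → F} (hv : IsNormalized v) {k : F}
    (hk : IsNormalized (k • v)) : k • v = v := by
  suffices k = 1 by rw [this, one_smul]
  simp only [IsNormalized, Pi.smul_apply, smul_eq_mul] at hk
  rcases hv with h | ⟨h, h'⟩ | ⟨h, h', h''⟩
  · rcases hk with h1 | ⟨h1, h2⟩ | ⟨h1, h2, h3⟩ <;> simp_all
  · rcases hk with h1 | ⟨h1, h2⟩ | ⟨h1, h2, h3⟩ <;> simp_all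
  · simp_all

section NormalizedFlexes

variable {F : Type*} [Field F] [IsAlgClosed F] [CharZero F]
  {T : (Fin 3 → F) →ₗ[F] (Fin 3 → F) →ₗ[F] (Fin 3 → F) →ₗ[F] F}

theorem IsSmoothCubic.existsUnique_third_flex (hT : IsSmoothCubic T) {p q : Fin 3 → F}
    (hpn : IsNormalized p) (hp : IsFlex T p) (hqn : IsNormalized q) (hq : IsFlex T q)
    (hqp : q ≠ p) :
    ∃! r, (IsNormalized r ∧ IsFlex T r) ∧ r ≠ p ∧ r ≠ q ∧ ∃ x y : F, r = x • p + y • q := by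
  obtain ⟨w, e, h⟩ := hT.exists_isFlexFrame (by simp) hp
  have hcases : ∀ r, IsNormalized r → IsFlex T r → r ≠ p →
      ∃ k a b : F, k ≠ 0 ∧ r = k • (a • p + b • w + e) := by
    intro r hrn hr hrp
    refine (h.eq_smul_of_isFlex hT hr).resolve_left ?_
    rintro ⟨k, -, rfl⟩
    exact hrp (hpn.smul_eq hrn)
  obtain ⟨k, a, b, hk, hqe⟩ := hcases q hqn hq hqp
  have hq' : IsFlex T (a • p + b • w + e) := by rwa [hqe, isFlex_smul_iff hk] at hq
  have ha := h.ne_zero_of_isFlex hT hq'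
  have hr' : IsFlex T ((-a) • p + b • w + e) := by
    rw [h.isFlex_iff hT] at hq' ⊢
    simpa using hq'
  obtain ⟨l, hl, hln⟩ := exists_isNormalized_smul hr'.1
  have hlin : ∀ a' : F, l • (a' • p + b • w + e) = (l * (a' - a)) • p + (l * k⁻¹) • q := by
    intro a'
    rw [hqe, smul_smul, mul_assoc, inv_mul_cancel₀ hk, mul_one]
    module
  refine ⟨l • ((-a) • p + b • w + e), ⟨⟨hln, hr'.smul hl⟩, ?_, ?_, _, _, hlin _⟩, ?_⟩
  · intro h0
    have : (-(l * a) - 1) • p + (l * b) • w + l • e = 0 := by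
      rw [← sub_eq_zero] at h0
      rw [← h0]
      module
    exact hl (h.coeff_eq_zero hT this).2.2
  · intro h0
    rw [hqe] at h0
    have : (-(l * a)) • p + (l * b) • w + l • e = (k * a) • p + (k * b) • w + k • e := by
      rw [← sub_eq_zero] at h0 ⊢
      rw [← h0]
      module
    obtain ⟨h1, -, h3⟩ := h.coeff_eq hT this
    subst h3
    have : 2 * (l * a) = 0 := by linear_combination -h1
    exact mul_ne_zero two_ne_zero (mul_ne_zero hl ha) this
  · rintro r ⟨⟨hrn, hr⟩, hrp, hrq, x, y, hxy⟩
    obtain ⟨m, a', b', hm, hre⟩ := hcases r hrn hr hrp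
    have hr'' : IsFlex T (a' • p + b' • w + e) := by rwa [hre, isFlex_smul_iff hm] at hr
    have hcoef : (m * a') • p + (m * b') • w + m • e
        = (x + y * k * a) • p + (y * k * b) • w + (y * k) • e := by
      have : r = r := rfl
      nth_rewrite 1 [hre] at this
      rw [hxy, hqe] at this
      rw [← sub_eq_zero] at this ⊢
      rw [← this]
      module
    obtain ⟨-, h2, h3⟩ := h.coeff_eq hT hcoef
    have hb : b' = b := mul_left_cancel₀ hm (by rw [h2, h3])
    subst hb
    have hsq : a' = a ∨ a' = -a := by
      rw [← sq_eq_sq_iff_eq_or_eq_neg]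
      have e1 := ((h.isFlex_iff hT _ _).1 hq').1
      have e2 := ((h.isFlex_iff hT _ _).1 hr'').1
      apply mul_left_cancel₀ (mul_ne_zero (three_ne_zero (α := F)) h.ppe)
      linear_combination e2 - e1
    rcases hsq with rfl | rfl
    · refine absurd ?_ hrq
      have : r = (m * k⁻¹) • q := by
        rw [hre, hqe, smul_smul, mul_assoc, inv_mul_cancel₀ hk, mul_one]
      rw [this] at hrn ⊢
      exact hqn.smul_eq hrn
    · have : r = (m * l⁻¹) • l • ((-a) • p + b' • w + e) := by
        rw [hre, smul_smul, mul_assoc, inv_mul_cancel₀ hl, mul_one]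
      rw [this] at hrn ⊢
      exact hln.smul_eq hrn

theorem IsSmoothCubic.card_normalized_flexes (hT : IsSmoothCubic T) {p : Fin 3 → F}
    (hp : IsFlex T p) : Nat.card {v // IsNormalized v ∧ IsFlex T v} = 9 := by
  obtain ⟨w, e, h⟩ := hT.exists_isFlexFrame (by simp) hp
  obtain ⟨A, hA, hAmem⟩ := exists_finset_card_four_of_quartic h.www
    (fun b => h.nonsingular hT (b := b)) two_ne_zero
  have hroot : ∀ b : F, ∃ a : F,
      3 * T p p e * a ^ 2 + T w w w * b ^ 3 + 3 * T w e e * b + T e e e = 0 := by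
    intro b
    have hα := h.ppe
    obtain ⟨a, ha⟩ := IsAlgClosed.exists_eq_mul_self
      (-(T w w w * b ^ 3 + 3 * T w e e * b + T e e e) / (3 * T p p e))
    refine ⟨a, ?_⟩
    rw [pow_two, ← ha]
    field_simp
    ring
  choose s hs using hroot
  let rep : Option (A × Bool) → Fin 3 → F := fun x =>
    x.elim p fun y => (cond y.2 (s y.1) (-s y.1)) • p + (y.1 : F) • w + e
  have hrep : ∀ x, IsFlex T (rep x) := by
    rintro (_ | ⟨⟨b, hb⟩, _ | _⟩)
    · exact hp
    · refine (h.isFlex_iff hT _ _).2 ⟨?_, (hAmem b).1 hb⟩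
      have := hs b
      simpa using this
    · exact (h.isFlex_iff hT _ _).2 ⟨hs b, (hAmem b).1 hb⟩
  choose k hk hkn using fun x => exists_isNormalized_smul (hrep x).1
  let Φ : Option (A × Bool) → {v // IsNormalized v ∧ IsFlex T v} := fun x =>
    ⟨k x • rep x, hkn x, (hrep x).smul (hk x)⟩
  have hinj : ∀ x y, (∃ c : F, rep x = c • rep y) → x = y := by
    rintro (_ | ⟨⟨b, hb⟩, t⟩) (_ | ⟨⟨b', hb'⟩, t'⟩) ⟨c, hc⟩
    · rfl
    · exfalso
      have h1 : (1 : F) • p + (0 : F) • w + (0 : F) • e =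
          (c * cond t' (s b') (-s b')) • p + (c * b') • w + c • e := by
        simp only [rep, Option.elim] at hc
        rw [one_smul, zero_smul, zero_smul, add_zero, add_zero]
        refine hc.trans ?_
        module
      obtain ⟨h2, -, h3⟩ := h.coeff_eq hT h1
      rw [← h3, zero_mul] at h2
      exact one_ne_zero h2
    · exfalso
      have h1 : (cond t (s b) (-s b)) • p + b • w + (1 : F) • e =
          c • p + (0 : F) • w + (0 : F) • e := by
        simp only [rep, Option.elim] at hc
        rw [one_smul, zero_smul, zero_smul, add_zero, add_zero, hc]
      exact one_ne_zero (h.coeff_eq hT h1).2.2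
    · have h1 : (cond t (s b) (-s b)) • p + b • w + (1 : F) • e =
          (c * cond t' (s b') (-s b')) • p + (c * b') • w + c • e := by
        simp only [rep, Option.elim] at hc
        rw [one_smul, hc]
        module
      obtain ⟨h2, h3, h4⟩ := h.coeff_eq hT h1
      rw [← h4, one_mul] at h2 h3
      subst h3
      have hs0 : s b ≠ 0 := h.ne_zero_of_isFlex hT (hrep (some (⟨b, hb⟩, true)))
      cases t <;> cases t' <;> simp_all [CharZero.eq_neg_self_iff, CharZero.neg_eq_self_iff]
  have hbij : Function.Bijective Φ := by
    constructor
    · intro x y hxy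
      refine hinj x y ⟨(k x)⁻¹ * k y, ?_⟩
      rw [mul_smul, ← show k x • rep x = k y • rep y from congrArg Subtype.val hxy, smul_smul,
        inv_mul_cancel₀ (hk x), one_smul]
    · have hsurj : ∀ v : Fin 3 → F, IsNormalized v → ∀ x, ∀ c : F, v = c • rep x →
          k x • rep x = v := by
        intro v hv x c hc
        have h1 : v = (c * (k x)⁻¹) • k x • rep x := by
          rw [smul_smul, mul_assoc, inv_mul_cancel₀ (hk x), mul_one, hc]
        rw [h1] at hv
        rw [h1, (hkn x).smul_eq hv]
      rintro ⟨v, hvn, hv⟩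
      rcases h.eq_smul_of_isFlex hT hv with ⟨c, -, hc⟩ | ⟨c, a, b, hc0, hc⟩
      · exact ⟨none, Subtype.ext (hsurj v hvn none c hc)⟩
      · rw [hc, isFlex_smul_iff hc0, h.isFlex_iff hT] at hv
        have hb := (hAmem b).2 hv.2
        have hsq : a = s b ∨ a = -s b := by
          rw [← sq_eq_sq_iff_eq_or_eq_neg]
          apply mul_left_cancel₀ (mul_ne_zero (three_ne_zero (α := F)) h.ppe)
          linear_combination hv.1 - hs b
        rcases hsq with rfl | rfl
        · exact ⟨some (⟨b, hb⟩, true), Subtype.ext (hsurj v hvn _ c hc)⟩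
        · exact ⟨some (⟨b, hb⟩, false), Subtype.ext (hsurj v hvn _ c hc)⟩
  rw [← Nat.card_eq_of_bijective Φ hbij]
  simp [hA]

end NormalizedFlexes

theorem MvPolynomial.pderiv_pderiv_comm {R σ : Type*} [CommRing R] (i j : σ)
    (p : MvPolynomial σ R) : pderiv i (pderiv j p) = pderiv j (pderiv i p) := by
  classical
  have h : ⁅pderiv (R := R) i, pderiv (R := R) j⁆ = 0 :=
    MvPolynomial.derivation_ext fun k => by
      simp [Derivation.commutator_apply, pderiv_X, Pi.single_apply, apply_ite]
  rw [← sub_eq_zero, ← Derivation.commutator_apply, h, Derivation.zero_apply]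

/-- The trilinear form whose coefficients are the third derivatives of `g`. -/
noncomputable def MvPolynomial.polarization {F : Type*} [Field F] (g : MvPolynomial (Fin 3) F) :
    (Fin 3 → F) →ₗ[F] (Fin 3 → F) →ₗ[F] (Fin 3 → F) →ₗ[F] F :=
  ∑ i, (LinearMap.proj i).smulRight (∑ j, (LinearMap.proj j).smulRight
    (∑ k, coeff 0 (pderiv k (pderiv j (pderiv i g))) • LinearMap.proj k))

/-- The matrix of second partial derivatives of `g`. -/
noncomputable def MvPolynomial.hessian {F : Type*} [CommSemiring F] (g : MvPolynomial (Fin 3) F) :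
    Matrix (Fin 3) (Fin 3) (MvPolynomial (Fin 3) F) :=
  Matrix.of fun i j => pderiv j (pderiv i g)

section Polarization

open MvPolynomial

variable {F : Type*} [Field F] {g : MvPolynomial (Fin 3) F}

theorem MvPolynomial.polarization_apply (x y z : Fin 3 → F) :
    polarization g x y z =
      ∑ i, x i * ∑ j, y j * ∑ k, coeff 0 (pderiv k (pderiv j (pderiv i g))) * z k := by
  simp [polarization, LinearMap.sum_apply]

theorem MvPolynomial.polarization_swap_left (x y z : Fin 3 → F) :
    polarization g x y z = polarization g y x z := by
  simp only [polarization_apply, Finset.mul_sum]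
  rw [Finset.sum_comm]
  refine Finset.sum_congr rfl fun i _ => Finset.sum_congr rfl fun j _ =>
    Finset.sum_congr rfl fun k _ => ?_
  rw [pderiv_pderiv_comm i j g]
  ring

theorem MvPolynomial.polarization_swap_right (x y z : Fin 3 → F) :
    polarization g x y z = polarization g x z y := by
  simp only [polarization_apply, Finset.mul_sum]
  refine Finset.sum_congr rfl fun i _ => ?_
  rw [Finset.sum_comm]
  refine Finset.sum_congr rfl fun j _ => Finset.sum_congr rfl fun k _ => ?_
  rw [pderiv_pderiv_comm j k]
  ring

theorem MvPolynomial.IsHomogeneous.sum_mul_eval_pderiv {n : ℕ} (hg : g.IsHomogeneous n)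
    (x : Fin 3 → F) : ∑ i, x i * eval x (pderiv i g) = n * eval x g := by
  have h := congrArg (eval x) hg.sum_X_mul_pderiv
  simpa using h

theorem MvPolynomial.IsHomogeneous.eval_hessian (hg : g.IsHomogeneous 3) (x : Fin 3 → F)
    (i j : Fin 3) :
    eval x (hessian g i j) = ∑ k, coeff 0 (pderiv k (pderiv j (pderiv i g))) * x k := by
  have h1 : (pderiv j (pderiv i g)).IsHomogeneous 1 := hg.pderiv.pderiv
  have h2 := h1.sum_mul_eval_pderiv x
  rw [Nat.cast_one, one_mul] at h2
  rw [hessian, Matrix.of_apply, ← h2]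
  refine Finset.sum_congr rfl fun k _ => ?_
  have h3 : (pderiv k (pderiv j (pderiv i g))).IsHomogeneous 0 := h1.pderiv
  rw [totalDegree_eq_zero_iff_eq_C.1 (Nat.le_zero.1 h3.totalDegree_le), eval_C, coeff_C]
  simp [mul_comm]

theorem MvPolynomial.IsHomogeneous.polarization_eq_hessian (hg : g.IsHomogeneous 3)
    (x u : Fin 3 → F) (i : Fin 3) :
    polarization g x u (Pi.single i 1) = ((hessian g).map (eval x)).mulVec u i := by
  rw [polarization_swap_right, polarization_swap_left, polarization_swap_right]
  simp only [polarization_apply, ← hg.eval_hessian]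
  simp [Matrix.mulVec, dotProduct, Pi.single_apply, mul_comm]

theorem MvPolynomial.IsHomogeneous.polarization_self_left (hg : g.IsHomogeneous 3)
    (x u : Fin 3 → F) :
    polarization g u x x = 2 * ∑ i, u i * eval x (pderiv i g) := by
  simp only [polarization_apply, ← hg.eval_hessian]
  rw [Finset.mul_sum]
  refine Finset.sum_congr rfl fun i _ => ?_
  have h1 : (pderiv i g).IsHomogeneous 2 := hg.pderiv
  have h2 := h1.sum_mul_eval_pderiv x
  simp only [hessian, Matrix.of_apply, h2]
  push_cast
  ring

theorem MvPolynomial.IsHomogeneous.polarization_self (hg : g.IsHomogeneous 3) (x : Fin 3 → F) :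
    polarization g x x x = 6 * eval x g := by
  rw [hg.polarization_self_left, hg.sum_mul_eval_pderiv]
  push_cast
  ring

theorem MvPolynomial.IsHomogeneous.isSmoothCubic [CharZero F] (hg : g.IsHomogeneous 3)
    (hsm : ∀ x : Fin 3 → F, x ≠ 0 → ∃ i, eval x (pderiv i g) ≠ 0) :
    IsSmoothCubic (polarization g) where
  swap_left := polarization_swap_left
  swap_right := polarization_swap_right
  smooth x hx := by
    obtain ⟨i, hi⟩ := hsm x hx
    refine ⟨Pi.single i 1, ?_⟩
    rw [polarization_swap_right, polarization_swap_left, hg.polarization_self_left]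
    simpa [Pi.single_apply] using hi

theorem MvPolynomial.IsHomogeneous.isFlex_iff [CharZero F] (hg : g.IsHomogeneous 3)
    (x : Fin 3 → F) : IsFlex (polarization g) x ↔
      x ≠ 0 ∧ eval x g = 0 ∧ ((hessian g).map (eval x)).det = 0 := by
  rw [IsFlex, hg.polarization_self, ← Matrix.exists_mulVec_eq_zero_iff]
  refine and_congr_right fun _ => and_congr (by simp) (exists_congr fun w => and_congr_right
    fun _ => ⟨fun h => ?_, fun h u => ?_⟩)
  · ext i
    rw [← hg.polarization_eq_hessian, h]
    rfl
  · have h0 : polarization g x w = 0 := by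
      ext i
      simp [hg.polarization_eq_hessian, h]
    rw [h0, LinearMap.zero_apply]

theorem MvPolynomial.IsHomogeneous.exists_isFlex [CharZero F] [IsAlgClosed F]
    (hg : g.IsHomogeneous 3) : ∃ x, IsFlex (polarization g) x := by
  have hdet : ∀ x, eval x (hessian g).det = ((hessian g).map (eval x)).det := fun x =>
    RingHom.map_det (eval x) (hessian g)
  obtain ⟨x, hx, h1, h2⟩ := exists_common_zero_ne_zero g (hessian g).det
    (by simpa using hg.polarization_self 0) (by
      have h0 : (hessian g).map (eval 0) = 0 := by
        ext i j
        rw [Matrix.map_apply, hg.eval_hessian]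
        simp
      rw [hdet, h0, Matrix.det_zero])
  exact ⟨x, (hg.isFlex_iff x).2 ⟨hx, h1, hdet x ▸ h2⟩⟩

end Polarization

theorem IsSmoothCubic.exists_flex_involution {F : Type*} [Field F] [IsAlgClosed F] [CharZero F]
    {T : (Fin 3 → F) →ₗ[F] (Fin 3 → F) →ₗ[F] (Fin 3 → F) →ₗ[F] F} (hT : IsSmoothCubic T)
    (p : {v // IsNormalized v ∧ IsFlex T v}) :
    ∃ ι : {v // IsNormalized v ∧ IsFlex T v} → {v // IsNormalized v ∧ IsFlex T v},
      Function.Involutive ι ∧ (∀ q, ι q = q ↔ q = p) ∧ ι p = p ∧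
      (∀ q, q ≠ p → ι q ≠ p ∧ ∃ x y : F, (ι q).1 = x • p.1 + y • q.1) ∧
      ∀ q r, q ≠ p → r ≠ p → r ≠ q → (∃ x y : F, r.1 = x • p.1 + y • q.1) → r = ι q := by
  classical
  have hthird : ∀ q : {v // IsNormalized v ∧ IsFlex T v}, ∃ r, (q = p → r = p) ∧ (q ≠ p →
      (r ≠ p ∧ r ≠ q ∧ ∃ x y : F, r.1 = x • p.1 + y • q.1) ∧
      ∀ r', r' ≠ p → r' ≠ q → (∃ x y : F, r'.1 = x • p.1 + y • q.1) → r' = r) := by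
    intro q
    by_cases hq : q = p
    · exact ⟨p, fun _ => rfl, fun h => absurd hq h⟩
    · obtain ⟨r, ⟨hr, hrp, hrq, hxy⟩, huniq⟩ := hT.existsUnique_third_flex p.2.1 p.2.2 q.2.1 q.2.2
        (Subtype.coe_ne_coe.2 hq)
      refine ⟨⟨r, hr⟩, fun h => absurd h hq, fun _ => ⟨⟨fun h => hrp (congrArg Subtype.val h),
        fun h => hrq (congrArg Subtype.val h), hxy⟩, fun r' h1 h2 h3 => ?_⟩⟩
      exact Subtype.ext (huniq r'.1
        ⟨r'.2, Subtype.coe_ne_coe.2 h1, Subtype.coe_ne_coe.2 h2, h3⟩)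
  choose ι hι0 hι1 using hthird
  refine ⟨ι, fun q => ?_, fun q => ⟨fun h => ?_, fun h => ?_⟩, hι0 p rfl,
    fun q hq => ⟨(hι1 q hq).1.1, (hι1 q hq).1.2.2⟩,
    fun q r hq h1 h2 h3 => (hι1 q hq).2 r h1 h2 h3⟩
  · by_cases hq : q = p
    · rw [hι0 q hq, hι0 p rfl, hq]
    · obtain ⟨⟨h1, h2, x, y, hxy⟩, -⟩ := hι1 q hq
      refine ((hι1 _ h1).2 q hq (Ne.symm h2) ⟨-(y⁻¹ * x), y⁻¹, ?_⟩).symm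
      have hy : y ≠ 0 := by
        rintro rfl
        rw [zero_smul, add_zero] at hxy
        refine h1 (Subtype.ext ?_)
        have h3 := (ι q).2.1
        rw [hxy] at h3 ⊢
        exact p.2.1.smul_eq h3
      rw [hxy, smul_add, smul_smul, smul_smul, inv_mul_cancel₀ hy]
      module
  · by_contra hq
    exact (hι1 q hq).1.2.1 h
  · rw [hι0 q h, h]

theorem IsNormalized.map {F : Type*} [Field F] {v : Fin 3 → F} (hv : IsNormalized v)
    (σ : F →+* F) : IsNormalized fun i => σ (v i) := by
  rcases hv with h | ⟨h, h'⟩ | ⟨h, h', h''⟩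
  · exact Or.inl (by simp [h])
  · exact Or.inr (Or.inl (by simp [h, h']))
  · exact Or.inr (Or.inr (by simp [h, h', h'']))

/-- Corollary 4.2: if a smooth plane cubic curve over a field `K` of characteristic zero
has no inflection point with a representative over `K`, then some element of the Galois
group of `Ω/K` induces a permutation of order exactly 3 on the set of inflection points
(points of `P²(Ω)`, i.e. nonzero vectors of `Ω³` up to scaling, at which the cubic form
and the determinant of its Hessian matrix both vanish). -/
theorem galois_acts_with_order_three_on_inflection_points
    (K Ω : Type) [Field K] [CharZero K] [Field Ω] [Algebra K Ω] [IsAlgClosure K Ω]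
    (f : MvPolynomial (Fin 3) K) (hf : f.IsHomogeneous 3)
    (hsmooth : ∀ x : Fin 3 → Ω, x ≠ 0 →
      ∃ i : Fin 3, MvPolynomial.eval x
        (MvPolynomial.map (algebraMap K Ω) (MvPolynomial.pderiv i f)) ≠ 0)
    -- `Infl x` : the point of `P²(Ω)` represented by `x` is an inflection point
    (Infl : (Fin 3 → Ω) → Prop)
    (hInfl : ∀ x : Fin 3 → Ω, Infl x ↔
      (MvPolynomial.eval x (MvPolynomial.map (algebraMap K Ω) f) = 0 ∧
        Matrix.det (Matrix.of fun (i j : Fin 3) =>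
          MvPolynomial.eval x (MvPolynomial.map (algebraMap K Ω)
            (MvPolynomial.pderiv j (MvPolynomial.pderiv i f)))) = 0))
    -- no inflection point has a representative in `K³`
    (hnoK : ∀ v : Fin 3 → K, v ≠ 0 → ¬ Infl (fun i => algebraMap K Ω (v i))) :
    ∃ σ : Ω ≃ₐ[K] Ω,
      -- the permutation induced by `σ` on the set of inflection points has order
      -- dividing 3 ...
      (∀ v : Fin 3 → Ω, v ≠ 0 → Infl v →
        ∃ c : Ω, c ≠ 0 ∧ (fun i => σ (σ (σ (v i)))) = c • v) ∧
      -- ... and is not the identity, hence has order exactly 3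
      (∃ v : Fin 3 → Ω, v ≠ 0 ∧ Infl v ∧ ∀ c : Ω, (fun i => σ (v i)) ≠ c • v) := by
  have : IsAlgClosed Ω := IsAlgClosure.isAlgClosed K
  have : Algebra.IsAlgebraic K Ω := IsAlgClosure.isAlgebraic
  have : Normal K Ω := IsAlgClosure.normal K Ω
  have : IsGalois K Ω := {}
  have : CharZero Ω := charZero_of_injective_algebraMap (algebraMap K Ω).injective
  let g := MvPolynomial.map (algebraMap K Ω) f
  let T := MvPolynomial.polarization g
  have hg : g.IsHomogeneous 3 := hf.map _
  have hT : IsSmoothCubic T := hg.isSmoothCubic fun x hx => by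
    simpa only [g, MvPolynomial.pderiv_map] using hsmooth x hx
  have hflex : ∀ x, IsFlex T x ↔ x ≠ 0 ∧ Infl x := fun x => by
    rw [hg.isFlex_iff, hInfl]
    have : (MvPolynomial.hessian g).map (MvPolynomial.eval x) = Matrix.of fun (i j : Fin 3) =>
        MvPolynomial.eval x (MvPolynomial.map (algebraMap K Ω)
          (MvPolynomial.pderiv j (MvPolynomial.pderiv i f))) := by
      ext i j
      simp only [MvPolynomial.hessian, g, Matrix.map_apply, Matrix.of_apply,
        MvPolynomial.pderiv_map]
    rw [this]
  have heval : ∀ (σ : Ω ≃ₐ[K] Ω) (x : Fin 3 → Ω) (q : MvPolynomial (Fin 3) K),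
      MvPolynomial.eval (fun i => σ (x i)) (MvPolynomial.map (algebraMap K Ω) q) =
        σ (MvPolynomial.eval x (MvPolynomial.map (algebraMap K Ω) q)) := fun σ x q => by
    rw [MvPolynomial.eval_map, MvPolynomial.eval_map, ← MvPolynomial.aeval_def,
      ← MvPolynomial.aeval_def]
    exact (MvPolynomial.comp_aeval_apply x (σ : Ω →ₐ[K] Ω) q).symm
  have hmap : ∀ (σ : Ω ≃ₐ[K] Ω) (x : Fin 3 → Ω), IsFlex T x → IsFlex T fun i => σ (x i) := by
    intro σ x hx
    rw [hflex, hInfl] at hx ⊢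
    obtain ⟨h0, h1, h2⟩ := hx
    refine ⟨fun h => h0 (funext fun i => σ.injective ?_), ?_, ?_⟩
    · simpa using congrFun h i
    · rw [heval, h1, map_zero]
    · simp only [heval]
      rw [← map_zero σ, ← h2]
      exact (AlgEquiv.map_det σ _).symm
  let _ : MulAction (Ω ≃ₐ[K] Ω) {v // IsNormalized v ∧ IsFlex T v} :=
    { smul := fun σ s => ⟨fun i => σ (s.1 i), s.2.1.map (σ : Ω →+* Ω), hmap σ _ s.2.2⟩
      one_smul := fun _ => rfl
      mul_smul := fun _ _ _ => rfl }
  have hsmul : ∀ (σ : Ω ≃ₐ[K] Ω) (s : {v // IsNormalized v ∧ IsFlex T v}),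
      (σ • s).1 = fun i => σ (s.1 i) := fun _ _ => rfl
  have hcard : Nat.card {v // IsNormalized v ∧ IsFlex T v} = 9 := by
    obtain ⟨p, hp⟩ := hg.exists_isFlex
    exact hT.card_normalized_flexes hp
  have : Finite {v // IsNormalized v ∧ IsFlex T v} := Nat.finite_of_card_ne_zero (by simp [hcard])
  have hinvol : ∀ p : {v // IsNormalized v ∧ IsFlex T v},
      ∃ ι : {v // IsNormalized v ∧ IsFlex T v} → {v // IsNormalized v ∧ IsFlex T v},
        Function.Involutive ι ∧ (∀ q, ι q = q ↔ q = p) ∧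
        ∀ h ∈ (MulAction.toPermHom (Ω ≃ₐ[K] Ω) {v // IsNormalized v ∧ IsFlex T v}).range,
          h p = p → ∀ q, h (ι q) = ι (h q) := by
    intro p
    obtain ⟨ι, hinv, hfix, hp, hι, huniq⟩ := hT.exists_flex_involution p
    refine ⟨ι, hinv, hfix, ?_⟩
    rintro _ ⟨σ, rfl⟩ hσ q
    change σ • p = p at hσ
    change σ • ι q = ι (σ • q)
    have hne : ∀ q, q ≠ p → σ • q ≠ p := fun q hq h => hq (smul_left_cancel σ (h.trans hσ.symm))
    by_cases hq : q = p
    · rw [hq, hσ, hp, hσ]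
    · obtain ⟨h1, x, y, hxy⟩ := hι q hq
      refine huniq _ _ (hne q hq) (hne _ h1) (fun h => ?_) ⟨σ x, σ y, ?_⟩
      · exact hq ((hfix q).1 (smul_left_cancel σ h))
      · rw [show p.1 = (σ • p).1 by rw [hσ], hsmul, hsmul, hsmul, hxy]
        ext i
        simp
  rcases Equiv.Perm.exists_orderOf_eq_three_or_exists_fixed hcard
    (MulAction.toPermHom (Ω ≃ₐ[K] Ω) {v // IsNormalized v ∧ IsFlex T v}).range hinvol with
    ⟨_, ⟨σ, rfl⟩, hord⟩ | ⟨s, hs⟩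
  · refine ⟨σ, fun v hv0 hv => ?_, ?_⟩
    · have hvf := (hflex v).2 ⟨hv0, hv⟩
      obtain ⟨k, hk, hkn⟩ := exists_isNormalized_smul hv0
      have h3 := pow_orderOf_eq_one
        (MulAction.toPermHom (Ω ≃ₐ[K] Ω) {v // IsNormalized v ∧ IsFlex T v} σ)
      rw [hord] at h3
      have h4 := congrArg Subtype.val (Equiv.ext_iff.1 h3 ⟨k • v, hkn, hvf.smul hk⟩)
      have h5 : ∀ i, σ (σ (σ (k * v i))) = k * v i := fun i => congrFun h4 i
      have hk3 : σ (σ (σ k)) ≠ 0 := by simpa using hk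
      refine ⟨k / σ (σ (σ k)), div_ne_zero hk hk3, funext fun i => ?_⟩
      have h6 := h5 i
      rw [map_mul, map_mul, map_mul] at h6
      rw [Pi.smul_apply, smul_eq_mul]
      field_simp
      linear_combination h6
    · by_contra! hcon
      have h1 : MulAction.toPermHom (Ω ≃ₐ[K] Ω) {v // IsNormalized v ∧ IsFlex T v} σ = 1 := by
        ext1 s
        obtain ⟨c, hc⟩ := hcon s.1 s.2.2.1 ((hflex _).1 s.2.2).2
        refine Subtype.ext ?_
        have h2 := (σ • s).2.1
        rw [hsmul, hc] at h2
        exact hc.trans (s.2.1.smul_eq h2)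
      rw [h1, orderOf_one] at hord
      omega
  · exfalso
    have hfix : ∀ i, s.1 i ∈ Set.range (algebraMap K Ω) := fun i => by
      rw [InfiniteGalois.mem_range_algebraMap_iff_fixed]
      intro σ
      exact congrFun (congrArg Subtype.val (hs _ ⟨σ, rfl⟩)) i
    choose v hv using hfix
    have hv' : (fun i => algebraMap K Ω (v i)) = s.1 := funext hv
    have hInf := (hflex _).1 s.2.2
    refine hnoK v ?_ (hv' ▸ hInf.2)
    rintro rfl
    refine hInf.1 ?_
    rw [← hv']
    ext i
    simp
end

section
/- Let k be an algebraically closed field of characteristic zero, and let K = k(λ, μ) be the field of rational functions in two variables over k (the fraction field of the polynomial ring in two variables λ, μ over k). Then the equation λx³ + λ²y³ + μz³ + μ²t³ = 0 has no solution (x, y, z, t) ∈ K⁴ other than x = y = z = t = 0. -/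
/-- Polynomials whose nonzero members have pairwise distinct degrees for a monomial order cannot
cancel each other. -/
theorem MonomialOrder.eq_zero_of_sum_eq_zero_of_degree_injOn {σ R ι : Type*} [CommSemiring R]
    (m : MonomialOrder σ) (s : Finset ι) (f : ι → MvPolynomial σ R)
    (hf : ∀ i ∈ s, ∀ j ∈ s, f i ≠ 0 → f j ≠ 0 → m.degree (f i) = m.degree (f j) → i = j)
    (hsum : ∑ i ∈ s, f i = 0) : ∀ i ∈ s, f i = 0 := by
  classical
  by_contra! ⟨a, ha, ha0⟩
  obtain ⟨i, hi, hmax⟩ := (s.filter fun j => f j ≠ 0).exists_max_image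
    (fun j => m.toSyn (m.degree (f j))) ⟨a, Finset.mem_filter.mpr ⟨ha, ha0⟩⟩
  obtain ⟨his, hi0⟩ := Finset.mem_filter.mp hi
  have hcoeff := congrArg (MvPolynomial.coeff (m.degree (f i))) hsum
  rw [MvPolynomial.coeff_sum, Finset.sum_eq_single_of_mem i his, MvPolynomial.coeff_zero] at hcoeff
  · exact m.coeff_degree_ne_zero_iff.mpr hi0 hcoeff
  · intro j hj hji
    by_cases hj0 : f j = 0
    · simp [hj0]
    · refine m.coeff_eq_zero_of_lt ((hmax j (Finset.mem_filter.mpr ⟨hj, hj0⟩)).lt_of_ne ?_)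
      exact fun h => hji (hf j hj i his hj0 hi0 (m.toSyn.injective h))

/-- A sum of terms `X ^ e i * p i ^ n`, with the exponents `e i` pairwise incongruent
modulo `n`, vanishes only if every `p i` does. -/
theorem MvPolynomial.eq_zero_of_sum_monomial_mul_pow_eq_zero {σ R ι : Type*} [CommRing R]
    [IsDomain R] [Fintype ι] (m : MonomialOrder σ) (n : ℕ) (e : ι → σ →₀ ℕ)
    (he : ∀ i j, (∀ a, e i a ≡ e j a [MOD n]) → i = j) (p : ι → MvPolynomial σ R)
    (h : ∑ i, monomial (e i) 1 * p i ^ n = 0) (i : ι) : p i = 0 := by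
  have hmon (i : ι) : monomial (e i) (1 : R) ≠ 0 := by simp
  have hdeg (i : ι) (hi : monomial (e i) 1 * p i ^ n ≠ 0) :
      m.degree (monomial (e i) 1 * p i ^ n) = e i + n • m.degree (p i) := by
    classical
    rw [m.degree_mul (hmon i) (right_ne_zero_of_mul hi), m.degree_pow, m.degree_monomial,
      if_neg one_ne_zero]
  have hzero := m.eq_zero_of_sum_eq_zero_of_degree_injOn Finset.univ _ (fun i _ j _ hi hj hij => by
    rw [hdeg i hi, hdeg j hj] at hij
    refine he i j fun a => ?_
    have ha := DFunLike.congr_fun hij a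
    simp only [Finsupp.add_apply, Finsupp.smul_apply, smul_eq_mul] at ha
    simpa [Nat.ModEq] using congrArg (· % n) ha) h i (Finset.mem_univ i)
  exact eq_zero_of_pow_eq_zero ((mul_eq_zero.mp hzero).resolve_left (hmon i))

/-- The cubic surface `λx³ + λ²y³ + μz³ + μ²t³ = 0` over `K = k(λ, μ)`, where `k` is an
algebraically closed field of characteristic zero, has no `K`-points. -/
theorem main_example_cubic_has_no_rational_points
    (k : Type) [Field k] [IsAlgClosed k] [CharZero k]
    (x y z t : FractionRing (MvPolynomial (Fin 2) k))
    (l m : FractionRing (MvPolynomial (Fin 2) k))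
    (hl : l = algebraMap (MvPolynomial (Fin 2) k) (FractionRing (MvPolynomial (Fin 2) k))
      (MvPolynomial.X 0))
    (hm : m = algebraMap (MvPolynomial (Fin 2) k) (FractionRing (MvPolynomial (Fin 2) k))
      (MvPolynomial.X 1))
    (h : l * x ^ 3 + l ^ 2 * y ^ 3 + m * z ^ 3 + m ^ 2 * t ^ 3 = 0) :
    x = 0 ∧ y = 0 ∧ z = 0 ∧ t = 0 := by
  let v : Fin 4 → FractionRing (MvPolynomial (Fin 2) k) := ![x, y, z, t]
  obtain ⟨d, hd⟩ := IsLocalization.exist_integer_multiples_of_finite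
    (nonZeroDivisors (MvPolynomial (Fin 2) k)) v
  choose p hp using hd
  let φ := algebraMap (MvPolynomial (Fin 2) k) (FractionRing (MvPolynomial (Fin 2) k))
  change l = φ _ at hl
  change m = φ _ at hm
  have hd0 : φ d ≠ 0 := IsFractionRing.to_map_ne_zero_of_mem_nonZeroDivisors d.2
  have hp' (i : Fin 4) : φ (p i) = φ d * v i :=
    (hp i).trans (Algebra.smul_def _ _)
  let e : Fin 4 → Fin 2 →₀ ℕ :=
    ![.single 0 1, .single 0 2, .single 1 1, .single 1 2]
  have he : ∀ i j, (∀ a, e i a ≡ e j a [MOD 3]) → i = j := by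
    intro i j hij
    have h0 := hij 0
    have h1 := hij 1
    fin_cases i <;> fin_cases j <;> simp [e, Nat.ModEq] at h0 h1 ⊢
  have hsum : ∑ i, MvPolynomial.monomial (e i) 1 * p i ^ 3 = 0 := by
    apply IsFractionRing.injective _ (FractionRing (MvPolynomial (Fin 2) k))
    change φ _ = φ _
    simp only [Fin.sum_univ_four, map_add, map_mul, map_pow, hp', map_zero]
    simp only [e, v, Matrix.cons_val, ← MvPolynomial.X_pow_eq_monomial, map_pow, pow_one,
      ← hl, ← hm]
    linear_combination φ d ^ 3 * h
  have hv (i : Fin 4) : v i = 0 := by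
    have hpi := MvPolynomial.eq_zero_of_sum_monomial_mul_pow_eq_zero
      MonomialOrder.lex 3 e he p hsum i
    have := hp' i
    rw [hpi, map_zero] at this
    exact (mul_eq_zero.mp this.symm).resolve_left hd0
  exact ⟨hv 0, hv 1, hv 2, hv 3⟩
end

section
/- Let k be an algebraically closed field of characteristic zero, and let K = k(λ, μ) be the field of rational functions in two variables over k (the fraction field of the polynomial ring in two variables λ, μ over k). Then the equation μt³ = x³ + λy³ + λ²z³ has no solution (x, y, z, t) ∈ K⁴ other than x = y = z = t = 0. -/
/-- Nonzero polynomials whose degrees for a monomial order are pairwise distinct cannot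
sum to zero. -/
theorem MonomialOrder.eq_zero_of_sum_eq_zero_of_degree_ne {σ R ι : Type*} [CommSemiring R]
    (o : MonomialOrder σ) (s : Finset ι) (p : ι → MvPolynomial σ R)
    (hdeg : ∀ i ∈ s, ∀ j ∈ s, i ≠ j → p i ≠ 0 → p j ≠ 0 → o.degree (p i) ≠ o.degree (p j))
    (hsum : ∑ i ∈ s, p i = 0) : ∀ i ∈ s, p i = 0 := by
  classical
  by_contra! hne
  obtain ⟨i, hi, hpi⟩ := hne
  obtain ⟨j, hj, hmax⟩ := (s.filter fun i => p i ≠ 0).exists_max_image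
    (fun i => o.toSyn (o.degree (p i))) ⟨i, Finset.mem_filter.2 ⟨hi, hpi⟩⟩
  rw [Finset.mem_filter] at hj
  have hcoeff := congrArg (MvPolynomial.coeff (o.degree (p j))) hsum
  rw [MvPolynomial.coeff_sum, Finset.sum_eq_single_of_mem j hj.1] at hcoeff
  · exact o.leadingCoeff_ne_zero_iff.2 hj.2 (by simpa [MonomialOrder.leadingCoeff] using hcoeff)
  · intro b hb hbj
    by_cases hpb : p b = 0
    · simp [hpb]
    · refine o.coeff_eq_zero_of_lt (lt_of_le_of_ne (hmax b (Finset.mem_filter.2 ⟨hb, hpb⟩)) ?_)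
      exact fun h => hdeg b hb j hj.1 hbj hpb hj.2 (o.toSyn.injective h)

/-- The surface `μt³ = x³ + λy³ + λ²z³` has no points over the polynomial ring in `λ` and `μ`:
the leading exponents of the four terms are pairwise distinct modulo `3`. -/
theorem MvPolynomial.eq_zero_of_X_mul_cube_eq {R : Type*} [CommRing R] [IsDomain R]
    (x y z t : MvPolynomial (Fin 2) R)
    (h : X 1 * t ^ 3 = x ^ 3 + X 0 * y ^ 3 + X 0 ^ 2 * z ^ 3) :
    x = 0 ∧ y = 0 ∧ z = 0 ∧ t = 0 := by
  let o : MonomialOrder (Fin 2) := MonomialOrder.lex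
  let p : Fin 4 → MvPolynomial (Fin 2) R := ![x ^ 3, X 0 * y ^ 3, X 0 ^ 2 * z ^ 3, -(X 1 * t ^ 3)]
  let e : Fin 4 → Fin 2 →₀ ℕ := ![0, Finsupp.single 0 1, Finsupp.single 0 2, Finsupp.single 1 1]
  have hdeg : ∀ i, p i ≠ 0 → ∃ d : Fin 2 →₀ ℕ, o.degree (p i) = e i + 3 • d := by
    have hX (i : Fin 2) : (X i : MvPolynomial (Fin 2) R) ≠ 0 := X_ne_zero i
    intro i hi
    fin_cases i
    · exact ⟨o.degree x, by simp [p, e, o.degree_pow]⟩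
    · refine ⟨o.degree y, ?_⟩
      have hy : y ≠ 0 := by rintro rfl; simp [p] at hi
      simp [p, e, o.degree_mul (hX 0) (pow_ne_zero 3 hy), o.degree_pow, o.degree_X]
    · refine ⟨o.degree z, ?_⟩
      have hz : z ≠ 0 := by rintro rfl; simp [p] at hi
      simp [p, e, o.degree_mul (pow_ne_zero 2 (hX 0)) (pow_ne_zero 3 hz), o.degree_pow, o.degree_X]
    · refine ⟨o.degree t, ?_⟩
      have ht : t ≠ 0 := by rintro rfl; simp [p] at hi
      simp [p, e, o.degree_mul (hX 1) (pow_ne_zero 3 ht), o.degree_pow, o.degree_X]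
  have hp : ∀ i ∈ Finset.univ, p i = 0 := by
    refine o.eq_zero_of_sum_eq_zero_of_degree_ne Finset.univ p ?_ ?_
    · intro i _ j _ hij hi hj heq
      obtain ⟨c, hc⟩ := hdeg i hi
      obtain ⟨d, hd⟩ := hdeg j hj
      rw [hc, hd] at heq
      have h0 := DFunLike.congr_fun heq 0
      have h1 := DFunLike.congr_fun heq 1
      fin_cases i <;> fin_cases j <;> simp [e] at hij h0 h1 <;> omega
    · simp only [Fin.sum_univ_four, p, h, Matrix.cons_val]
      ring
  have hx := hp 0 (Finset.mem_univ _)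
  have hy := hp 1 (Finset.mem_univ _)
  have hz := hp 2 (Finset.mem_univ _)
  have ht := hp 3 (Finset.mem_univ _)
  simp [p] at hx hy hz ht
  exact ⟨hx, hy, hz, ht⟩

/-- The cubic surface `μt³ = x³ + λy³ + λ²z³` over `K = k(λ, μ)`, where `k` is an
algebraically closed field of characteristic zero, has no `K`-points. -/
theorem section5_example_cubic_has_no_rational_points
    (k : Type) [Field k] [IsAlgClosed k] [CharZero k]
    (x y z t : FractionRing (MvPolynomial (Fin 2) k))
    (l m : FractionRing (MvPolynomial (Fin 2) k))
    (hl : l = algebraMap (MvPolynomial (Fin 2) k) (FractionRing (MvPolynomial (Fin 2) k))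
      (MvPolynomial.X 0))
    (hm : m = algebraMap (MvPolynomial (Fin 2) k) (FractionRing (MvPolynomial (Fin 2) k))
      (MvPolynomial.X 1))
    (h : m * t ^ 3 = x ^ 3 + l * y ^ 3 + l ^ 2 * z ^ 3) :
    x = 0 ∧ y = 0 ∧ z = 0 ∧ t = 0 := by
  subst hl hm
  obtain ⟨b, hb⟩ := IsLocalization.exist_integer_multiples_of_finite
    (nonZeroDivisors (MvPolynomial (Fin 2) k)) ![x, y, z, t]
  choose q hq using hb
  have hx : algebraMap _ _ (q 0) = algebraMap _ _ (b : MvPolynomial (Fin 2) k) * x := by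
    simpa [Algebra.smul_def] using hq 0
  have hy : algebraMap _ _ (q 1) = algebraMap _ _ (b : MvPolynomial (Fin 2) k) * y := by
    simpa [Algebra.smul_def] using hq 1
  have hz : algebraMap _ _ (q 2) = algebraMap _ _ (b : MvPolynomial (Fin 2) k) * z := by
    simpa [Algebra.smul_def] using hq 2
  have ht : algebraMap _ _ (q 3) = algebraMap _ _ (b : MvPolynomial (Fin 2) k) * t := by
    simpa [Algebra.smul_def] using hq 3
  have hb0 := IsFractionRing.to_map_ne_zero_of_mem_nonZeroDivisors
    (K := FractionRing (MvPolynomial (Fin 2) k)) b.2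
  have hq0 := MvPolynomial.eq_zero_of_X_mul_cube_eq (q 0) (q 1) (q 2) (q 3) <| by
    apply IsFractionRing.injective (MvPolynomial (Fin 2) k)
      (FractionRing (MvPolynomial (Fin 2) k))
    simp only [map_add, map_mul, map_pow, hx, hy, hz, ht]
    linear_combination (algebraMap _ _ (b : MvPolynomial (Fin 2) k)) ^ 3 * h
  obtain ⟨h0, h1, h2, h3⟩ := hq0
  rw [h0, map_zero, zero_eq_mul] at hx
  rw [h1, map_zero, zero_eq_mul] at hy
  rw [h2, map_zero, zero_eq_mul] at hz
  rw [h3, map_zero, zero_eq_mul] at ht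
  exact ⟨hx.resolve_left hb0, hy.resolve_left hb0, hz.resolve_left hb0, ht.resolve_left hb0⟩
end

section
/- Let k be an algebraically closed field of characteristic zero, and let K = k(λ, μ) be the field of rational functions in two variables over k (the fraction field of the polynomial ring in two variables λ, μ over k). Then the equation x³ + λy³ + λ²z³ = 0 has no solution (x, y, z) ∈ K³ other than x = y = z = 0. -/
/-- In a domain with well-founded divisibility, infinite descent at a prime `p` shows that
`a³ + p b³ + p² c³ = 0` has only the trivial solution. -/
theorem Prime.eq_zero_of_cube_add_mul_cube_add_sq_mul_cube_eq_zero
    {R : Type*} [CommRing R] [IsDomain R] [WfDvdMonoid R] {p a b c : R} (hp : Prime p)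
    (h : a ^ 3 + p * b ^ 3 + p ^ 2 * c ^ 3 = 0) : a = 0 ∧ b = 0 ∧ c = 0 := by
  have key : ∀ (n : ℕ) (a b c : R), a ^ 3 + p * b ^ 3 + p ^ 2 * c ^ 3 = 0 →
      p ^ n ∣ a ∧ p ^ n ∣ b ∧ p ^ n ∣ c := by
    intro n
    induction n with
    | zero => simp
    | succ n ih =>
      intro a b c h
      obtain ⟨a, rfl⟩ : p ∣ a :=
        hp.dvd_of_dvd_pow (n := 3) ⟨-(b ^ 3 + p * c ^ 3), by linear_combination h⟩
      have h₁ : p ^ 2 * a ^ 3 + b ^ 3 + p * c ^ 3 = 0 :=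
        mul_left_cancel₀ hp.ne_zero (by linear_combination h)
      obtain ⟨b, rfl⟩ : p ∣ b :=
        hp.dvd_of_dvd_pow (n := 3) ⟨-(p * a ^ 3 + c ^ 3), by linear_combination h₁⟩
      have h₂ : p * a ^ 3 + p ^ 2 * b ^ 3 + c ^ 3 = 0 :=
        mul_left_cancel₀ hp.ne_zero (by linear_combination h₁)
      obtain ⟨c, rfl⟩ : p ∣ c :=
        hp.dvd_of_dvd_pow (n := 3) ⟨-(a ^ 3 + p * b ^ 3), by linear_combination h₂⟩
      have h₃ : a ^ 3 + p * b ^ 3 + p ^ 2 * c ^ 3 = 0 :=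
        mul_left_cancel₀ hp.ne_zero (by linear_combination h₂)
      obtain ⟨ha, hb, hc⟩ := ih a b c h₃
      simp only [pow_succ']
      exact ⟨mul_dvd_mul_left p ha, mul_dvd_mul_left p hb, mul_dvd_mul_left p hc⟩
  have zero_of_dvd : ∀ r : R, (∀ n : ℕ, p ^ n ∣ r) → r = 0 := by
    intro r hr
    by_contra hr₀
    obtain ⟨n, hn⟩ := FiniteMultiplicity.of_not_isUnit hp.not_isUnit hr₀
    exact hn (hr (n + 1))
  exact ⟨zero_of_dvd a fun n => (key n a b c h).1, zero_of_dvd b fun n => (key n a b c h).2.1,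
    zero_of_dvd c fun n => (key n a b c h).2.2⟩


/-- The plane cubic curve `x³ + λy³ + λ²z³ = 0` over `K = k(λ, μ)`, where `k` is an
algebraically closed field of characteristic zero, has no `K`-points. -/
theorem section5_example_plane_cubic_has_no_rational_points
    (k : Type) [Field k] [IsAlgClosed k] [CharZero k]
    (x y z : FractionRing (MvPolynomial (Fin 2) k))
    (l : FractionRing (MvPolynomial (Fin 2) k))
    (hl : l = algebraMap (MvPolynomial (Fin 2) k) (FractionRing (MvPolynomial (Fin 2) k))
      (MvPolynomial.X 0))
    (h : x ^ 3 + l * y ^ 3 + l ^ 2 * z ^ 3 = 0) :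
    x = 0 ∧ y = 0 ∧ z = 0 := by
  subst hl
  obtain ⟨d, hd⟩ := IsLocalization.exist_integer_multiples_of_finite
    (nonZeroDivisors (MvPolynomial (Fin 2) k)) ![x, y, z]
  obtain ⟨a, ha⟩ := hd 0
  obtain ⟨b, hb⟩ := hd 1
  obtain ⟨c, hc⟩ := hd 2
  simp only [Algebra.smul_def, Matrix.cons_val] at ha hb hc
  have hd₀ : algebraMap (MvPolynomial (Fin 2) k) (FractionRing (MvPolynomial (Fin 2) k)) d ≠ 0 :=
    IsFractionRing.to_map_ne_zero_of_mem_nonZeroDivisors d.2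
  have hpoly : a ^ 3 + MvPolynomial.X 0 * b ^ 3 + MvPolynomial.X 0 ^ 2 * c ^ 3 = 0 := by
    apply IsFractionRing.injective (MvPolynomial (Fin 2) k)
      (FractionRing (MvPolynomial (Fin 2) k))
    simp only [map_add, map_mul, map_pow, map_zero, ha, hb, hc]
    linear_combination
      algebraMap (MvPolynomial (Fin 2) k) (FractionRing (MvPolynomial (Fin 2) k)) d ^ 3 * h
  obtain ⟨rfl, rfl, rfl⟩ :=
    MvPolynomial.X_prime.eq_zero_of_cube_add_mul_cube_add_sq_mul_cube_eq_zero hpoly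
  rw [map_zero, zero_eq_mul] at ha hb hc
  exact ⟨ha.resolve_left hd₀, hb.resolve_left hd₀, hc.resolve_left hd₀⟩
end

section
/- Let W be the Coxeter group of type E₆ (the group presented by the Coxeter matrix E₆; it is isomorphic to the Weyl group W(E₆), a finite group of order 51840). Let P be a Sylow 3-subgroup of W, and let γ be an element of P that does not lie in the center of P. Then the centralizer of γ in P is abelian. In particular, every subgroup of P all of whose elements commute with γ is abelian. -/
open MulAction

section ParabolicStabilizer

variable {B G X : Type*} [Group G] [LinearOrder X] [MulAction G X]

/-- Compatibility of an order with an action of involutions `s i` satisfying simply laced braid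
relations. It models the weights of a minuscule representation, ordered so that raising a weight
makes it smaller. -/
def IsMinuscule (X : Type*) [LinearOrder X] [MulAction G X] (s : B → G) : Prop :=
  ∀ (i j : B) (x : X), i ≠ j → s i • x < x → s j • x ≤ x →
    (Commute (s i) (s j) ∧ s j • s i • x ≤ s i • x ∧ s i • s j • x ≤ s j • x) ∨
    (s i * s j * s i = s j * s i * s j ∧ s j • x = x ∧ s j • s i • x < s i • x ∧
      s i • s j • s i • x = s j • s i • x)

open Classical in
/-- The coset of `K` carrying a highest point to `x`, read off from a chain of generators `s i`,
`i ∈ J`, that lead from `x` down to a minimal point. -/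
noncomputable def cosetOfPoint [WellFoundedLT X] (s : B → G) (J : Set B) (K : Subgroup G) (x : X) :
    G ⧸ K :=
  if h : ∃ i ∈ J, s i • x < x then
    s h.choose • cosetOfPoint s J K (s h.choose • x)
  else ((1 : G) : G ⧸ K)
termination_by wellFounded_lt.wrap x
decreasing_by exact h.choose_spec.2

variable [WellFoundedLT X]

theorem cosetOfPoint_of_forall_not_lt {s : B → G} {J : Set B} {K : Subgroup G} {x : X}
    (h : ∀ i ∈ J, ¬ s i • x < x) : cosetOfPoint s J K x = ((1 : G) : G ⧸ K) := by
  rw [cosetOfPoint, dif_neg (by simpa using h)]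

theorem exists_cosetOfPoint_eq_smul {s : B → G} {J : Set B} (K : Subgroup G) {x : X}
    (h : ∃ i ∈ J, s i • x < x) :
    ∃ i ∈ J, s i • x < x ∧ cosetOfPoint s J K x = s i • cosetOfPoint s J K (s i • x) :=
  ⟨h.choose, h.choose_spec.1, h.choose_spec.2, by rw [cosetOfPoint, dif_pos h]⟩

variable {s : B → G} {J : Set B} {S : Set X} {x₀ : X}

theorem smul_cosetOfPoint_of_le (hs : ∀ i, s i * s i = 1) (hmin : IsMinuscule X s)
    (hS : ∀ i ∈ J, ∀ x ∈ S, s i • x ∈ S)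
    (hx₀ : ∀ x ∈ S, (∀ i ∈ J, ¬ s i • x < x) → x = x₀) {x : X} (hx : x ∈ S) {j : B} (hj : j ∈ J)
    (hle : s j • x ≤ x) :
    s j • cosetOfPoint s J (Subgroup.closure (s '' {i ∈ J | s i • x₀ = x₀})) x =
      cosetOfPoint s J (Subgroup.closure (s '' {i ∈ J | s i • x₀ = x₀})) (s j • x) := by
  set K := Subgroup.closure (s '' {i ∈ J | s i • x₀ = x₀}) with hK
  have hsc (i : B) (y : G ⧸ K) : s i • s i • y = y := by rw [smul_smul, hs, one_smul]
  induction x using WellFoundedLT.induction generalizing j with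
  | ind x ih =>
  by_cases h : ∃ i ∈ J, s i • x < x
  · obtain ⟨i, hi, hlt, hT⟩ := exists_cosetOfPoint_eq_smul K h
    rcases eq_or_ne i j with rfl | hij
    · rw [hT, hsc]
    have hu := hS i hi x hx
    rcases hmin i j x hij hlt hle with ⟨hc, hle₁, hle₂⟩ | ⟨hb, hfix, hlt', hfix'⟩
    · have hcx : s j • s i • x = s i • s j • x := by rw [smul_smul, smul_smul, hc.eq]
      rw [hT, smul_smul, ← hc.eq, ← smul_smul, ih _ hlt hu hj hle₁, hcx]
      rcases hle.eq_or_lt with heq | hlt₂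
      · rw [heq, hT]
      · rw [← ih _ hlt₂ (hS j hj x hx) hi hle₂, hsc]
    · have hv := hS j hj _ hu
      have h₁ := ih _ hlt hu hj hlt'.le
      have h₂ := ih _ (hlt'.trans hlt) hv hi hfix'.le
      rw [hfix'] at h₂
      have h₃ : cosetOfPoint s J K (s i • x) = s j • cosetOfPoint s J K (s j • s i • x) := by
        rw [← h₁, hsc]
      rw [hfix, hT, h₃, smul_smul, smul_smul, ← hb, ← smul_smul, h₂, ← smul_smul]
  · push Not at h
    obtain rfl := hx₀ x hx fun i hi => (h i hi).not_gt
    have heq : s j • x = x := le_antisymm hle (h j hj)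
    rw [heq, cosetOfPoint_of_forall_not_lt fun i hi => (h i hi).not_gt]
    change ((s j * 1 : G) : G ⧸ K) = _
    rw [mul_one, QuotientGroup.eq, mul_one, inv_mem_iff]
    exact Subgroup.subset_closure ⟨j, ⟨hj, heq⟩, rfl⟩

theorem smul_cosetOfPoint (hs : ∀ i, s i * s i = 1) (hmin : IsMinuscule X s)
    (hS : ∀ i ∈ J, ∀ x ∈ S, s i • x ∈ S)
    (hx₀ : ∀ x ∈ S, (∀ i ∈ J, ¬ s i • x < x) → x = x₀) {g : G}
    (hg : g ∈ Subgroup.closure (s '' J)) :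
    ∀ x ∈ S, g • x ∈ S ∧
      g • cosetOfPoint s J (Subgroup.closure (s '' {i ∈ J | s i • x₀ = x₀})) x =
        cosetOfPoint s J (Subgroup.closure (s '' {i ∈ J | s i • x₀ = x₀})) (g • x) := by
  set K := Subgroup.closure (s '' {i ∈ J | s i • x₀ = x₀}) with hK
  have hgen : ∀ j ∈ J, ∀ x ∈ S, s j • x ∈ S ∧
      s j • cosetOfPoint s J K x = cosetOfPoint s J K (s j • x) := fun j hj x hx => by
    refine ⟨hS j hj x hx, ?_⟩
    rcases le_total (s j • x) x with hle | hle
    · exact smul_cosetOfPoint_of_le hs hmin hS hx₀ hx hj hle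
    · have h := smul_cosetOfPoint_of_le hs hmin hS hx₀ (hS j hj x hx) hj
        (by rwa [smul_smul, hs, one_smul])
      rw [smul_smul (s j) (s j) x, hs, one_smul] at h
      rw [← h, smul_smul, hs, one_smul]
  induction hg using Subgroup.closure_induction'' with
  | one => simp
  | mem _ h => obtain ⟨j, hj, rfl⟩ := h; exact hgen j hj
  | inv_mem _ h =>
    obtain ⟨j, hj, rfl⟩ := h
    rw [inv_eq_of_mul_eq_one_left (hs j)]
    exact hgen j hj
  | mul a b _ _ iha ihb =>
    intro x hx
    obtain ⟨hb, hb'⟩ := ihb x hx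
    obtain ⟨ha, ha'⟩ := iha _ hb
    rw [mul_smul, mul_smul, hb', ha']
    exact ⟨ha, rfl⟩

/-- If the points of `S` are connected to the only highest point `x₀` of `S` by the `s i` with
`i ∈ J`, then the parabolic subgroup fixing `x₀` has index `#S` in the one generated by `J`. -/
theorem relIndex_closure_image_eq_ncard (hs : ∀ i, s i * s i = 1) (hmin : IsMinuscule X s)
    (hS : ∀ i ∈ J, ∀ x ∈ S, s i • x ∈ S) (hx₀S : x₀ ∈ S) (hx₀J : ∀ i ∈ J, ¬ s i • x₀ < x₀)
    (hx₀ : ∀ x ∈ S, (∀ i ∈ J, ¬ s i • x < x) → x = x₀) :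
    (Subgroup.closure (s '' {i ∈ J | s i • x₀ = x₀})).relIndex (Subgroup.closure (s '' J)) =
      S.ncard := by
  set K := Subgroup.closure (s '' {i ∈ J | s i • x₀ = x₀}) with hK
  set H := Subgroup.closure (s '' J) with hH
  have hKfix : K ≤ stabilizer G x₀ := by
    rw [hK, Subgroup.closure_le]
    rintro _ ⟨i, hi, rfl⟩
    exact hi.2
  have hstab : K.subgroupOf H = stabilizer H x₀ := by
    ext ⟨g, hg⟩
    rw [Subgroup.mem_subgroupOf, mem_stabilizer_iff, Subgroup.mk_smul]
    refine ⟨fun h => hKfix h, fun h => ?_⟩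
    have hT := (smul_cosetOfPoint hs hmin hS hx₀ hg x₀ hx₀S).2
    rw [h, cosetOfPoint_of_forall_not_lt hx₀J] at hT
    change ((g * 1 : G) : G ⧸ K) = _ at hT
    rwa [mul_one, QuotientGroup.eq, mul_one, inv_mem_iff] at hT
  have horb : orbit H x₀ = S := by
    refine Set.Subset.antisymm ?_ fun x => ?_
    · rintro _ ⟨⟨g, hg⟩, rfl⟩
      exact (smul_cosetOfPoint hs hmin hS hx₀ hg x₀ hx₀S).1
    · induction x using WellFoundedLT.induction with
      | ind x ih =>
      intro hx
      by_cases h : ∃ i ∈ J, s i • x < x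
      · obtain ⟨i, hi, hlt⟩ := h
        have hsx : x = s i • s i • x := by rw [smul_smul, hs, one_smul]
        rw [hsx]
        exact mem_orbit_of_mem_orbit (⟨s i, Subgroup.subset_closure ⟨i, hi, rfl⟩⟩ : H)
          (ih _ hlt (hS i hi x hx))
      · rw [hx₀ x hx (by simpa using h)]
        exact mem_orbit_self _
  rw [Subgroup.relIndex, hstab, index_stabilizer, horb]

end ParabolicStabilizer

section PGroup

/-- In a group of order `p ^ 4`, the centralizer of a non-central element is abelian. -/
theorem Commute.of_commute_of_card_eq_prime_pow_four {p : ℕ} [Fact p.Prime] {G : Type*} [Group G]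
    (hG : Nat.card G = p ^ 4) {γ : G} (hγ : γ ∉ Subgroup.center G) {a b : G}
    (ha : Commute a γ) (hb : Commute b γ) : Commute a b := by
  have hp : p.Prime := Fact.out
  have : Finite G := Nat.finite_of_card_ne_zero (by rw [hG]; exact pow_ne_zero _ hp.ne_zero)
  have hpG : IsPGroup p G := IsPGroup.of_card hG
  have : Nontrivial G := ⟨γ, 1, fun h => hγ (h ▸ one_mem _)⟩
  set C := Subgroup.centralizer {γ} with hC
  have hmemC {x : G} : x ∈ C ↔ Commute x γ := by
    rw [hC, Subgroup.mem_centralizer_singleton_iff]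
    exact (commute_iff_eq x γ).symm
  have hCtop : C ≠ ⊤ := fun h => hγ <| Subgroup.mem_center_iff.2 fun g =>
    (hmemC.1 (h ▸ Subgroup.mem_top g)).eq
  obtain ⟨c, hc, hcC⟩ := (Nat.dvd_prime_pow hp).1 (hG ▸ C.card_subgroup_dvd_card)
  have hc3 : c ≤ 3 := by
    by_contra! h
    exact hCtop <| C.eq_top_of_card_eq <| by rw [hcC, hG, le_antisymm hc h]
  have hZZ : (Subgroup.center G) < (Subgroup.center C).map C.subtype := by
    refine SetLike.lt_iff_le_and_exists.2 ⟨fun z hz => ?_, γ, ?_, hγ⟩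
    · refine ⟨⟨z, hmemC.2 (Subgroup.mem_center_iff.1 hz γ).symm⟩, ?_, rfl⟩
      exact Subgroup.mem_center_iff.2 fun g => Subtype.ext (Subgroup.mem_center_iff.1 hz g)
    · refine ⟨⟨γ, hmemC.2 (Commute.refl γ)⟩, ?_, rfl⟩
      exact Subgroup.mem_center_iff.2 fun g => Subtype.ext (hmemC.1 g.2).eq
  obtain ⟨m, -, hm⟩ := (Nat.dvd_prime_pow hp).1 (hG ▸ (Subgroup.center G).card_subgroup_dvd_card)
  obtain ⟨z, hz, hzC⟩ := (Nat.dvd_prime_pow hp).1 (hcC ▸ (Subgroup.center C).card_subgroup_dvd_card)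
  have hm1 : 1 ≤ m := by
    have := hpG.center_nontrivial
    have := Finite.one_lt_card_iff_nontrivial.2 this
    rw [hm] at this
    by_contra! h
    simp [Nat.lt_one_iff.1 h] at this
  have hmz : m < z := by
    have h : Nat.card (Subgroup.center G) < Nat.card ((Subgroup.center C).map C.subtype) :=
      Set.ncard_lt_ncard hZZ
    rw [Subgroup.card_map_of_injective C.subtype_injective, hm, hzC] at h
    exact (Nat.pow_lt_pow_iff_right hp.one_lt).1 h
  have hquot : Nat.card (C ⧸ Subgroup.center C) ∣ p := by
    have h := (Subgroup.center C).card_eq_card_quotient_mul_card_subgroup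
    rw [hcC, hzC, ← Nat.sub_add_cancel hz, pow_add] at h
    rw [← Nat.eq_of_mul_eq_mul_right (pow_pos hp.pos z) h]
    exact (pow_dvd_pow p (by omega)).trans (pow_one p).dvd
  have := isCyclic_of_card_dvd_prime hquot
  have hcomm := isMulCommutative_of_isCyclic_quotient_center_self C
  exact congrArg Subtype.val
    (hcomm.is_comm.comm (⟨a, hmemC.2 ha⟩ : C) ⟨b, hmemC.2 hb⟩)

end PGroup

namespace CoxeterMatrix.E₆

/-- The action of the simple reflections of type `E₆` on the weights of the minuscule
27-dimensional representation, numbered from the highest weight downwards. -/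
def reflectWeight (i : Fin 6) (x : Fin 27) : Fin 27 :=
  (![![1, 0, 2, 3, 4, 5, 6, 7, 8, 9, 12, 11, 10, 15, 14, 13, 17, 16, 19, 18, 21, 20, 22, 23, 24,
        25, 26],
     ![0, 1, 2, 4, 3, 6, 5, 9, 8, 7, 10, 11, 12, 13, 14, 15, 16, 17, 20, 21, 18, 19, 23, 22, 24,
        25, 26],
     ![0, 2, 1, 3, 4, 5, 6, 7, 10, 9, 8, 13, 12, 11, 16, 15, 14, 17, 18, 22, 20, 23, 19, 21, 24,
        25, 26],
     ![0, 1, 3, 2, 4, 5, 8, 7, 6, 11, 10, 9, 12, 13, 14, 15, 18, 19, 16, 17, 20, 21, 22, 24, 23,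
        25, 26],
     ![0, 1, 2, 5, 6, 3, 4, 7, 8, 9, 10, 14, 12, 16, 11, 17, 13, 15, 18, 19, 20, 21, 22, 23, 25,
        24, 26],
     ![0, 1, 2, 3, 4, 7, 9, 5, 11, 6, 13, 8, 15, 10, 14, 12, 16, 17, 18, 19, 20, 21, 22, 23, 24,
        26, 25]] : Fin 6 → Fin 27 → Fin 27) i x

theorem reflectWeight_involutive (i : Fin 6) : Function.Involutive (reflectWeight i) := by
  revert i
  unfold Function.Involutive
  decide +kernel

theorem isLiftable_reflectWeight :
    E₆.IsLiftable fun i => (reflectWeight_involutive i).toPerm := by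
  intro i j
  ext1 x
  revert i j x
  decide +kernel

/-- The action of the Coxeter group of type `E₆` on the 27 minuscule weights. -/
noncomputable instance : MulAction E₆.Group (Fin 27) :=
  MulAction.compHom (Fin 27) (E₆.toCoxeterSystem.lift ⟨_, isLiftable_reflectWeight⟩)

theorem simple_smul (i : Fin 6) (x : Fin 27) : E₆.simple i • x = reflectWeight i x := by
  change E₆.toCoxeterSystem.lift ⟨_, isLiftable_reflectWeight⟩ (E₆.toCoxeterSystem.simple i) x = _
  rw [CoxeterSystem.lift_apply_simple]
  rfl

theorem simple_mul_self (i : Fin 6) : E₆.simple i * E₆.simple i = 1 :=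
  E₆.toCoxeterSystem.simple_mul_simple_self i

theorem inv_simple (i : Fin 6) : (E₆.simple i)⁻¹ = E₆.simple i :=
  E₆.toCoxeterSystem.inv_simple i

theorem commute_simple {i j : Fin 6} (h : E₆ i j = 2) : Commute (E₆.simple i) (E₆.simple j) := by
  have hr := E₆.toCoxeterSystem.simple_mul_simple_pow i j
  rw [h, pow_two, toCoxeterSystem_simple, ← eq_inv_iff_mul_eq_one, mul_inv_rev, inv_simple,
    inv_simple] at hr
  exact hr

theorem simple_braid {i j : Fin 6} (h : E₆ i j = 3) :
    E₆.simple i * E₆.simple j * E₆.simple i = E₆.simple j * E₆.simple i * E₆.simple j := by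
  have hr := E₆.toCoxeterSystem.simple_mul_simple_pow i j
  rw [h, toCoxeterSystem_simple] at hr
  have hr' : E₆.simple i * E₆.simple j * E₆.simple i *
      (E₆.simple j * E₆.simple i * E₆.simple j) = 1 := by
    simpa only [pow_succ, pow_zero, one_mul, mul_assoc] using hr
  rw [eq_inv_of_mul_eq_one_left hr']
  simp only [mul_inv_rev, inv_simple, mul_assoc]

theorem isMinuscule_simple : IsMinuscule (Fin 27) E₆.simple := by
  have key : ∀ (i j : Fin 6) (x : Fin 27), i ≠ j → reflectWeight i x < x → reflectWeight j x ≤ x →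
      (E₆ i j = 2 ∧ reflectWeight j (reflectWeight i x) ≤ reflectWeight i x ∧
        reflectWeight i (reflectWeight j x) ≤ reflectWeight j x) ∨
      (E₆ i j = 3 ∧ reflectWeight j x = x ∧
        reflectWeight j (reflectWeight i x) < reflectWeight i x ∧
        reflectWeight i (reflectWeight j (reflectWeight i x)) =
          reflectWeight j (reflectWeight i x)) := by
    intro i
    fin_cases i <;> decide +kernel
  intro i j x hij
  simp only [simple_smul]
  exact fun h₁ h₂ => (key i j x hij h₁ h₂).imp (And.imp_left commute_simple)
    (And.imp_left simple_braid)

/-- The parabolic subgroup generated by the simple reflections in `J`. -/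
def parabolic (J : Finset (Fin 6)) : Subgroup E₆.Group :=
  Subgroup.closure (E₆.simple '' J)

theorem relIndex_parabolic (I J : Finset (Fin 6)) (S : Finset (Fin 27)) (x₀ : Fin 27) (n : ℕ)
    (h : S.card = n ∧ {i ∈ J | reflectWeight i x₀ = x₀} = I ∧
      (∀ i ∈ J, ∀ x ∈ S, reflectWeight i x ∈ S) ∧ x₀ ∈ S ∧
      (∀ i ∈ J, ¬ reflectWeight i x₀ < x₀) ∧
      ∀ x ∈ S, (∀ i ∈ J, ¬ reflectWeight i x < x) → x = x₀) :
    (parabolic I).relIndex (parabolic J) = n := by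
  obtain ⟨hn, hI, hS, hx₀S, hx₀J, hx₀⟩ := h
  have h := relIndex_closure_image_eq_ncard (J := (J : Set (Fin 6))) (S := (S : Set (Fin 27)))
    (x₀ := x₀) simple_mul_self isMinuscule_simple
  simp only [simple_smul, Finset.mem_coe, Set.ncard_coe_finset] at h
  rw [← hn, ← h hS hx₀S hx₀J hx₀, ← hI, parabolic, parabolic, Finset.coe_filter]

theorem parabolic_mono {I J : Finset (Fin 6)} (h : I ⊆ J) : parabolic I ≤ parabolic J :=
  Subgroup.closure_mono (Set.image_mono (Finset.coe_subset.2 h))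

theorem parabolic_univ : parabolic Finset.univ = ⊤ := by
  rw [parabolic, Finset.coe_univ, Set.image_univ]
  exact E₆.toCoxeterSystem.subgroup_closure_range_simple

theorem parabolic_empty : parabolic ∅ = ⊥ := by
  simp [parabolic]

theorem card_group : Nat.card E₆.Group = 51840 := by
  have h₁ : (parabolic {1, 2, 3, 4, 5}).relIndex (parabolic Finset.univ) = 27 :=
    relIndex_parabolic _ Finset.univ Finset.univ 0 _ (by decide +kernel)
  have h₂ : (parabolic {1, 3, 4, 5}).relIndex (parabolic {1, 2, 3, 4, 5}) = 16 :=
    relIndex_parabolic _ {1, 2, 3, 4, 5} {1, 2, 3, 4, 5, 6, 7, 8, 9, 10, 11, 13, 14, 16, 18, 20} 1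
      _ (by decide +kernel)
  have h₃ : (parabolic {1, 4, 5}).relIndex (parabolic {1, 3, 4, 5}) = 10 :=
    relIndex_parabolic _ {1, 3, 4, 5} {2, 3, 4, 5, 6, 7, 8, 9, 11, 14} 2 _ (by decide +kernel)
  have h₄ : (parabolic {5}).relIndex (parabolic {1, 4, 5}) = 6 :=
    relIndex_parabolic _ {1, 4, 5} {3, 4, 5, 6, 7, 9} 3 _ (by decide +kernel)
  have h₅ : (parabolic ∅).relIndex (parabolic {5}) = 2 :=
    relIndex_parabolic _ {5} {5, 7} 5 _ (by decide +kernel)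
  have h : (parabolic ∅).relIndex (parabolic Finset.univ) = 51840 := by
    rw [← Subgroup.relIndex_mul_relIndex _ _ _ (parabolic_mono (J := {1, 2, 3, 4, 5}) (by decide))
        (parabolic_mono (by decide)), h₁,
      ← Subgroup.relIndex_mul_relIndex _ _ _ (parabolic_mono (J := {1, 3, 4, 5}) (by decide))
        (parabolic_mono (by decide)), h₂,
      ← Subgroup.relIndex_mul_relIndex _ _ _ (parabolic_mono (J := {1, 4, 5}) (by decide))
        (parabolic_mono (by decide)), h₃,
      ← Subgroup.relIndex_mul_relIndex _ _ _ (parabolic_mono (J := {5}) (by decide))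
        (parabolic_mono (by decide)), h₄, h₅]
  rwa [parabolic_empty, parabolic_univ, Subgroup.relIndex_bot_left, Subgroup.card_top] at h

theorem card_sylow_three (P : Sylow 3 E₆.Group) : Nat.card P = 3 ^ 4 := by
  have : Finite E₆.Group := Nat.finite_of_card_ne_zero (by rw [card_group]; decide)
  have hfac : (51840 : ℕ).factorization 3 = 4 := by
    rw [Nat.factorization_def _ Nat.prime_three, show 51840 = 3 ^ 4 * 640 by norm_num,
      padicValNat.mul (by norm_num) (by norm_num), padicValNat.prime_pow,
      padicValNat.eq_zero_of_not_dvd (by norm_num)]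
  rw [P.card_eq_multiplicity, card_group, hfac]

end CoxeterMatrix.E₆

/-- In a Sylow 3-subgroup `P` of the Weyl group `W(E₆)` (realized as the Coxeter group of
type `E₆`), the centralizer in `P` of any non-central element `γ` of `P` is abelian; in
particular any subgroup of `P` all of whose elements commute with `γ` is abelian. -/
theorem sylow_three_E6_centralizer_of_noncentral_is_abelian
    (P : Sylow 3 CoxeterMatrix.E₆.Group) (γ : CoxeterMatrix.E₆.Group) (hγP : γ ∈ P)
    (hγ : (⟨γ, hγP⟩ : (P : Subgroup CoxeterMatrix.E₆.Group)) ∉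
      Subgroup.center (P : Subgroup CoxeterMatrix.E₆.Group)) :
    ∀ a b : CoxeterMatrix.E₆.Group, a ∈ P → b ∈ P →
      Commute a γ → Commute b γ → Commute a b := by
  intro a b ha hb haγ hbγ
  have h := Commute.of_commute_of_card_eq_prime_pow_four (CoxeterMatrix.E₆.card_sylow_three P) hγ
    (a := ⟨a, ha⟩) (b := ⟨b, hb⟩) (Subtype.ext haγ) (Subtype.ext hbγ)
  exact congrArg Subtype.val h
end

section
/- Let W be the Coxeter group of type E₆ (the group presented by the Coxeter matrix E₆; it is isomorphic to the Weyl group W(E₆), a finite group of order 51840). Then the center of every Sylow 3-subgroup of W is a group of order exactly 3. -/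
section MinusculeOrbit

variable {B W X : Type*} [LinearOrder X]

/-- A finite set `O` of points, with smallest point `o`, on which the simple reflections in `J` act
through `r` in the way they act on the weights of a minuscule representation: every point
of `O` other than `o` is lowered by some reflection in `J`, and two reflections, one of which lowers
a point that the other does not raise, generate an orbit of one of the shapes that occur
for minuscule weights. -/
structure IsMinusculeOrbit (M : CoxeterMatrix B) (r : B → X → X) (J : Finset B) (O : Finset X)
    (o : X) : Prop where
  base_mem : o ∈ O
  base_le : ∀ i ∈ J, o ≤ r i o
  apply_mem : ∀ i ∈ J, ∀ y ∈ O, r i y ∈ O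
  exists_lt : ∀ y ∈ O, y ≠ o → ∃ q ∈ J, r q y < y
  rank_two : ∀ y ∈ O, ∀ q ∈ J, r q y < y → ∀ i ∈ J, i ≠ q → r i y ≤ y →
    (M i q = 2 ∧ r i (r q y) ≤ r q y ∧ (r i y = y ∨ r i y < y ∧ r q (r i y) ≤ r i y)) ∨
    (M i q = 3 ∧ r i y = y ∧ r i (r q y) < r q y ∧ r q (r i (r q y)) = r i (r q y))

namespace IsMinusculeOrbit

variable [WellFoundedLT X] [Group W] {M : CoxeterMatrix B} {r : B → X → X}
  {J : Finset B} {O : Finset X} {o : X}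

theorem exists_transversal (h : IsMinusculeOrbit M r J O o) (s : B → W) :
    ∃ c : X → W, c o = 1 ∧ ∀ y ∈ O, y ≠ o → ∃ q ∈ J, r q y < y ∧ c y = s q * c (r q y) := by
  classical
  let F : (y : X) → ((z : X) → z < y → W) → W := fun y ih =>
    if hy : y ∈ O ∧ y ≠ o then
      s (h.exists_lt y hy.1 hy.2).choose * ih _ (h.exists_lt y hy.1 hy.2).choose_spec.2
    else 1
  refine ⟨wellFounded_lt.fix F, ?_, fun y hy hyo => ?_⟩
  · rw [WellFounded.fix_eq]
    simp [F]
  · refine ⟨_, (h.exists_lt y hy hyo).choose_spec.1, (h.exists_lt y hy hyo).choose_spec.2, ?_⟩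
    rw [WellFounded.fix_eq]
    simp only [F]
    rw [dif_pos ⟨hy, hyo⟩]

variable [MulAction W X]

theorem simple_mul_transversal_of_le (h : IsMinusculeOrbit M r J O o) (cs : CoxeterSystem M W)
    (hr : ∀ i x, cs.simple i • x = r i x) {H : Subgroup W}
    (hH : ∀ i ∈ J, r i o = o → cs.simple i ∈ H) {c : X → W} (hc₁ : c o = 1)
    (hc : ∀ y ∈ O, y ≠ o → ∃ q ∈ J, r q y < y ∧ c y = cs.simple q * c (r q y)) :
    ∀ y ∈ O, ∀ i ∈ J, r i y ≤ y →
      cs.simple i • (c y : W ⧸ H) = (c (r i y) : W ⧸ H) := by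
  have hrr : ∀ i x, r i (r i x) = x := fun i x => by simp [← hr, ← mul_smul]
  have hss : ∀ i (x : W ⧸ H), cs.simple i • cs.simple i • x = x := fun i x => by
    simp [← mul_smul]
  intro y
  induction y using WellFoundedLT.induction with
  | _ y ih =>
  intro hy i hi hle
  by_cases hyo : y = o
  · subst hyo
    have hfix : r i y = y := le_antisymm hle (h.base_le i hi)
    rw [hfix, hc₁, MulAction.Quotient.smul_coe, smul_eq_mul, mul_one, QuotientGroup.eq]
    simpa using hH i hi hfix
  obtain ⟨q, hq, hlt, hcy⟩ := hc y hy hyo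
  have hcy' : (c y : W ⧸ H) = cs.simple q • (c (r q y) : W ⧸ H) := by
    rw [hcy, MulAction.Quotient.smul_coe, smul_eq_mul]
  have hm := h.apply_mem q hq y hy
  by_cases hiq : i = q
  · subst hiq
    rw [hcy', hss]
  rcases h.rank_two y hy q hq hlt i hi hiq hle with ⟨hM, h₁, h₂⟩ | ⟨hM, hfix, h₁, h₂⟩
  · have hcomm : cs.simple i * cs.simple q = cs.simple q * cs.simple i := by
      have := cs.simple_mul_simple_pow i q
      rw [hM, pow_two, mul_eq_one_iff_eq_inv] at this
      simpa using this
    have hrcomm : r i (r q y) = r q (r i y) := by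
      simp only [← hr, ← mul_smul, hcomm]
    rw [hcy', ← mul_smul, hcomm, mul_smul, ih _ hlt hm i hi h₁, hrcomm]
    rcases h₂ with h₂ | ⟨h₂, h₃⟩
    · rw [h₂, hcy']
    · rw [← ih _ h₂ (h.apply_mem i hi y hy) q hq h₃, hss]
  · have hbraid : cs.simple i * cs.simple q * cs.simple i =
        cs.simple q * cs.simple i * cs.simple q := by
      have : cs.simple i * cs.simple q * cs.simple i *
          (cs.simple q * cs.simple i * cs.simple q) = 1 := by
        have := cs.simple_mul_simple_pow i q
        rw [hM] at this
        simpa only [pow_succ, pow_zero, one_mul, mul_assoc] using this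
      simpa [mul_assoc] using eq_inv_of_mul_eq_one_left this
    have hl := ih _ hlt hm i hi h₁.le
    have hlq := ih _ (h₁.trans hlt) (h.apply_mem i hi _ hm) q hq h₂.le
    rw [h₂] at hlq
    have hm' : (c (r q y) : W ⧸ H) = cs.simple i • (c (r i (r q y)) : W ⧸ H) := by
      rw [← hl, hss]
    rw [hfix, hcy', hm', ← mul_smul, ← mul_smul, hbraid, mul_smul, mul_smul, hlq]

theorem simple_mul_transversal (h : IsMinusculeOrbit M r J O o) (cs : CoxeterSystem M W)
    (hr : ∀ i x, cs.simple i • x = r i x) {H : Subgroup W}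
    (hH : ∀ i ∈ J, r i o = o → cs.simple i ∈ H) {c : X → W} (hc₁ : c o = 1)
    (hc : ∀ y ∈ O, y ≠ o → ∃ q ∈ J, r q y < y ∧ c y = cs.simple q * c (r q y))
    {y : X} (hy : y ∈ O) {i : B} (hi : i ∈ J) :
    cs.simple i • (c y : W ⧸ H) = (c (r i y) : W ⧸ H) := by
  have hle := h.simple_mul_transversal_of_le cs hr hH hc₁ hc
  rcases le_total (r i y) y with h' | h'
  · exact hle y hy i hi h'
  · have hrr : r i (r i y) = y := by simp [← hr, ← mul_smul]
    have := hle _ (h.apply_mem i hi y hy) i hi (by rwa [hrr])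
    rw [hrr] at this
    rw [← this]
    simp

theorem mul_transversal (h : IsMinusculeOrbit M r J O o) (cs : CoxeterSystem M W)
    (hr : ∀ i x, cs.simple i • x = r i x) {H : Subgroup W}
    (hH : ∀ i ∈ J, r i o = o → cs.simple i ∈ H) {c : X → W} (hc₁ : c o = 1)
    (hc : ∀ y ∈ O, y ≠ o → ∃ q ∈ J, r q y < y ∧ c y = cs.simple q * c (r q y))
    {g : W} (hg : g ∈ Subgroup.closure (cs.simple '' J)) :
    ∀ y ∈ O, g • y ∈ O ∧ g • (c y : W ⧸ H) = (c (g • y) : W ⧸ H) := by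
  have key : ∀ i ∈ J, ∀ g : W,
      (∀ y ∈ O, g • y ∈ O ∧ g • (c y : W ⧸ H) = (c (g • y) : W ⧸ H)) →
      ∀ y ∈ O, (cs.simple i * g) • y ∈ O ∧
        (cs.simple i * g) • (c y : W ⧸ H) = (c ((cs.simple i * g) • y) : W ⧸ H) := by
    intro i hi g ih y hy
    obtain ⟨h₁, h₂⟩ := ih y hy
    rw [mul_smul, mul_smul, h₂, hr, h.simple_mul_transversal cs hr hH hc₁ hc h₁ hi]
    exact ⟨h.apply_mem i hi _ h₁, rfl⟩
  induction hg using Subgroup.closure_induction_left with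
  | one => simp
  | mul_left x hx g _ ih =>
    obtain ⟨i, hi, rfl⟩ := hx
    exact key i hi g ih
  | inv_mul_cancel x hx g _ ih =>
    obtain ⟨i, hi, rfl⟩ := hx
    rw [cs.inv_simple]
    exact key i hi g ih

theorem transversal_spec (h : IsMinusculeOrbit M r J O o) (cs : CoxeterSystem M W)
    (hr : ∀ i x, cs.simple i • x = r i x) {c : X → W} (hc₁ : c o = 1)
    (hc : ∀ y ∈ O, y ≠ o → ∃ q ∈ J, r q y < y ∧ c y = cs.simple q * c (r q y)) :
    ∀ y ∈ O, c y ∈ Subgroup.closure (cs.simple '' J) ∧ c y • o = y := by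
  intro y
  induction y using WellFoundedLT.induction with
  | _ y ih =>
  intro hy
  by_cases hyo : y = o
  · subst hyo
    simp [hc₁, one_mem]
  obtain ⟨q, hq, hlt, hcy⟩ := hc y hy hyo
  obtain ⟨h₁, h₂⟩ := ih _ hlt (h.apply_mem q hq y hy)
  rw [hcy]
  refine ⟨mul_mem (Subgroup.subset_closure ⟨q, hq, rfl⟩) h₁, ?_⟩
  rw [mul_smul, h₂, ← hr, ← mul_smul]
  simp

theorem mem_closure_of_smul_eq (h : IsMinusculeOrbit M r J O o) (cs : CoxeterSystem M W)
    (hr : ∀ i x, cs.simple i • x = r i x) {J' : Finset B} (hJ' : ∀ i ∈ J, r i o = o → i ∈ J')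
    {g : W} (hg : g ∈ Subgroup.closure (cs.simple '' J)) (hgo : g • o = o) :
    g ∈ Subgroup.closure (cs.simple '' J') := by
  obtain ⟨c, hc₁, hc⟩ := h.exists_transversal cs.simple
  have := (h.mul_transversal cs hr (H := Subgroup.closure (cs.simple '' J'))
    (fun i hi hio => Subgroup.subset_closure ⟨i, hJ' i hi hio, rfl⟩) hc₁ hc hg o h.base_mem).2
  rw [hgo, hc₁, MulAction.Quotient.smul_coe, smul_eq_mul, mul_one, eq_comm,
    QuotientGroup.eq] at this
  simpa using this

theorem card_closure (h : IsMinusculeOrbit M r J O o) (cs : CoxeterSystem M W)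
    (hr : ∀ i x, cs.simple i • x = r i x) {J' : Finset B}
    (hJ' : ∀ i, i ∈ J' ↔ i ∈ J ∧ r i o = o) :
    Nat.card (Subgroup.closure (cs.simple '' J)) =
      O.card * Nat.card (Subgroup.closure (cs.simple '' J')) := by
  obtain ⟨c, hc₁, hc⟩ := h.exists_transversal cs.simple
  have hspec := h.transversal_spec cs hr hc₁ hc
  have hfix : ∀ g ∈ Subgroup.closure (cs.simple '' J'), g • o = o := by
    have : Subgroup.closure (cs.simple '' J') ≤ MulAction.stabilizer W o := by
      rw [Subgroup.closure_le]
      rintro _ ⟨i, hi, rfl⟩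
      exact (hr i o).trans ((hJ' i).1 hi).2
    exact this
  have hmono : Subgroup.closure (cs.simple '' J') ≤ Subgroup.closure (cs.simple '' J) :=
    Subgroup.closure_mono (Set.image_mono fun i hi => ((hJ' i).1 hi).1)
  let f : O × Subgroup.closure (cs.simple '' (J' : Set B)) →
      Subgroup.closure (cs.simple '' (J : Set B)) :=
    fun p => ⟨c p.1 * p.2, mul_mem (hspec p.1 p.1.2).1 (hmono p.2.2)⟩
  have hf : Function.Bijective f := by
    constructor
    · rintro ⟨⟨y, hy⟩, ⟨g, hg⟩⟩ ⟨⟨y', hy'⟩, ⟨g', hg'⟩⟩ heq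
      have heq : c y * g = c y' * g' := congrArg Subtype.val heq
      have hyy : y = y' := by
        have := congrArg (· • o) heq
        simpa [mul_smul, hfix g hg, hfix g' hg', (hspec y hy).2, (hspec y' hy').2] using this
      subst hyy
      obtain rfl := mul_left_cancel heq
      rfl
    · rintro ⟨g, hg⟩
      have hgo := (h.mul_transversal cs hr (H := Subgroup.closure (cs.simple '' J'))
        (fun i hi hio => Subgroup.subset_closure ⟨i, (hJ' i).2 ⟨hi, hio⟩, rfl⟩)
        hc₁ hc hg o h.base_mem)
      refine ⟨⟨⟨g • o, hgo.1⟩, ⟨(c (g • o))⁻¹ * g, ?_⟩⟩, ?_⟩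
      · have := hgo.2
        rwa [hc₁, MulAction.Quotient.smul_coe, smul_eq_mul, mul_one, eq_comm,
          QuotientGroup.eq] at this
      · simp [f]
  rw [← Nat.card_congr (Equiv.ofBijective f hf), Nat.card_prod]
  simp

end IsMinusculeOrbit

end MinusculeOrbit

/-- The permutations of the 27 weights of a minuscule representation of type `E₆` induced by the
simple reflections; the weights are listed by increasing depth below the highest weight. -/
def e6Reflection : Fin 6 → Fin 27 → Fin 27 :=
  ![![0, 1, 2, 3, 4, 7, 8, 5, 6, 10, 9, 13, 12, 11,
      16, 15, 14, 17, 18, 19, 20, 21, 22, 23, 24, 26, 25],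
    ![0, 1, 2, 4, 3, 6, 5, 8, 7, 9, 10, 11, 12, 13,
      14, 15, 16, 19, 18, 17, 21, 20, 23, 22, 24, 25, 26],
    ![0, 1, 2, 5, 6, 3, 4, 7, 8, 9, 12, 11, 10, 15,
      14, 13, 18, 17, 16, 19, 20, 21, 22, 23, 25, 24, 26],
    ![0, 1, 3, 2, 4, 5, 9, 7, 10, 6, 8, 11, 12, 13,
      14, 17, 16, 15, 20, 19, 18, 21, 22, 24, 23, 25, 26],
    ![0, 2, 1, 3, 4, 5, 6, 7, 8, 11, 13, 9, 15, 10,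
      14, 12, 16, 17, 18, 19, 22, 23, 20, 21, 24, 25, 26],
    ![1, 0, 2, 3, 4, 5, 6, 7, 8, 9, 10, 14, 12, 16,
      11, 18, 13, 20, 15, 21, 17, 19, 22, 23, 24, 25, 26]]

theorem e6Reflection_involutive (i : Fin 6) : Function.Involutive (e6Reflection i) := by
  revert i
  unfold Function.Involutive
  decide +kernel

theorem isLiftable_e6Reflection :
    CoxeterMatrix.E₆.IsLiftable fun i => (e6Reflection_involutive i).toPerm := by
  intro i j
  ext x : 1
  revert i j x
  decide +kernel

/-- The action of the Coxeter group of type `E₆` on the 27 minuscule weights. -/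
noncomputable instance e6MulAction : MulAction CoxeterMatrix.E₆.Group (Fin 27) :=
  MulAction.compHom (Fin 27)
    (CoxeterMatrix.E₆.toCoxeterSystem.lift ⟨_, isLiftable_e6Reflection⟩)

theorem e6_simple_smul (i : Fin 6) (x : Fin 27) :
    CoxeterMatrix.E₆.toCoxeterSystem.simple i • x = e6Reflection i x := by
  change CoxeterMatrix.E₆.toCoxeterSystem.lift ⟨_, isLiftable_e6Reflection⟩ _ x = _
  rw [CoxeterSystem.lift_apply_simple]
  rfl

theorem isMinusculeOrbit_E₆ :
    IsMinusculeOrbit CoxeterMatrix.E₆ e6Reflection Finset.univ Finset.univ 0 := by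
  constructor <;> decide +kernel

theorem isMinusculeOrbit_D₅ :
    IsMinusculeOrbit CoxeterMatrix.E₆ e6Reflection {0, 1, 2, 3, 4}
      {14, 16, 18, 20, 21, 22, 23, 24, 25, 26} 14 := by
  constructor <;> decide +kernel

theorem isMinusculeOrbit_D₄ :
    IsMinusculeOrbit CoxeterMatrix.E₆ e6Reflection {1, 2, 3, 4} {1, 2, 3, 4, 5, 6, 9, 11} 1 := by
  constructor <;> decide +kernel

theorem isMinusculeOrbit_A₃ :
    IsMinusculeOrbit CoxeterMatrix.E₆ e6Reflection {1, 2, 3} {13, 15, 17, 19} 13 := by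
  constructor <;> decide +kernel

theorem isMinusculeOrbit_A₂ :
    IsMinusculeOrbit CoxeterMatrix.E₆ e6Reflection {1, 3} {15, 17, 19} 15 := by
  constructor <;> decide +kernel

theorem isMinusculeOrbit_A₁ :
    IsMinusculeOrbit CoxeterMatrix.E₆ e6Reflection {1} {3, 4} 3 := by
  constructor <;> decide +kernel

section WreathProduct

variable {G : Type*} [Group G] {a b c d : G}

/-- The normal form of an element of the group generated by three commuting elements `a`, `b`, `c`
of order three and an element `d` of order three which permutes them cyclically. -/
def wreathNormalForm (a b c d : G) (i j k l : ZMod 3) : G :=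
  a ^ i.val * b ^ j.val * c ^ k.val * d ^ l.val

theorem pow_val_add_one_of_pow_three_eq_one {g : G} (hg : g ^ 3 = 1) (i : ZMod 3) :
    g ^ (i + 1).val = g * g ^ i.val := by
  rw [ZMod.val_add, ← pow_eq_pow_mod _ hg, pow_add, ← pow_mul_comm]
  simp [ZMod.val_one]

/-- The relations of the wreath product of two cyclic groups of order three. -/
structure IsWreathGenerating (a b c d : G) : Prop where
  pow_three : a ^ 3 = 1
  pow_three' : d ^ 3 = 1
  comm : Commute a b
  conj_a : d * a = b * d
  conj_b : d * b = c * d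
  conj_c : d * c = a * d

namespace IsWreathGenerating

theorem rotate (h : IsWreathGenerating a b c d) : IsWreathGenerating b c a d := by
  have hb : b = d * a * d⁻¹ := by rw [h.conj_a, mul_inv_cancel_right]
  have hc : c = d * b * d⁻¹ := by rw [h.conj_b, mul_inv_cancel_right]
  refine ⟨?_, h.pow_three', ?_, h.conj_b, h.conj_c, h.conj_a⟩
  · rw [hb, conj_pow, h.pow_three, mul_one, mul_inv_cancel]
  · rw [hc]
    nth_rw 1 [hb]
    exact (Commute.conj_iff d).2 h.comm

theorem mul_a_left (h : IsWreathGenerating a b c d) (i j k l : ZMod 3) :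
    a * wreathNormalForm a b c d i j k l = wreathNormalForm a b c d (i + 1) j k l := by
  simp only [wreathNormalForm, pow_val_add_one_of_pow_three_eq_one h.pow_three, mul_assoc]

theorem mul_d_right (h : IsWreathGenerating a b c d) (i j k l : ZMod 3) :
    wreathNormalForm a b c d i j k l * d = wreathNormalForm a b c d i j k (l + 1) := by
  simp only [wreathNormalForm, pow_val_add_one_of_pow_three_eq_one h.pow_three', mul_assoc,
    pow_mul_comm']

theorem mul_d_left (h : IsWreathGenerating a b c d) (i j k l : ZMod 3) :
    d * wreathNormalForm a b c d i j k l = wreathNormalForm a b c d k i j (l + 1) := by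
  have ha : d * a ^ i.val = b ^ i.val * d := SemiconjBy.pow_right h.conj_a _
  have hb : d * b ^ j.val = c ^ j.val * d := SemiconjBy.pow_right h.conj_b _
  have hc : d * c ^ k.val = a ^ k.val * d := SemiconjBy.pow_right h.conj_c _
  have h₁ : Commute (a ^ k.val) (b ^ i.val) := h.comm.pow_pow _ _
  have h₂ : Commute (a ^ k.val) (c ^ j.val) := (h.rotate.rotate.comm.pow_pow _ _).symm
  calc d * wreathNormalForm a b c d i j k l
      = d * a ^ i.val * b ^ j.val * c ^ k.val * d ^ l.val := by
        simp only [wreathNormalForm, mul_assoc]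
    _ = b ^ i.val * (d * b ^ j.val) * c ^ k.val * d ^ l.val := by simp only [ha, mul_assoc]
    _ = b ^ i.val * c ^ j.val * (d * c ^ k.val) * d ^ l.val := by simp only [hb, mul_assoc]
    _ = b ^ i.val * c ^ j.val * a ^ k.val * (d * d ^ l.val) := by simp only [hc, mul_assoc]
    _ = wreathNormalForm a b c d k i j (l + 1) := by
        rw [wreathNormalForm, pow_val_add_one_of_pow_three_eq_one h.pow_three',
          (h₁.mul_right h₂).symm.eq]
        simp only [mul_assoc]

theorem mul_a_right (h : IsWreathGenerating a b c d) (i j k l : ZMod 3) :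
    wreathNormalForm a b c d i j k l * a =
      wreathNormalForm a b c d (i + if l = 0 then 1 else 0) (j + if l = 1 then 1 else 0)
        (k + if l = 2 then 1 else 0) l := by
  have hd : d ^ (2 : ZMod 3).val = d * d := pow_two d
  have hab : Commute (b ^ j.val) a := (h.comm.pow_right _).symm
  have hac : Commute (c ^ k.val) a := h.rotate.rotate.comm.pow_left _
  have hbc : Commute (c ^ k.val) b := (h.rotate.comm.pow_right _).symm
  obtain rfl | rfl | rfl : l = 0 ∨ l = 1 ∨ l = 2 := by revert l; decide
  · simp only [wreathNormalForm, ZMod.val_zero, pow_zero, mul_one, if_true,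
      pow_val_add_one_of_pow_three_eq_one h.pow_three]
    have h01 : (0 : ZMod 3) ≠ 1 := by decide
    have h02 : (0 : ZMod 3) ≠ 2 := by decide
    simp only [h01, h02, if_false, add_zero]
    rw [mul_assoc _ _ a, hac.eq, ← mul_assoc, mul_assoc _ _ a, hab.eq, ← mul_assoc, pow_mul_comm']
  · have h01 : (1 : ZMod 3) ≠ 0 := by decide
    have h02 : (1 : ZMod 3) ≠ 2 := by decide
    simp only [wreathNormalForm, h01, h02, if_false, if_true, add_zero,
      pow_val_add_one_of_pow_three_eq_one h.rotate.pow_three, ZMod.val_one, pow_one]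
    rw [mul_assoc _ _ a, h.conj_a, ← mul_assoc, mul_assoc _ _ b, hbc.eq, ← mul_assoc,
      mul_assoc _ _ b, pow_mul_comm']
  · have h01 : (2 : ZMod 3) ≠ 0 := by decide
    have h02 : (2 : ZMod 3) ≠ 1 := by decide
    simp only [wreathNormalForm, h01, h02, if_false, if_true, add_zero,
      pow_val_add_one_of_pow_three_eq_one h.rotate.rotate.pow_three, hd]
    rw [mul_assoc _ _ a, mul_assoc d d a, h.conj_a, ← mul_assoc d b d, h.conj_b, mul_assoc c d d,
      ← mul_assoc, mul_assoc _ _ c, pow_mul_comm']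

theorem exists_eq_wreathNormalForm (h : IsWreathGenerating a b c d) {g : G}
    (hg : g ∈ Subgroup.closure {a, d}) : ∃ i j k l, g = wreathNormalForm a b c d i j k l := by
  induction hg using Subgroup.closure_induction_right with
  | one => exact ⟨0, 0, 0, 0, by simp [wreathNormalForm]⟩
  | mul_right g _ x hx ih =>
    obtain ⟨i, j, k, l, rfl⟩ := ih
    rcases hx with rfl | rfl
    · exact ⟨_, _, _, _, h.mul_a_right i j k l⟩
    · exact ⟨_, _, _, _, h.mul_d_right i j k l⟩
  | mul_inv_cancel g _ x hx ih =>
    have hx' : x⁻¹ = x * x := by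
      rw [inv_eq_iff_mul_eq_one, ← pow_two, ← pow_succ']
      rcases hx with rfl | rfl
      exacts [h.pow_three, h.pow_three']
    obtain ⟨i, j, k, l, rfl⟩ := ih
    rw [hx', ← mul_assoc]
    rcases hx with rfl | rfl
    · rw [h.mul_a_right, h.mul_a_right]
      exact ⟨_, _, _, _, rfl⟩
    · rw [h.mul_d_right, h.mul_d_right]
      exact ⟨_, _, _, _, rfl⟩

theorem wreathNormalForm_mem_closure (h : IsWreathGenerating a b c d) (i j k l : ZMod 3) :
    wreathNormalForm a b c d i j k l ∈ Subgroup.closure {a, d} := by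
  have ha : a ∈ Subgroup.closure {a, d} := Subgroup.subset_closure (by simp)
  have hd : d ∈ Subgroup.closure {a, d} := Subgroup.subset_closure (by simp)
  have hb : b ∈ Subgroup.closure {a, d} := by
    rw [eq_mul_inv_of_mul_eq h.conj_a.symm]
    exact mul_mem (mul_mem hd ha) (inv_mem hd)
  have hc : c ∈ Subgroup.closure {a, d} := by
    rw [eq_mul_inv_of_mul_eq h.conj_b.symm]
    exact mul_mem (mul_mem hd hb) (inv_mem hd)
  exact mul_mem (mul_mem (mul_mem (pow_mem ha _) (pow_mem hb _)) (pow_mem hc _)) (pow_mem hd _)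

theorem card_closure (h : IsWreathGenerating a b c d)
    (hinj : ∀ {i j k l i' j' k' l' : ZMod 3},
      wreathNormalForm a b c d i j k l = wreathNormalForm a b c d i' j' k' l' →
      i = i' ∧ j = j' ∧ k = k' ∧ l = l') :
    Nat.card (Subgroup.closure {a, d}) = 81 := by
  let f : ZMod 3 × ZMod 3 × ZMod 3 × ZMod 3 → Subgroup.closure {a, d} :=
    fun x => ⟨wreathNormalForm a b c d x.1 x.2.1 x.2.2.1 x.2.2.2,
      h.wreathNormalForm_mem_closure _ _ _ _⟩
  have hf : Function.Bijective f := by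
    refine ⟨fun x y hxy => by simpa [Prod.ext_iff] using hinj (Subtype.ext_iff.1 hxy),
      fun ⟨g, hg⟩ => ?_⟩
    obtain ⟨i, j, k, l, rfl⟩ := h.exists_eq_wreathNormalForm hg
    exact ⟨(i, j, k, l), rfl⟩
  rw [← Nat.card_eq_of_bijective f hf]
  simp

theorem card_center_closure (h : IsWreathGenerating a b c d)
    (hinj : ∀ {i j k l i' j' k' l' : ZMod 3},
      wreathNormalForm a b c d i j k l = wreathNormalForm a b c d i' j' k' l' →
      i = i' ∧ j = j' ∧ k = k' ∧ l = l') :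
    Nat.card (Subgroup.center (Subgroup.closure {a, d})) = 3 := by
  have hcentral : ∀ (i : ZMod 3), ∀ g ∈ Subgroup.closure {a, d},
      g * wreathNormalForm a b c d i i i 0 = wreathNormalForm a b c d i i i 0 * g := by
    intro i
    have : Subgroup.closure {a, d} ≤
        Subgroup.centralizer {wreathNormalForm a b c d i i i 0} := by
      rw [Subgroup.closure_le]
      rintro x (rfl | rfl) <;> rw [SetLike.mem_coe, Subgroup.mem_centralizer_singleton_iff]
      · rw [h.mul_a_left, h.mul_a_right]
        have h01 : (0 : ZMod 3) ≠ 1 := by decide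
        have h02 : (0 : ZMod 3) ≠ 2 := by decide
        simp [h01, h02]
      · rw [h.mul_d_left, h.mul_d_right]
    intro g hg
    exact Subgroup.mem_centralizer_singleton_iff.1 (this hg)
  let f : ZMod 3 → Subgroup.center (Subgroup.closure {a, d}) := fun i =>
    ⟨⟨wreathNormalForm a b c d i i i 0, h.wreathNormalForm_mem_closure _ _ _ _⟩,
      Subgroup.mem_center_iff.2 fun g => Subtype.ext (hcentral i g g.2)⟩
  have hf : Function.Bijective f := by
    refine ⟨fun i j hij => ?_, fun ⟨⟨g, hg⟩, hgc⟩ => ?_⟩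
    · exact (hinj (Subtype.ext_iff.1 (Subtype.ext_iff.1 hij))).1
    · obtain ⟨i, j, k, l, rfl⟩ := h.exists_eq_wreathNormalForm hg
      rw [Subgroup.mem_center_iff] at hgc
      have ha := congrArg Subtype.val (hgc ⟨a, Subgroup.subset_closure (by simp)⟩)
      have hd := congrArg Subtype.val (hgc ⟨d, Subgroup.subset_closure (by simp)⟩)
      simp only [Subgroup.coe_mul, h.mul_a_left, h.mul_a_right] at ha
      simp only [Subgroup.coe_mul, h.mul_d_left, h.mul_d_right] at hd
      obtain ⟨rfl, rfl, -, -⟩ := hinj hd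
      have hl : l = 0 := by
        by_contra hl
        simpa [hl] using (hinj ha).1
      subst hl
      exact ⟨_, rfl⟩
  rw [← Nat.card_eq_of_bijective f hf]
  simp

end IsWreathGenerating

end WreathProduct

theorem e6_card : Nat.card CoxeterMatrix.E₆.Group = 51840 := by
  let cs := CoxeterMatrix.E₆.toCoxeterSystem
  have h₆ := isMinusculeOrbit_E₆.card_closure cs e6_simple_smul (J' := {0, 1, 2, 3, 4})
    (by decide +kernel)
  have h₅ := isMinusculeOrbit_D₅.card_closure cs e6_simple_smul (J' := {1, 2, 3, 4})
    (by decide +kernel)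
  have h₄ := isMinusculeOrbit_D₄.card_closure cs e6_simple_smul (J' := {1, 2, 3})
    (by decide +kernel)
  have h₃ := isMinusculeOrbit_A₃.card_closure cs e6_simple_smul (J' := {1, 3})
    (by decide +kernel)
  have h₂ := isMinusculeOrbit_A₂.card_closure cs e6_simple_smul (J' := {1})
    (by decide +kernel)
  have h₁ := isMinusculeOrbit_A₁.card_closure cs e6_simple_smul (J' := ∅)
    (by decide +kernel)
  rw [h₅, h₄, h₃, h₂, h₁, Finset.coe_univ, Set.image_univ, cs.subgroup_closure_range_simple,
    Finset.coe_empty, Set.image_empty, Subgroup.closure_empty, Subgroup.card_bot,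
    Subgroup.card_top] at h₆
  exact h₆

instance e6_faithfulSMul : FaithfulSMul CoxeterMatrix.E₆.Group (Fin 27) := by
  let cs := CoxeterMatrix.E₆.toCoxeterSystem
  have key : ∀ g : CoxeterMatrix.E₆.Group, (∀ x : Fin 27, g • x = x) → g = 1 := by
    intro g hg
    have h : g ∈ Subgroup.closure
        (cs.simple '' ((Finset.univ : Finset (Fin 6)) : Set (Fin 6))) := by
      rw [Finset.coe_univ, Set.image_univ, cs.subgroup_closure_range_simple]
      exact Subgroup.mem_top g
    replace h := isMinusculeOrbit_E₆.mem_closure_of_smul_eq cs e6_simple_smul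
      (J' := {0, 1, 2, 3, 4}) (by decide +kernel) h (hg _)
    replace h := isMinusculeOrbit_D₅.mem_closure_of_smul_eq cs e6_simple_smul
      (J' := {1, 2, 3, 4}) (by decide +kernel) h (hg _)
    replace h := isMinusculeOrbit_D₄.mem_closure_of_smul_eq cs e6_simple_smul
      (J' := {1, 2, 3}) (by decide +kernel) h (hg _)
    replace h := isMinusculeOrbit_A₃.mem_closure_of_smul_eq cs e6_simple_smul
      (J' := {1, 3}) (by decide +kernel) h (hg _)
    replace h := isMinusculeOrbit_A₂.mem_closure_of_smul_eq cs e6_simple_smul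
      (J' := {1}) (by decide +kernel) h (hg _)
    replace h := isMinusculeOrbit_A₁.mem_closure_of_smul_eq cs e6_simple_smul
      (J' := ∅) (by decide +kernel) h (hg _)
    simpa using h
  refine ⟨fun {g g'} h => ?_⟩
  rw [← inv_mul_eq_one]
  refine key _ fun x => ?_
  rw [mul_smul, ← h, inv_smul_smul]

/-- The element of the Coxeter group of type `E₆` given by a word in the simple reflections. -/
noncomputable abbrev e6Word (ω : List (Fin 6)) : CoxeterMatrix.E₆.Group :=
  CoxeterMatrix.E₆.toCoxeterSystem.wordProd ω

theorem e6Word_smul (ω : List (Fin 6)) (x : Fin 27) :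
    e6Word ω • x = ω.foldr e6Reflection x := by
  induction ω with
  | nil => simp
  | cons i ω ih =>
    rw [e6Word, CoxeterSystem.wordProd_cons, mul_smul, ih, e6_simple_smul, List.foldr_cons]

theorem e6Word_eq {ω ω' : List (Fin 6)}
    (h : ∀ x, ω.foldr e6Reflection x = ω'.foldr e6Reflection x) :
    e6Word ω = e6Word ω' :=
  eq_of_smul_eq_smul fun x : Fin 27 => by rw [e6Word_smul, e6Word_smul, h]

theorem e6_isWreathGenerating :
    IsWreathGenerating (e6Word [3, 1])
      (e6Word [4, 3, 0, 2, 1, 3, 4, 5, 4, 3, 2, 1, 3, 4])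
      (e6Word [5, 2, 3, 0, 2, 1, 3, 4, 3, 2, 1, 3, 0, 2])
      (e6Word [4, 5, 3, 4, 2, 3, 0, 2]) := by
  constructor
  · rw [pow_succ, pow_two, ← CoxeterSystem.wordProd_append, ← CoxeterSystem.wordProd_append,
      ← CoxeterSystem.wordProd_nil]
    exact e6Word_eq (by decide +kernel)
  · rw [pow_succ, pow_two, ← CoxeterSystem.wordProd_append, ← CoxeterSystem.wordProd_append,
      ← CoxeterSystem.wordProd_nil]
    exact e6Word_eq (by decide +kernel)
  all_goals
    try rw [commute_iff_eq]
    rw [← CoxeterSystem.wordProd_append, ← CoxeterSystem.wordProd_append]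
    exact e6Word_eq (by decide +kernel)

theorem e6_wreathNormalForm_injective {i j k l i' j' k' l' : ZMod 3}
    (h : wreathNormalForm (e6Word [3, 1])
      (e6Word [4, 3, 0, 2, 1, 3, 4, 5, 4, 3, 2, 1, 3, 4])
      (e6Word [5, 2, 3, 0, 2, 1, 3, 4, 3, 2, 1, 3, 0, 2])
      (e6Word [4, 5, 3, 4, 2, 3, 0, 2]) i j k l =
      wreathNormalForm (e6Word [3, 1])
      (e6Word [4, 3, 0, 2, 1, 3, 4, 5, 4, 3, 2, 1, 3, 4])
      (e6Word [5, 2, 3, 0, 2, 1, 3, 4, 3, 2, 1, 3, 0, 2])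
      (e6Word [4, 5, 3, 4, 2, 3, 0, 2]) i' j' k' l') :
    i = i' ∧ j = j' ∧ k = k' ∧ l = l' := by
  have h₀ := congrArg (· • (0 : Fin 27)) h
  have h₂ := congrArg (· • (2 : Fin 27)) h
  simp only [wreathNormalForm, mul_smul, ← smul_iterate_apply, funext (e6Word_smul _)]
    at h₀ h₂
  clear h
  revert i j k l i' j' k' l'
  decide +kernel

/-- The center of every Sylow 3-subgroup of the Weyl group `W(E₆)` (realized as the
Coxeter group of type `E₆`) has order exactly 3. -/
theorem sylow_three_E6_center_card_eq_three
    (P : Sylow 3 CoxeterMatrix.E₆.Group) :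
    Nat.card (Subgroup.center (P : Subgroup CoxeterMatrix.E₆.Group)) = 3 := by
  have : Finite CoxeterMatrix.E₆.Group := Nat.finite_of_card_ne_zero (by rw [e6_card]; decide)
  have hfac : (51840 : ℕ).factorization 3 = 4 := by
    rw [Nat.factorization_def _ Nat.prime_three]
    decide +kernel
  let Q : Sylow 3 CoxeterMatrix.E₆.Group := Sylow.ofCard _
    ((e6_isWreathGenerating.card_closure e6_wreathNormalForm_injective).trans
      (by rw [e6_card, hfac]; rfl))
  rw [Nat.card_congr (Subgroup.centerCongr (P.equiv Q)).toEquiv]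
  exact e6_isWreathGenerating.card_center_closure e6_wreathNormalForm_injective
end

section
/- Let W be the Coxeter group of type E₆ (the group presented by the Coxeter matrix E₆; it is isomorphic to the Weyl group W(E₆), a finite group of order 51840). Then every Sylow 3-subgroup P of W has order 81, and P contains a normal subgroup N of index 3 which is isomorphic to (ℤ/3ℤ)³, the elementary abelian group of order 27. -/
open Matrix (vecMulVec mulVec_mulVec one_mulVec sub_mulVec vecMulVec_mulVec)
open scoped Matrix

namespace CoxeterE6

/-- The Coxeter group of type `E₆`. -/
abbrev W : Type := CoxeterMatrix.E₆.Group

/-- The simple reflections of `W`. -/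
abbrev s (i : Fin 6) : W := CoxeterMatrix.E₆.simple i

theorem entry_cases (i j : Fin 6) :
    (i = j ∧ CoxeterMatrix.E₆ i j = 1) ∨
      (CartanMatrix.E₆ i j = 0 ∧ CoxeterMatrix.E₆ i j = 2) ∨
      (CartanMatrix.E₆ i j = -1 ∧ CoxeterMatrix.E₆ i j = 3) := by
  revert j; fin_cases i <;> decide +kernel

theorem cartan_comm (i j : Fin 6) : CartanMatrix.E₆ i j = CartanMatrix.E₆ j i :=
  CartanMatrix.E₆_isSymm.apply j i

theorem simple_mul_self (i : Fin 6) : s i * s i = 1 :=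
  CoxeterMatrix.E₆.toCoxeterSystem.simple_mul_simple_self i

theorem simple_comm {i j : Fin 6} (h : CartanMatrix.E₆ i j = 0) : s i * s j = s j * s i := by
  obtain ⟨rfl, -⟩ | ⟨-, hm⟩ | ⟨h', -⟩ := entry_cases i j
  · rfl
  · have := CoxeterMatrix.E₆.toCoxeterSystem.simple_mul_simple_pow i j
    rw [hm, pow_two] at this
    change s i * s j * (s i * s j) = 1 at this
    rw [eq_inv_of_mul_eq_one_left this, mul_inv_rev,
      inv_eq_of_mul_eq_one_left (simple_mul_self i), inv_eq_of_mul_eq_one_left (simple_mul_self j)]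
  · omega

theorem simple_braid {i j : Fin 6} (h : CartanMatrix.E₆ i j = -1) :
    s i * s j * s i = s j * s i * s j := by
  obtain ⟨rfl, -⟩ | ⟨h', -⟩ | ⟨-, hm⟩ := entry_cases i j
  · rfl
  · omega
  · have := CoxeterMatrix.E₆.toCoxeterSystem.simple_mul_simple_pow i j
    rw [hm] at this
    change (s i * s j) ^ 3 = 1 at this
    have hi := inv_eq_of_mul_eq_one_left (simple_mul_self i)
    have hj := inv_eq_of_mul_eq_one_left (simple_mul_self j)
    have h2 : (s i * s j * s i) * (s j * s i * s j) = 1 := by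
      rw [← this]; simp only [pow_succ, pow_zero, one_mul, mul_assoc]
    rw [eq_inv_of_mul_eq_one_left h2]
    simp only [mul_inv_rev, hi, hj, mul_assoc]

/-- The matrix of the `i`-th simple reflection in the basis of fundamental weights. -/
def reflection (i : Fin 6) : Matrix (Fin 6) (Fin 6) ℤ :=
  1 - vecMulVec (CartanMatrix.E₆ i) (Pi.single i 1)

/-- The action of the `i`-th simple reflection on coordinates in the basis of fundamental
weights. -/
def reflect (i : Fin 6) (v : Fin 6 → ℤ) : Fin 6 → ℤ :=
  fun j ↦ v j - v i * CartanMatrix.E₆ i j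

theorem reflection_mulVec (i : Fin 6) (v : Fin 6 → ℤ) : reflection i *ᵥ v = reflect i v := by
  ext j
  simp [reflection, reflect, sub_mulVec, vecMulVec_mulVec, mul_comm]

theorem reflection_mul_self (i : Fin 6) : reflection i * reflection i = 1 := by
  revert i; decide +kernel

theorem reflection_comm (i j : Fin 6) (h : CartanMatrix.E₆ i j = 0) :
    reflection i * reflection j = reflection j * reflection i := by
  revert j; fin_cases i <;> decide +kernel

theorem reflection_braid (i j : Fin 6) (h : CartanMatrix.E₆ i j = -1) :
    reflection i * reflection j * reflection i = reflection j * reflection i * reflection j := by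
  revert j; fin_cases i <;> decide +kernel

theorem reflection_isLiftable : CoxeterMatrix.E₆.IsLiftable reflection := by
  intro i j
  obtain ⟨rfl, hm⟩ | ⟨h, hm⟩ | ⟨h, hm⟩ := entry_cases i j
  · rw [reflection_mul_self, one_pow]
  · rw [hm, pow_two]
    nth_rw 2 [reflection_comm i j h]
    rw [mul_assoc, ← mul_assoc (reflection j), reflection_mul_self, one_mul, reflection_mul_self]
  · rw [hm]
    calc (reflection i * reflection j) ^ 3
        = (reflection i * reflection j * reflection i) *
            (reflection j * reflection i * reflection j) := by
          simp only [pow_succ, pow_zero, one_mul, mul_assoc]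
      _ = reflection i * (reflection j * (reflection i * reflection i) * reflection j) *
            reflection i := by
          rw [← reflection_braid i j h]; simp only [mul_assoc]
      _ = 1 := by simp only [reflection_mul_self, mul_one]

/-- The action of `W` on the weight lattice, in the basis of fundamental weights. -/
def weightRep : W →* Matrix (Fin 6) (Fin 6) ℤ :=
  CoxeterMatrix.E₆.toCoxeterSystem.lift ⟨reflection, reflection_isLiftable⟩

theorem weightRep_simple (i : Fin 6) : weightRep (s i) = reflection i :=
  CoxeterMatrix.E₆.toCoxeterSystem.lift_apply_simple reflection_isLiftable i

instance : MulAction W (Fin 6 → ℤ) where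
  smul g v := weightRep g *ᵥ v
  one_smul v := by change weightRep 1 *ᵥ v = v; rw [map_one, one_mulVec]
  mul_smul g h v := by
    change weightRep (g * h) *ᵥ v = weightRep g *ᵥ (weightRep h *ᵥ v)
    rw [map_mul, mulVec_mulVec]

theorem smul_def (g : W) (v : Fin 6 → ℤ) : g • v = weightRep g *ᵥ v := rfl

theorem simple_smul (i : Fin 6) (v : Fin 6 → ℤ) : s i • v = reflect i v := by
  rw [smul_def, weightRep_simple, reflection_mulVec]

theorem reflect_reflect (i : Fin 6) (v : Fin 6 → ℤ) : reflect i (reflect i v) = v := by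
  rw [← simple_smul, ← simple_smul, smul_smul, simple_mul_self, one_smul]

theorem reflect_apply_self (i : Fin 6) (v : Fin 6 → ℤ) : reflect i v i = -v i := by
  simp only [reflect, CartanMatrix.E₆_diag]; ring

theorem reflect_eq_self {i : Fin 6} {v : Fin 6 → ℤ} (h : v i = 0) : reflect i v = v := by
  ext j
  simp [reflect, h]

/-- The parabolic subgroup of `W` generated by the simple reflections in `J`. -/
def parabolic (J : Finset (Fin 6)) : Subgroup W := Subgroup.closure (s '' J)

theorem simple_mem_parabolic {J : Finset (Fin 6)} {i : Fin 6} (h : i ∈ J) : s i ∈ parabolic J :=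
  Subgroup.subset_closure ⟨i, h, rfl⟩

theorem parabolic_mono {J J' : Finset (Fin 6)} (h : J ⊆ J') : parabolic J ≤ parabolic J' :=
  Subgroup.closure_mono (Set.image_mono (by exact_mod_cast h))

/-- The pairing of a weight with the sum of the fundamental coweights. -/
def height (v : Fin 6 → ℤ) : ℤ := 8 * v 0 + 11 * v 1 + 15 * v 2 + 21 * v 3 + 15 * v 4 + 8 * v 5

theorem height_reflect (i : Fin 6) (v : Fin 6 → ℤ) : height (reflect i v) = height v - v i := by
  fin_cases i <;> simp [height, reflect, CartanMatrix.E₆] <;> ring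

/-- `O` is stable under the reflections in `J`, all its coordinates in `J` lie in `{-1, 0, 1}`,
and `ω` is its only `J`-dominant element. -/
structure IsMinuscule (J : Finset (Fin 6)) (ω : Fin 6 → ℤ) (O : Finset (Fin 6 → ℤ)) : Prop where
  mem : ω ∈ O
  dominant : ∀ i ∈ J, 0 ≤ ω i
  reflect_mem : ∀ v ∈ O, ∀ i ∈ J, reflect i v ∈ O
  bounded : ∀ v ∈ O, ∀ i ∈ J, -1 ≤ v i ∧ v i ≤ 1
  eq_or_exists : ∀ v ∈ O, v = ω ∨ ∃ i ∈ J, v i = -1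

/-- Induction from higher to lower weights in `O`. -/
theorem IsMinuscule.height_induction {J : Finset (Fin 6)} {ω : Fin 6 → ℤ}
    {O : Finset (Fin 6 → ℤ)} (hO : IsMinuscule J ω O) {P : ∀ v ∈ O, Prop}
    (step : ∀ v hv, (∀ u (hu : u ∈ O), height v < height u → P u hu) → P v hv) (v : Fin 6 → ℤ)
    (hv : v ∈ O) : P v hv := by
  have hle (u) (hu : u ∈ O) : height u ≤ O.sup' ⟨ω, hO.mem⟩ height := O.le_sup' height hu
  generalize O.sup' ⟨ω, hO.mem⟩ height = N at hle
  induction h : (N - height v).toNat using Nat.strong_induction_on generalizing v with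
  | _ n ih =>
    refine step v hv fun u hu huv ↦ ih _ ?_ u hu rfl
    have := hle u hu
    omega

/-- The cosets of `K` obtained from the trivial one by applying simple reflections in `J` that
lower a weight, starting at `ω`, together with the weight reached. -/
inductive Reach (J : Finset (Fin 6)) (ω : Fin 6 → ℤ) (K : Subgroup W) :
    (Fin 6 → ℤ) → W ⧸ K → Prop
  | base : Reach J ω K ω (1 : W)
  | step {i : Fin 6} {v : Fin 6 → ℤ} {p : W ⧸ K} (hi : i ∈ J) (hv : v i = -1)
      (h : Reach J ω K (reflect i v) p) : Reach J ω K v (s i • p)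

namespace Reach

variable {J : Finset (Fin 6)} {ω v : Fin 6 → ℤ} {O : Finset (Fin 6 → ℤ)} {K : Subgroup W}
  {p q : W ⧸ K}

theorem mem (hO : IsMinuscule J ω O) (h : Reach J ω K v p) : v ∈ O := by
  induction h with
  | base => exact hO.mem
  | step hi hv _ ih => simpa only [reflect_reflect] using hO.reflect_mem _ ih _ hi

theorem lower {i : Fin 6} (hi : i ∈ J) (hv : v i = 1) (h : Reach J ω K v p) :
    Reach J ω K (reflect i v) (s i • p) :=
  step hi (by rw [reflect_apply_self, hv]) (by rwa [reflect_reflect])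

theorem exists_smul (h : Reach J ω K v p) : ∃ g ∈ parabolic J, g • ω = v := by
  induction h with
  | base => exact ⟨1, one_mem _, one_smul _ _⟩
  | @step i v p hi hv _ ih =>
    obtain ⟨g, hg, hgv⟩ := ih
    refine ⟨s i * g, mul_mem (simple_mem_parabolic hi) hg, ?_⟩
    rw [mul_smul, hgv, simple_smul, reflect_reflect]

theorem exists_of_mem (hO : IsMinuscule J ω O) (hv : v ∈ O) : ∃ p, Reach J ω K v p := by
  induction v, hv using hO.height_induction with
  | step v hv ih =>
    obtain rfl | ⟨i, hi, hvi⟩ := hO.eq_or_exists v hv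
    · exact ⟨_, base⟩
    · obtain ⟨p, hp⟩ := ih _ (hO.reflect_mem v hv i hi) (by rw [height_reflect]; omega)
      exact ⟨_, step hi hvi hp⟩

theorem unique (hO : IsMinuscule J ω O) (hp : Reach J ω K v p) (hq : Reach J ω K v q) :
    p = q := by
  have hv := hp.mem hO
  induction v, hv using hO.height_induction generalizing p q with
  | step v hv ih =>
    cases hp with
    | base =>
      cases hq with
      | base => rfl
      | step hi hvi _ => have := hO.dominant _ hi; omega
    | @step i _ p hi hvi hp =>
      cases hq with
      | base => have := hO.dominant _ hi; omega
      | @step j _ q hj hvj hq =>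
        have hpO := hp.mem hO
        have hqO := hq.mem hO
        have hpv : height v < height (reflect i v) := by rw [height_reflect]; omega
        have hqv : height v < height (reflect j v) := by rw [height_reflect]; omega
        obtain ⟨rfl, -⟩ | ⟨hij, -⟩ | ⟨hij, -⟩ := entry_cases i j
        · rw [ih _ hpO hpv hp hq]
        · have hcomm : reflect i (reflect j v) = reflect j (reflect i v) := by
            simp only [← simple_smul, smul_smul, simple_comm hij]
          have hvij : reflect i v j = -1 := by simp [reflect, hij, hvj]
          have hvji : reflect j v i = -1 := by simp [reflect, cartan_comm j i, hij, hvi]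
          obtain ⟨r, hr⟩ := exists_of_mem (K := K) hO (hO.reflect_mem _ hpO j hj)
          rw [ih _ hpO hpv hp (step hj hvij hr),
            ih _ hqO hqv hq (step hi hvji (hcomm ▸ hr)), smul_smul, smul_smul, simple_comm hij]
        · have hb := (hO.bounded _ hpO j hj).1
          simp only [reflect, hij, hvi, hvj] at hb
          omega

theorem smul_eq_self (hO : IsMinuscule J ω O) (hK : ∀ i ∈ J, ω i = 0 → s i ∈ K) {j : Fin 6}
    (hj : j ∈ J) (hvj : v j = 0) (hp : Reach J ω K v p) : s j • p = p := by
  have hv := hp.mem hO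
  induction v, hv using hO.height_induction generalizing p j with
  | step v hv ih =>
    cases hp with
    | base => exact QuotientGroup.eq.mpr (by simpa using hK j hj hvj)
    | @step i _ p hi hvi hp =>
      have hpO := hp.mem hO
      have hpv : height v < height (reflect i v) := by rw [height_reflect]; omega
      obtain ⟨rfl, -⟩ | ⟨hij, -⟩ | ⟨hij, -⟩ := entry_cases i j
      · omega
      · rw [smul_smul, ← simple_comm hij, ← smul_smul,
          ih _ hpO hpv hj (by simp [reflect, hij, hvj]) hp]
      · have huj : reflect i v j = -1 := by simp [reflect, hij, hvi, hvj]
        obtain ⟨r, hr⟩ := exists_of_mem (K := K) hO (hO.reflect_mem _ hpO j hj)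
        have hri : s i • r = r := by
          refine ih _ (hr.mem hO) ?_ hi ?_ hr
          · rw [height_reflect]; omega
          · simp [reflect, cartan_comm j i, hij, hvi, hvj]
        rw [unique hO hp (step hj huj hr), smul_smul, smul_smul, ← simple_braid hij, mul_smul, hri,
          mul_smul]

theorem smul_simple (hO : IsMinuscule J ω O) (hK : ∀ i ∈ J, ω i = 0 → s i ∈ K) {i : Fin 6}
    (hi : i ∈ J) (hp : Reach J ω K v p) : Reach J ω K (reflect i v) (s i • p) := by
  have hv := hp.mem hO
  have hb := hO.bounded _ hv i hi
  obtain h | h | h : v i = 1 ∨ v i = 0 ∨ v i = -1 := by omega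
  · exact hp.lower hi h
  · rw [smul_eq_self hO hK hi h hp]
    rwa [reflect_eq_self h]
  · obtain ⟨q, hq⟩ := exists_of_mem (K := K) hO (hO.reflect_mem _ hv i hi)
    rwa [unique hO hp (step hi h hq), smul_smul, simple_mul_self, one_smul]

theorem smul (hO : IsMinuscule J ω O) (hK : ∀ i ∈ J, ω i = 0 → s i ∈ K) {g : W}
    (hg : g ∈ parabolic J) (hp : Reach J ω K v p) : Reach J ω K (g • v) (g • p) := by
  induction hg using Subgroup.closure_induction_left generalizing v p with
  | one => simpa using hp
  | mul_left x hx y _ ih =>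
    obtain ⟨i, hi, rfl⟩ := hx
    rw [mul_smul, mul_smul, simple_smul]
    exact (ih hp).smul_simple hO hK hi
  | inv_mul_cancel x hx y _ ih =>
    obtain ⟨i, hi, rfl⟩ := hx
    rw [inv_eq_of_mul_eq_one_left (simple_mul_self i), mul_smul, mul_smul, simple_smul]
    exact (ih hp).smul_simple hO hK hi

end Reach

namespace IsMinuscule

variable {J : Finset (Fin 6)} {ω : Fin 6 → ℤ} {O : Finset (Fin 6 → ℤ)}

/-- The stabilizer of `ω` in the parabolic subgroup is generated by simple reflections. -/
theorem mem_of_smul_eq (hO : IsMinuscule J ω O) {K : Subgroup W}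
    (hK : ∀ i ∈ J, ω i = 0 → s i ∈ K) {g : W} (hg : g ∈ parabolic J) (h : g • ω = ω) : g ∈ K := by
  have hr := (Reach.base (J := J) (ω := ω) (K := K)).smul hO hK hg
  rw [h] at hr
  simpa using QuotientGroup.eq.mp (Reach.base.unique hO hr)

theorem relIndex_eq (hO : IsMinuscule J ω O) :
    (parabolic {i ∈ J | ω i = 0}).relIndex (parabolic J) = O.card := by
  have hK : ∀ i ∈ J, ω i = 0 → s i ∈ parabolic {i ∈ J | ω i = 0} := fun i hi h ↦
    simple_mem_parabolic (by simp [hi, h])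
  have hstab : (parabolic {i ∈ J | ω i = 0}).subgroupOf (parabolic J) =
      MulAction.stabilizer (parabolic J) ω := by
    ext ⟨g, hg⟩
    rw [Subgroup.mem_subgroupOf, MulAction.mem_stabilizer_iff]
    refine ⟨fun h ↦ ?_, hO.mem_of_smul_eq hK hg⟩
    have hle : parabolic {i ∈ J | ω i = 0} ≤ MulAction.stabilizer W ω := by
      rw [parabolic, Subgroup.closure_le]
      rintro _ ⟨i, hi, rfl⟩
      have hi : ω i = 0 := by simp at hi; exact hi.2
      simp [simple_smul, reflect_eq_self hi]
    exact hle h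
  have horb : MulAction.orbit (parabolic J) ω = O := by
    ext v
    refine ⟨?_, fun hv ↦ ?_⟩
    · rintro ⟨⟨g, hg⟩, rfl⟩
      exact ((Reach.base (K := ⊤)).smul hO (by simp) hg).mem hO
    · obtain ⟨p, hp⟩ := Reach.exists_of_mem (K := ⊤) hO hv
      obtain ⟨g, hg, rfl⟩ := hp.exists_smul
      exact ⟨⟨g, hg⟩, rfl⟩
  rw [Subgroup.relIndex, hstab, MulAction.index_stabilizer, horb, Set.ncard_coe_finset]

end IsMinuscule

/-- The weights of the 27-dimensional representation of `E₆`. -/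
def weightsE₆ : Finset (Fin 6 → ℤ) :=
  {![0, 0, 0, 0, 0, 1], ![0, 0, 0, 0, 1, -1], ![0, 0, 0, 1, -1, 0], ![0, 1, 1, -1, 0, 0],
    ![0, -1, 1, 0, 0, 0], ![1, 1, -1, 0, 0, 0], ![1, -1, -1, 1, 0, 0], ![-1, 1, 0, 0, 0, 0],
    ![-1, -1, 0, 1, 0, 0], ![1, 0, 0, -1, 1, 0], ![-1, 0, 1, -1, 1, 0], ![1, 0, 0, 0, -1, 1],
    ![0, 0, -1, 0, 1, 0], ![-1, 0, 1, 0, -1, 1], ![1, 0, 0, 0, 0, -1], ![0, 0, -1, 1, -1, 1],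
    ![-1, 0, 1, 0, 0, -1], ![0, 1, 0, -1, 0, 1], ![0, 0, -1, 1, 0, -1], ![0, -1, 0, 0, 0, 1],
    ![0, 1, 0, -1, 1, -1], ![0, -1, 0, 0, 1, -1], ![0, 1, 0, 0, -1, 0], ![0, -1, 0, 1, -1, 0],
    ![0, 0, 1, -1, 0, 0], ![1, 0, -1, 0, 0, 0], ![-1, 0, 0, 0, 0, 0]}

/-- The orbit of the fundamental weight `Pi.single 4 1`
under the parabolic subgroup of type `D₅`. -/
def weightsD₅ : Finset (Fin 6 → ℤ) :=
  {![0, 0, 0, 0, 1, 0], ![0, 0, 0, 1, -1, 1], ![0, 1, 1, -1, 0, 1], ![0, -1, 1, 0, 0, 1],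
    ![1, 1, -1, 0, 0, 1], ![1, -1, -1, 1, 0, 1], ![-1, 1, 0, 0, 0, 1], ![-1, -1, 0, 1, 0, 1],
    ![1, 0, 0, -1, 1, 1], ![-1, 0, 1, -1, 1, 1], ![1, 0, 0, 0, -1, 2], ![0, 0, -1, 0, 1, 1],
    ![-1, 0, 1, 0, -1, 2], ![0, 0, -1, 1, -1, 2], ![0, 1, 0, -1, 0, 2], ![0, -1, 0, 0, 0, 2]}

/-- The orbit of the fundamental weight `Pi.single 1 1`
under the parabolic subgroup of type `A₄`. -/
def weightsA₄ : Finset (Fin 6 → ℤ) :=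
  {![0, 1, 0, 0, 0, 0], ![0, -1, 0, 1, 0, 0], ![0, 0, 1, -1, 1, 0], ![1, 0, -1, 0, 1, 0],
    ![-1, 0, 0, 0, 1, 0]}

/-- The orbit of the fundamental weight `Pi.single 3 1`
under the parabolic subgroup of type `A₃`. -/
def weightsA₃ : Finset (Fin 6 → ℤ) :=
  {![0, 0, 0, 1, 0, 0], ![0, 1, 1, -1, 1, 0], ![1, 1, -1, 0, 1, 0], ![-1, 1, 0, 0, 1, 0]}

/-- The orbit of the fundamental weight `Pi.single 2 1`
under the parabolic subgroup of type `A₂`. -/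
def weightsA₂ : Finset (Fin 6 → ℤ) :=
  {![0, 0, 1, 0, 0, 0], ![1, 0, -1, 1, 0, 0], ![-1, 0, 0, 1, 0, 0]}

/-- The orbit of the fundamental weight `Pi.single 0 1`
under the parabolic subgroup of type `A₁`. -/
def weightsA₁ : Finset (Fin 6 → ℤ) :=
  {![1, 0, 0, 0, 0, 0], ![-1, 0, 1, 0, 0, 0]}

theorem isMinuscule_E₆ : IsMinuscule Finset.univ (Pi.single 5 1) weightsE₆ := by
  constructor <;> decide +kernel

theorem isMinuscule_D₅ : IsMinuscule {0, 1, 2, 3, 4} (Pi.single 4 1) weightsD₅ := by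
  constructor <;> decide +kernel

theorem isMinuscule_A₄ : IsMinuscule {0, 1, 2, 3} (Pi.single 1 1) weightsA₄ := by
  constructor <;> decide +kernel

theorem isMinuscule_A₃ : IsMinuscule {0, 2, 3} (Pi.single 3 1) weightsA₃ := by
  constructor <;> decide +kernel

theorem isMinuscule_A₂ : IsMinuscule {0, 2} (Pi.single 2 1) weightsA₂ := by
  constructor <;> decide +kernel

theorem isMinuscule_A₁ : IsMinuscule {0} (Pi.single 0 1) weightsA₁ := by
  constructor <;> decide +kernel

theorem parabolic_univ : parabolic Finset.univ = ⊤ := by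
  simpa [parabolic] using CoxeterMatrix.E₆.toCoxeterSystem.subgroup_closure_range_simple

theorem parabolic_empty : parabolic ∅ = ⊥ := by
  simp [parabolic]

theorem IsMinuscule.card_parabolic {J J' : Finset (Fin 6)} {ω : Fin 6 → ℤ}
    {O : Finset (Fin 6 → ℤ)} (hO : IsMinuscule J ω O) (hJ : {i ∈ J | ω i = 0} = J') :
    Nat.card (parabolic J) = Nat.card (parabolic J') * O.card := by
  subst hJ
  rw [← hO.relIndex_eq, ← Subgroup.relIndex_bot_left, ← Subgroup.relIndex_bot_left,
    Subgroup.relIndex_mul_relIndex _ _ _ bot_le (parabolic_mono (Finset.filter_subset _ _))]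

theorem card_W : Nat.card W = 51840 := by
  rw [← Subgroup.card_top, ← parabolic_univ,
    isMinuscule_E₆.card_parabolic (J' := {0, 1, 2, 3, 4}) (by decide +kernel),
    isMinuscule_D₅.card_parabolic (J' := {0, 1, 2, 3}) (by decide +kernel),
    isMinuscule_A₄.card_parabolic (J' := {0, 2, 3}) (by decide +kernel),
    isMinuscule_A₃.card_parabolic (J' := {0, 2}) (by decide +kernel),
    isMinuscule_A₂.card_parabolic (J' := {0}) (by decide +kernel),
    isMinuscule_A₁.card_parabolic (J' := ∅) (by decide +kernel),
    parabolic_empty, Subgroup.card_bot]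
  decide +kernel

theorem weightRep_injective : Function.Injective weightRep := by
  refine (injective_iff_map_eq_one weightRep).mpr fun g hg ↦ ?_
  have hfix (v : Fin 6 → ℤ) : g • v = v := by rw [smul_def, hg, one_mulVec]
  have hstep {J : Finset (Fin 6)} {ω : Fin 6 → ℤ} {O : Finset (Fin 6 → ℤ)}
      (hO : IsMinuscule J ω O) (hJ : g ∈ parabolic J) : g ∈ parabolic {i ∈ J | ω i = 0} :=
    hO.mem_of_smul_eq (fun i hi h ↦ simple_mem_parabolic (by simp [hi, h])) hJ (hfix ω)
  have h := hstep isMinuscule_E₆ (parabolic_univ ▸ Subgroup.mem_top g)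
  have h := hstep isMinuscule_D₅ h
  have h := hstep isMinuscule_A₄ h
  have h := hstep isMinuscule_A₃ h
  have h := hstep isMinuscule_A₂ h
  have h := hstep isMinuscule_A₁ h
  rw [← Subgroup.mem_bot, ← parabolic_empty]
  exact h

/-- The homomorphism from the cyclic group of order three sending a generator to `g`. -/
def zmodThreeHom {G : Type*} [Group G] (g : G) (hg : g ^ 3 = 1) :
    Multiplicative (ZMod 3) →* G where
  toFun x := g ^ x.toAdd.val
  map_one' := by simp
  map_mul' x y := by
    rw [← pow_add, toAdd_mul, ZMod.val_add, ← pow_eq_pow_mod _ hg]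

theorem eq_one_of_zmodThreeHom_smul_eq {G X : Type*} [Group G] [MulAction G X] {g : G}
    (hg : g ^ 3 = 1) {v : X} (hv : g • v ≠ v) {x : Multiplicative (ZMod 3)}
    (hx : zmodThreeHom g hg x • v = v) : x = 1 := by
  obtain ⟨n, hn⟩ : ∃ n, n = x.toAdd.val := ⟨_, rfl⟩
  have hlt : n < 3 := hn ▸ ZMod.val_lt _
  change g ^ x.toAdd.val • v = v at hx
  rw [← hn] at hx
  interval_cases n
  · exact (ZMod.val_eq_zero _).mp hn.symm
  · exact absurd (by simpa using hx) hv
  · refine absurd ?_ hv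
    conv_lhs => rw [← hx]
    rw [smul_smul, ← pow_succ', hg, one_smul]

/-- An element of order three commuting with `s 0`, `s 2`, `s 4` and `s 5`: the product of `s 1`
and a reflection. -/
def longElement : W :=
  ([1, 3, 2, 0, 4, 3, 1, 2, 3, 4, 5, 4, 3, 1, 2, 0, 3, 2, 4, 3].map s).prod

theorem weightRep_longElement : weightRep longElement =
    ([1, 3, 2, 0, 4, 3, 1, 2, 3, 4, 5, 4, 3, 1, 2, 0, 3, 2, 4, 3].map reflection).prod := by
  rw [longElement, map_list_prod, List.map_map]
  congr 2
  exact funext weightRep_simple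

theorem weightRep_simple_mul_simple (i j : Fin 6) :
    weightRep (s i * s j) = reflection i * reflection j := by
  rw [map_mul, weightRep_simple, weightRep_simple]

/-- `W` contains an elementary abelian subgroup of order 27. -/
theorem exists_elementary_abelian : ∃ f : Multiplicative (ZMod 3) × Multiplicative (ZMod 3) ×
    Multiplicative (ZMod 3) →* W, Function.Injective f := by
  have ha : (s 0 * s 2) ^ 3 = 1 := weightRep_injective <| by
    rw [map_pow, weightRep_simple_mul_simple, map_one]
    decide +kernel
  have hb : (s 4 * s 5) ^ 3 = 1 := weightRep_injective <| by
    rw [map_pow, weightRep_simple_mul_simple, map_one]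
    decide +kernel
  have hc : longElement ^ 3 = 1 := weightRep_injective <| by
    rw [map_pow, weightRep_longElement, map_one]
    decide +kernel
  have hab : Commute (s 0 * s 2) (s 4 * s 5) := weightRep_injective <| by
    simp only [map_mul, weightRep_simple]
    decide +kernel
  have hac : Commute (s 0 * s 2) longElement := weightRep_injective <| by
    simp only [map_mul, weightRep_simple, weightRep_longElement]
    decide +kernel
  have hbc : Commute (s 4 * s 5) longElement := weightRep_injective <| by
    simp only [map_mul, weightRep_simple, weightRep_longElement]
    decide +kernel
  have hmem {g : W} (hg : g ^ 3 = 1) {v : Fin 6 → ℤ} (h : g • v = v)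
      (x : Multiplicative (ZMod 3)) : zmodThreeHom g hg x ∈ MulAction.stabilizer W v :=
    pow_mem (S := MulAction.stabilizer W v) h _
  let f := (zmodThreeHom _ hb).noncommCoprod (zmodThreeHom _ hc) fun _ _ ↦ hbc.pow_pow _ _
  refine ⟨(zmodThreeHom _ ha).noncommCoprod f fun x y ↦
    (hab.pow_pow _ _).mul_right (hac.pow_pow _ _), ?_⟩
  refine (injective_iff_map_eq_one _).mpr fun ⟨x, y, z⟩ h ↦ ?_
  change zmodThreeHom _ ha x * (zmodThreeHom _ hb y * zmodThreeHom _ hc z) = 1 at h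
  have hS (v : Fin 6 → ℤ) : zmodThreeHom _ ha x * (zmodThreeHom _ hb y * zmodThreeHom _ hc z) ∈
      MulAction.stabilizer W v := h ▸ one_mem _
  have hx : x = 1 := by
    refine eq_one_of_zmodThreeHom_smul_eq ha (v := (![-2, 0, 1, 0, 0, 0] : Fin 6 → ℤ)) ?_ ?_
    · rw [smul_def, weightRep_simple_mul_simple]; decide +kernel
    · refine (Subgroup.mul_mem_cancel_right _ (mul_mem (hmem hb ?_ y) (hmem hc ?_ z))).mp (hS _)
      · rw [smul_def, weightRep_simple_mul_simple]; decide +kernel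
      · rw [smul_def, weightRep_longElement]; decide +kernel
  have hy : y = 1 := by
    refine eq_one_of_zmodThreeHom_smul_eq hb (v := (![0, 0, 0, 0, 1, -2] : Fin 6 → ℤ)) ?_ ?_
    · rw [smul_def, weightRep_simple_mul_simple]; decide +kernel
    · refine (Subgroup.mul_mem_cancel_right _ (hmem hc ?_ z)).mp
        ((Subgroup.mul_mem_cancel_left _ (hmem ha ?_ x)).mp (hS _))
      · rw [smul_def, weightRep_longElement]; decide +kernel
      · rw [smul_def, weightRep_simple_mul_simple]; decide +kernel
  have hz : z = 1 := by
    refine eq_one_of_zmodThreeHom_smul_eq hc (v := (![0, 1, 0, 0, 0, 0] : Fin 6 → ℤ)) ?_ ?_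
    · rw [smul_def, weightRep_longElement]; decide +kernel
    · refine (Subgroup.mul_mem_cancel_left _ (hmem hb ?_ y)).mp
        ((Subgroup.mul_mem_cancel_left _ (hmem ha ?_ x)).mp (hS _))
      · rw [smul_def, weightRep_simple_mul_simple]; decide +kernel
      · rw [smul_def, weightRep_simple_mul_simple]; decide +kernel
  rw [hx, hy, hz]
  rfl

end CoxeterE6

/-- Every Sylow 3-subgroup `P` of the Weyl group `W(E₆)` (realized as the Coxeter group
of type `E₆`) has order 81, and `P` contains a normal subgroup of index 3 isomorphic to
the elementary abelian group `(ℤ/3ℤ)³` of order 27. -/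
theorem sylow_three_E6_structure
    (P : Sylow 3 CoxeterMatrix.E₆.Group) :
    Nat.card (P : Subgroup CoxeterMatrix.E₆.Group) = 81 ∧
    ∃ N : Subgroup (P : Subgroup CoxeterMatrix.E₆.Group), N.Normal ∧ N.index = 3 ∧
      Nonempty (N ≃* (Multiplicative (ZMod 3) × Multiplicative (ZMod 3) ×
        Multiplicative (ZMod 3))) := by
  have : Finite CoxeterMatrix.E₆.Group := Nat.finite_of_card_ne_zero (by
    rw [CoxeterE6.card_W]; decide)
  have : Fact (Nat.Prime 3) := ⟨Nat.prime_three⟩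
  have hP : Nat.card (P : Subgroup CoxeterMatrix.E₆.Group) = 81 := by
    have h : (51840 : ℕ) = 3 ^ 4 * 640 := by norm_num
    rw [P.card_eq_multiplicity, CoxeterE6.card_W, h,
      Nat.factorization_mul (by norm_num) (by norm_num), Finsupp.add_apply,
      Nat.prime_three.factorization_pow, Finsupp.single_eq_same,
      Nat.factorization_eq_zero_of_not_dvd (by norm_num)]
    rfl
  refine ⟨hP, ?_⟩
  obtain ⟨f, hf⟩ := CoxeterE6.exists_elementary_abelian
  have hE : Nat.card (Multiplicative (ZMod 3) × Multiplicative (ZMod 3) ×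
      Multiplicative (ZMod 3)) = 3 ^ 3 := by
    simp
  have hfcard : Nat.card f.range = 3 ^ 3 := by
    rw [← Nat.card_congr (MonoidHom.ofInjective hf).toEquiv, hE]
  obtain ⟨Q, hQ⟩ := (IsPGroup.of_card hfcard).exists_le_sylow
  let φ := (Sylow.equiv Q P).toMonoidHom.comp (f.codRestrict Q fun x ↦ hQ ⟨x, rfl⟩)
  have hφ : Function.Injective φ :=
    (Sylow.equiv Q P).injective.comp fun x y h ↦ hf (congrArg Subtype.val h)
  have hindex : φ.range.index = 3 := by
    have h := φ.range.card_mul_index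
    rw [← Nat.card_congr (MonoidHom.ofInjective hφ).toEquiv, hE, hP] at h
    omega
  refine ⟨φ.range, Subgroup.normal_of_index_eq_minFac_card ?_, hindex,
    ⟨(MonoidHom.ofInjective hφ).symm⟩⟩
  rw [hindex, hP]
  norm_num
end
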